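/- Given a natural number n > 0, the following statements are equivalent for every C^(n)-weakly shrewd cardinal κ: (1) κ is C^(n)-strongly unfoldable; (2) κ is an element of C^(n+1); (3) there is no ordinal ε ≥ κ with the property that the set {ε} is definable by a Σ_{n+1}-formula with parameters in H(κ). -/

import Mathlib

namespace Paper

/-- First-order formulas in the language of set theory (one binary relation, membership),
using de Bruijn variables; `all` binds the last variable. -/
inductive SetFormula : ℕ → Type
  | mem {n : ℕ} (i j : Fin n) : SetFormula n
  | eq {n : ℕ} (i j : Fin n) : SetFormula n
  | fal {n : ℕ} : SetFormula n
  | imp {n : ℕ} (φ ψ : SetFormula n) : SetFormula n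
  | all {n : ℕ} (φ : SetFormula (n + 1)) : SetFormula n

namespace SetFormula

/-- Negation. -/
def not {n : ℕ} (φ : SetFormula n) : SetFormula n := φ.imp .fal

/-- Conjunction. -/
def and {n : ℕ} (φ ψ : SetFormula n) : SetFormula n := (φ.imp ψ.not).not

/-- Existential quantification (over the last variable). -/
def ex {n : ℕ} (φ : SetFormula (n + 1)) : SetFormula n := (SetFormula.all φ.not).not

end SetFormula

/-- Satisfaction of a set-theoretic formula in a structure `(M, E)`, where `E` interprets
the membership relation. -/
def Realize {M : Type*} (E : M → M → Prop) : ∀ {n : ℕ}, SetFormula n → (Fin n → M) → Prop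
  | _, .mem i j, v => E (v i) (v j)
  | _, .eq i j, v => v i = v j
  | _, .fal, _ => False
  | _, .imp φ ψ, v => Realize E φ v → Realize E ψ v
  | _, .all φ, v => ∀ a, Realize E φ (Fin.snoc v a)

/-- Satisfaction of a formula relativized to the subclass `S` of `M`; all quantifiers
range over `S`, and the assignment is required to take values in `S`. -/
def RealizeIn {M : Type*} (E : M → M → Prop) (S : M → Prop) {n : ℕ}
    (φ : SetFormula n) (v : Fin n → M) : Prop :=
  ∃ h : ∀ i, S (v i),
    Realize (fun a b : {x : M // S x} => E a.1 b.1) φ fun i => ⟨v i, h i⟩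

/-- `Δ₀`-formulas: formulas all of whose quantifiers are bounded. -/
inductive IsDelta0 : ∀ {n : ℕ}, SetFormula n → Prop
  | mem {n : ℕ} (i j : Fin n) : IsDelta0 (.mem i j)
  | eq {n : ℕ} (i j : Fin n) : IsDelta0 (.eq i j)
  | fal {n : ℕ} : IsDelta0 (n := n) .fal
  | imp {n : ℕ} {φ ψ : SetFormula n} : IsDelta0 φ → IsDelta0 ψ → IsDelta0 (φ.imp ψ)
  | ball {n : ℕ} (j : Fin n) {φ : SetFormula (n + 1)} :
      IsDelta0 φ → IsDelta0 (.all ((SetFormula.mem (Fin.last n) j.castSucc).imp φ))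
  | bex {n : ℕ} (j : Fin n) {φ : SetFormula (n + 1)} :
      IsDelta0 φ → IsDelta0 (SetFormula.ex ((SetFormula.mem (Fin.last n) j.castSucc).and φ))

mutual
  /-- `Σₙ`-formulas of the Lévy hierarchy. -/
  inductive IsSigma : ℕ → ∀ {n : ℕ}, SetFormula n → Prop
    | ofDelta0 {k n : ℕ} {φ : SetFormula n} : IsDelta0 φ → IsSigma k φ
    | ofPi {k n : ℕ} {φ : SetFormula n} : IsPi k φ → IsSigma (k + 1) φ
    | ex {k n : ℕ} {φ : SetFormula (n + 1)} : IsSigma (k + 1) φ → IsSigma (k + 1) φ.ex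
  /-- `Πₙ`-formulas of the Lévy hierarchy. -/
  inductive IsPi : ℕ → ∀ {n : ℕ}, SetFormula n → Prop
    | ofDelta0 {k n : ℕ} {φ : SetFormula n} : IsDelta0 φ → IsPi k φ
    | ofSigma {k n : ℕ} {φ : SetFormula n} : IsSigma k φ → IsPi (k + 1) φ
    | all {k n : ℕ} {φ : SetFormula (n + 1)} : IsPi (k + 1) φ → IsPi (k + 1) φ.all
end

end Paper
namespace Paper

section Generic

variable {M : Type*} (E : M → M → Prop)

/-- `x` is a transitive set (relative to the membership relation `E`). -/
def TransE (x : M) : Prop := ∀ y, E y x → ∀ z, E z y → E z x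

/-- `x` is an ordinal: a transitive set all of whose elements are transitive. -/
def OrdE (x : M) : Prop := TransE E x ∧ ∀ y, E y x → TransE E y

/-- `a ⊆ b`. -/
def SubE (a b : M) : Prop := ∀ z, E z a → E z b

/-- `a ≤ b` for ordinals. -/
def LeE (a b : M) : Prop := E a b ∨ a = b

/-- `x` is the empty set. -/
def EmptyE (x : M) : Prop := ∀ z, ¬ E z x

/-- `s = y ∪ {y}`. -/
def SuccSpecE (s y : M) : Prop := ∀ z, E z s ↔ (E z y ∨ z = y)

/-- `l` is a (nonzero) limit ordinal. -/
def LimitE (l : M) : Prop := OrdE E l ∧ (∃ w, E w l) ∧ ∀ α, E α l → ∃ β, E β l ∧ E α β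

/-- `w` is the first infinite ordinal `ω`. -/
def OmegaSpecE (w : M) : Prop := LimitE E w ∧ ∀ x, E x w → ¬ LimitE E x

/-- `x` is an infinite ordinal, i.e. an ordinal with `ω ≤ x`. -/
def InfiniteOrdE (x : M) : Prop := OrdE E x ∧ ∃ w, OmegaSpecE E w ∧ LeE E w x

/-- `p = {a, b}`. -/
def UPairE (p a b : M) : Prop := ∀ z, E z p ↔ (z = a ∨ z = b)

/-- `p` is the Kuratowski ordered pair `⟨a, b⟩`. -/
def OPairE (p a b : M) : Prop :=
  ∃ s t, UPairE E s a a ∧ UPairE E t a b ∧ UPairE E p s t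

/-- The ordered pair `⟨x, y⟩` is an element of `f`. -/
def PairMemE (f x y : M) : Prop := ∃ p, E p f ∧ OPairE E p x y

/-- `f` is (the graph of) a function from `a` to `b`. -/
def IsFuncE (f a b : M) : Prop :=
  (∀ p, E p f → ∃ x y, E x a ∧ E y b ∧ OPairE E p x y) ∧
    ∀ x, E x a → (∃ y, PairMemE E f x y) ∧
      ∀ y y', PairMemE E f x y → PairMemE E f x y' → y = y'

/-- `f` is a surjection from `a` onto `b`. -/
def SurjE (f a b : M) : Prop :=
  IsFuncE E f a b ∧ ∀ y, E y b → ∃ x, E x a ∧ PairMemE E f x y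

/-- `f` is an injection from `a` into `b`. -/
def InjE (f a b : M) : Prop :=
  IsFuncE E f a b ∧ ∀ x x' y, E x a → E x' a →
    PairMemE E f x y → PairMemE E f x' y → x = x'

/-- `f` is a bijection between `a` and `b`. -/
def BijE (f a b : M) : Prop := SurjE E f a b ∧ InjE E f a b

/-- `κ` is a cardinal: an ordinal not in bijection with any of its elements. -/
def CardE (κ : M) : Prop := OrdE E κ ∧ ∀ α, E α κ → ¬ ∃ f, BijE E f α κ

/-- `κ` is an infinite cardinal. -/
def InfCardE (κ : M) : Prop := CardE E κ ∧ InfiniteOrdE E κ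

/-- `b = a ∩ c`. -/
def InterSpecE (b a c : M) : Prop := ∀ z, E z b ↔ (E z a ∧ E z c)

/-- `c` is unbounded in the ordinal `κ`. -/
def UnboundedInE (c κ : M) : Prop := ∀ α, E α κ → ∃ β, E β c ∧ E α β

/-- `c` is closed in the ordinal `κ`: it contains each of its limit points below `κ`. -/
def ClosedInE (c κ : M) : Prop :=
  ∀ l, E l κ → (∃ w, E w l) → (∀ α, E α l → ∃ β, E β c ∧ E α β ∧ E β l) → E l c

/-- `c` is a closed unbounded subset of the ordinal `κ`. -/
def ClubInE (c κ : M) : Prop := SubE E c κ ∧ UnboundedInE E c κ ∧ ClosedInE E c κ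

/-- `f` is (the graph of) a sequence `⟨A_α | α < κ⟩` with `A_α ⊆ α` for all `α < κ`. -/
def SeqSpecE (f κ : M) : Prop :=
  ∀ α, E α κ → (∃ A, PairMemE E f α A ∧ SubE E A α) ∧
    ∀ A A', PairMemE E f α A → PairMemE E f α A' → A = A'

/-- `κ` is a subtle cardinal. -/
def SubtleE (κ : M) : Prop :=
  InfCardE E κ ∧ ∀ f, SeqSpecE E f κ → ∀ c, ClubInE E c κ →
    ∃ α β, E α c ∧ E β c ∧ E α β ∧
      ∃ A B, PairMemE E f α A ∧ PairMemE E f β B ∧ InterSpecE E A B α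

/-- `κ` is a regular ordinal: every function from an element of `κ` to `κ` has
bounded range. -/
def RegularE (κ : M) : Prop :=
  OrdE E κ ∧ ∀ γ f, E γ κ → IsFuncE E f γ κ →
    ∃ β, E β κ ∧ ∀ x y, PairMemE E f x y → E y β

/-- `p = 𝒫(a)`. -/
def PowSpecE (p a : M) : Prop := ∀ z, E z p ↔ SubE E z a

/-- `κ` is a strong limit cardinal: for every `α < κ`, `2^|α| < κ`. -/
def StrongLimitE (κ : M) : Prop :=
  ∀ α, E α κ → ∀ p, PowSpecE E p α → ∃ β f, E β κ ∧ InjE E f p β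

/-- `κ` is a strongly inaccessible cardinal: an uncountable regular strong limit
cardinal. -/
def InaccE (κ : M) : Prop :=
  CardE E κ ∧ (∃ w, OmegaSpecE E w ∧ E w κ) ∧ RegularE E κ ∧ StrongLimitE E κ

/-- `z` belongs to the transitive closure of `x`. -/
def TCMemE (z x : M) : Prop := ∀ t, TransE E t → SubE E x t → E z t

/-- `x ∈ H(θ)`: the transitive closure of `x` has cardinality less than `θ`. -/
def HMemE (x θ : M) : Prop :=
  ∃ t, TransE E t ∧ SubE E x t ∧ ∃ β f, E β θ ∧ SurjE E f β t

/-- `f` is (the graph of) the cumulative-hierarchy sequence `⟨V_β | β < α⟩`,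
determined by the recursion `V_β = {z | ∃ γ < β, z ⊆ V_γ}`. -/
def VHierE (f α : M) : Prop :=
  OrdE E α ∧ ∀ β, E β α →
    (∃ w, PairMemE E f β w ∧
      ∀ z, E z w ↔ ∃ γ, E γ β ∧ ∃ u, PairMemE E f γ u ∧ SubE E z u) ∧
    ∀ w w', PairMemE E f β w → PairMemE E f β w' → w = w'

/-- `x ∈ V_α`. -/
def VMemE (x α : M) : Prop :=
  OrdE E α ∧ ∃ f, VHierE E f α ∧ ∃ β u, E β α ∧ PairMemE E f β u ∧ SubE E x u

/-- The class `S` is a `Σₙ`-elementary subclass of the class `T`. -/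
def SigmaElemPairE (n : ℕ) (S T : M → Prop) : Prop :=
  (∀ x, S x → T x) ∧
    ∀ ⦃k : ℕ⦄ (φ : SetFormula k), IsSigma n φ → ∀ v : Fin k → M, (∀ i, S (v i)) →
      (RealizeIn E S φ v ↔ RealizeIn E T φ v)

/-- The class `S` is a (fully) elementary subclass of the class `T`. -/
def ElemPairE (S T : M → Prop) : Prop :=
  (∀ x, S x → T x) ∧
    ∀ ⦃k : ℕ⦄ (φ : SetFormula k) (v : Fin k → M), (∀ i, S (v i)) →
      (RealizeIn E S φ v ↔ RealizeIn E T φ v)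

/-- `j` is an elementary map from the class `S` into the class `T`. -/
def ElemMapE (S T : M → Prop) (j : M → M) : Prop :=
  (∀ x, S x → T (j x)) ∧
    ∀ ⦃k : ℕ⦄ (φ : SetFormula k) (v : Fin k → M), (∀ i, S (v i)) →
      (RealizeIn E S φ v ↔ RealizeIn E T φ fun i => j (v i))

/-- `α ∈ C⁽ⁿ⁾`: the ordinal `α` is `Σₙ`-correct, i.e. `V_α` is a `Σₙ`-elementary
submodel of the universe. -/
def CnE (n : ℕ) (α : M) : Prop :=
  OrdE E α ∧ SigmaElemPairE E n (fun x => VMemE E x α) fun _ => True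

/-- `κ` is a weakly shrewd cardinal. -/
def WeaklyShrewdE (κ : M) : Prop :=
  CardE E κ ∧ ∀ (φ : SetFormula 2) (θ z : M), CardE E θ → E κ θ → SubE E z κ →
    RealizeIn E (fun x => HMemE E x θ) φ ![z, κ] →
    ∃ κ' θ' z', CardE E κ' ∧ CardE E θ' ∧ E κ' θ' ∧ E κ' κ ∧
      InterSpecE E z' z κ' ∧ RealizeIn E (fun x => HMemE E x θ') φ ![z', κ']

/-- `κ` is a `C⁽ⁿ⁾`-weakly shrewd cardinal. -/
def CnWeaklyShrewdE (n : ℕ) (κ : M) : Prop :=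
  CardE E κ ∧ ∀ (φ : SetFormula 2) (θ z : M), CardE E θ → CnE E n θ → E κ θ →
    SubE E z κ → RealizeIn E (fun x => HMemE E x θ) φ ![z, κ] →
    ∃ κ' θ' z', CardE E κ' ∧ CardE E θ' ∧ CnE E n θ' ∧ E κ' θ' ∧ E κ' κ ∧
      InterSpecE E z' z κ' ∧ RealizeIn E (fun x => HMemE E x θ') φ ![z', κ']

/-- Axiom of extensionality for `(M, E)`. -/
def AxExtE : Prop := ∀ x y : M, (∀ z, E z x ↔ E z y) → x = y

/-- Axiom of pairing for `(M, E)`. -/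
def AxPairE : Prop := ∀ a b : M, ∃ p, UPairE E p a b

/-- Axiom of union for `(M, E)`. -/
def AxUnionE : Prop := ∀ a : M, ∃ u, ∀ z, E z u ↔ ∃ y, E y a ∧ E z y

/-- Axiom of power set for `(M, E)`. -/
def AxPowE : Prop := ∀ a : M, ∃ p, PowSpecE E p a

/-- Axiom of infinity for `(M, E)`. -/
def AxInfE : Prop :=
  ∃ I : M, (∃ e, E e I ∧ EmptyE E e) ∧ ∀ y, E y I → ∃ s, E s I ∧ SuccSpecE E s y

/-- Axiom of foundation for `(M, E)`. -/
def AxFoundE : Prop :=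
  ∀ a : M, (∃ z, E z a) → ∃ m, E m a ∧ ∀ z, E z a → ¬ E z m

/-- Separation scheme for `(M, E)`. -/
def AxSepE : Prop :=
  ∀ (k : ℕ) (φ : SetFormula (k + 1)) (p : Fin k → M) (a : M),
    ∃ s : M, ∀ z, E z s ↔ (E z a ∧ Realize E φ (Fin.cons z p))

/-- Replacement scheme for `(M, E)`. -/
def AxReplE : Prop :=
  ∀ (k : ℕ) (φ : SetFormula (k + 2)) (p : Fin k → M) (a : M),
    (∀ x, E x a → ∀ y y', Realize E φ (Fin.cons x (Fin.cons y p)) →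
      Realize E φ (Fin.cons x (Fin.cons y' p)) → y = y') →
    ∃ b : M, ∀ y, E y b ↔ ∃ x, E x a ∧ Realize E φ (Fin.cons x (Fin.cons y p))

/-- Axiom of choice for `(M, E)`. -/
def AxChoiceE : Prop :=
  ∀ a : M, (∀ x, E x a → ∃ z, E z x) →
    (∀ x y, E x a → E y a → x ≠ y → ¬ ∃ z, E z x ∧ E z y) →
    ∃ c, ∀ x, E x a → ∃ z, E z c ∧ E z x ∧ ∀ z', E z' c → E z' x → z' = z

/-- `(M, E)` is a model of `ZF⁻` (Zermelo–Fraenkel set theory without the power set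
axiom). -/
def IsZFMinusE : Prop :=
  AxExtE E ∧ AxPairE E ∧ AxUnionE E ∧ AxInfE E ∧ AxFoundE E ∧ AxSepE E ∧ AxReplE E

/-- `(M, E)` is a model of `ZFC`. -/
def IsZFCE : Prop :=
  Nonempty M ∧ IsZFMinusE E ∧ AxPowE E ∧ AxChoiceE E

/-- The set `m` is, with the induced membership relation, a transitive model
of `ZF⁻`. -/
def ZFMinusModelE (m : M) : Prop :=
  IsZFMinusE fun a b : {x : M // E x m} => E a.1 b.1

/-- `x` has cardinality `κ`. -/
def CardEqE (x κ : M) : Prop := ∃ f, BijE E f κ x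

/-- `m` is closed under sequences of length less than `κ`: `^{<κ}m ⊆ m`. -/
def SmallSeqClosedE (m κ : M) : Prop := ∀ γ f, E γ κ → IsFuncE E f γ m → E f m

/-- `κ` is a `C⁽ⁿ⁾`-strongly unfoldable cardinal. -/
def CnStronglyUnfoldableE (n : ℕ) (κ : M) : Prop :=
  InaccE E κ ∧ ∀ lam, CnE E n lam → E κ lam →
    ∀ m, TransE E m → ZFMinusModelE E m → CardEqE E m κ → E κ m →
      SmallSeqClosedE E m κ →
      ∃ N j κ', TransE E N ∧ (∀ x, VMemE E x lam → E x N) ∧ IsFuncE E j m N ∧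
        (∀ ⦃k : ℕ⦄ (φ : SetFormula k) (v w : Fin k → M), (∀ i, E (v i) m) →
          (∀ i, PairMemE E j (v i) (w i)) →
          (RealizeIn E (fun x => E x m) φ v ↔ RealizeIn E (fun x => E x N) φ w)) ∧
        (∀ α, E α κ → PairMemE E j α α) ∧ PairMemE E j κ κ' ∧ E lam κ' ∧
        SigmaElemPairE E n (fun x => VMemE E x lam) fun x => E x N ∧ VMemE E x κ'

/-- `x` is ordinal definable. -/
def IsODE (x : M) : Prop :=
  ∃ (k : ℕ) (φ : SetFormula (k + 1)) (p : Fin k → M), (∀ i, OrdE E (p i)) ∧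
    Realize E φ (Fin.cons x p) ∧ ∀ y, Realize E φ (Fin.cons y p) → y = x

/-- `x` is hereditarily ordinal definable, i.e. `x ∈ HOD`. -/
def IsHODE (x : M) : Prop := IsODE E x ∧ ∀ z, TCMemE E z x → IsODE E z

/-- The instance of the principle "`Ord` is essentially faint" for the class
sequence `⟨{A | Efam α A} | α ∈ Ord⟩`. -/
def FaintForE (Efam : M → M → Prop) : Prop :=
  (∀ α, OrdE E α → (∃ A, Efam α A) ∧ ∀ A, Efam α A → SubE E A α) →
    ∀ ξ, OrdE E ξ → ∃ α β A B, OrdE E α ∧ OrdE E β ∧ E ξ α ∧ E α β ∧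
      Efam β A ∧ InterSpecE E B A α ∧ Efam α B

/-- `C` is a closed unbounded class of ordinals. -/
def ClubClassE (C : M → Prop) : Prop :=
  (∀ x, C x → OrdE E x) ∧ (∀ α, OrdE E α → ∃ β, C β ∧ E α β) ∧
    ∀ l, OrdE E l → (∃ w, E w l) → (∀ α, E α l → ∃ β, C β ∧ E α β ∧ E β l) → C l

/-- The instance of the principle "`Ord` is essentially subtle" for the class
sequence `⟨{A | Efam α A} | α ∈ Ord⟩` and the class `C`. -/
def SubtleForE (Efam : M → M → Prop) (C : M → Prop) : Prop :=
  (∀ α, OrdE E α → (∃ A, Efam α A) ∧ ∀ A, Efam α A → SubE E A α) →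
    ClubClassE E C →
    ∃ α β A B, C α ∧ C β ∧ E α β ∧ Efam β A ∧ InterSpecE E B A α ∧ Efam α B

/-- The scheme "`Ord` is essentially faint" holds in `(M, E)`: every instance for a
definable (with parameters) class sequence holds. -/
def OrdFaintDefE : Prop :=
  ∀ (k : ℕ) (φ : SetFormula (k + 2)) (p : Fin k → M),
    FaintForE E fun α A => Realize E φ (Fin.cons α (Fin.cons A p))

/-- The scheme "`Ord` is essentially subtle" holds in `(M, E)`: every instance for
definable (with parameters) class sequences and club classes holds. -/
def OrdSubtleDefE : Prop :=
  ∀ (k k' : ℕ) (φ : SetFormula (k + 2)) (p : Fin k → M)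
    (ψ : SetFormula (k' + 1)) (q : Fin k' → M),
    SubtleForE E (fun α A => Realize E φ (Fin.cons α (Fin.cons A p)))
      fun x => Realize E ψ (Fin.cons x q)

/-- There is a proper class of subtle cardinals in `(M, E)`. -/
def ProperClassSubtleE : Prop := ∀ α, OrdE E α → ∃ κ, SubtleE E κ ∧ E α κ

/-- There are no strongly inaccessible cardinals in `(M, E)`. -/
def NoInaccE : Prop := ∀ κ, ¬ InaccE E κ

end Generic

end Paper
namespace Paper

/-- The membership relation on the universe `ZFSet` of sets. -/
def zmem : ZFSet.{0} → ZFSet.{0} → Prop := fun x y => x ∈ y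

/-- The membership relation on the inner model `HOD` of all hereditarily ordinal
definable sets. -/
def hodMem : {x : ZFSet.{0} // IsHODE zmem x} → {x : ZFSet.{0} // IsHODE zmem x} → Prop :=
  fun a b => a.1 ∈ b.1

/-- `κ` is a subtle cardinal in the inner model `HOD`. -/
def IsSubtleInHOD (κ : ZFSet.{0}) : Prop :=
  ∃ h : IsHODE zmem κ, SubtleE hodMem ⟨κ, h⟩

end Paper
namespace Paper

/-- The set `{ε}` is definable by a `Σₙ`-formula with parameters from the class
`P` (over the universe `ZFSet`). -/
def SigmaDefinableSingleton (n : ℕ) (ε : ZFSet.{0}) (P : ZFSet.{0} → Prop) : Prop :=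
  ∃ (k : ℕ) (φ : SetFormula (k + 1)) (p : Fin k → ZFSet.{0}),
    IsSigma n φ ∧ (∀ i, P (p i)) ∧
    Realize zmem φ (Fin.cons ε p) ∧ ∀ y, Realize zmem φ (Fin.cons y p) → y = ε

end Paper

namespace Paper

abbrev Z := ZFSet.{0}

/-- Satisfaction with quantifiers restricted to a class. -/
def RIn (S : Z → Prop) : ∀ {n : ℕ}, SetFormula n → (Fin n → Z) → Prop
  | _, .mem i j, v => v i ∈ v j
  | _, .eq i j, v => v i = v j
  | _, .fal, _ => False
  | _, .imp φ ψ, v => RIn S φ v → RIn S ψ v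
  | _, .all φ, v => ∀ a, S a → RIn S φ (Fin.snoc v a)

theorem snoc_sub {S : Z → Prop} {n : ℕ} (v : Fin n → Z) (h : ∀ i, S (v i)) (a : Z) (ha : S a) :
    ∀ i, S ((Fin.snoc v a : Fin (n+1) → Z) i) := by
  intro i
  refine Fin.lastCases ?_ (fun i => ?_) i
  · simpa using ha
  · simpa using h i

theorem realize_sub_iff (S : Z → Prop) {n : ℕ} (φ : SetFormula n) (v : Fin n → {x // S x}) :
    Realize (fun a b : {x : Z // S x} => zmem a.1 b.1) φ v ↔ RIn S φ (fun i => (v i).1) := by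
  induction φ with
  | mem i j => rfl
  | eq i j => simp [Realize, RIn, Subtype.ext_iff]
  | fal => rfl
  | imp φ ψ ih1 ih2 => simp [Realize, RIn, ih1, ih2]
  | all φ ih =>
    simp only [Realize, RIn, ih, Subtype.forall]
    refine forall_congr' fun a => forall_congr' fun ha => ?_
    have : (fun i => ((Fin.snoc v (⟨a, ha⟩ : {x // S x}) : Fin (_+1) → {x // S x}) i).1)
        = (Fin.snoc (fun i => (v i).1) a : Fin (_+1) → Z) := by
      funext i
      refine Fin.lastCases ?_ (fun i => ?_) i <;> simp
    rw [this]

theorem realizeIn_iff (S : Z → Prop) {n : ℕ} (φ : SetFormula n) (v : Fin n → Z) :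
    RealizeIn zmem S φ v ↔ (∀ i, S (v i)) ∧ RIn S φ v := by
  unfold RealizeIn
  constructor
  · rintro ⟨h, h2⟩
    exact ⟨h, (realize_sub_iff S φ _).1 h2⟩
  · rintro ⟨h, h2⟩
    exact ⟨h, (realize_sub_iff S φ fun i => ⟨v i, h i⟩).2 h2⟩

/-- Truth in the universe. -/
abbrev Tru {n : ℕ} (φ : SetFormula n) (v : Fin n → Z) : Prop := RIn (fun _ => True) φ v

theorem realize_iff {n : ℕ} (φ : SetFormula n) (v : Fin n → Z) :
    Realize zmem φ v ↔ Tru φ v := by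
  induction φ with
  | mem i j => rfl
  | eq i j => rfl
  | fal => rfl
  | imp φ ψ ih1 ih2 => simp [Realize, RIn, ih1, ih2, Tru]
  | all φ ih => simp [Realize, RIn, ih, Tru]

@[simp] theorem RIn_mem (S : Z → Prop) {n} (i j : Fin n) (v) : RIn S (.mem i j) v ↔ v i ∈ v j := Iff.rfl
@[simp] theorem RIn_eq (S : Z → Prop) {n} (i j : Fin n) (v) : RIn S (.eq i j) v ↔ v i = v j := Iff.rfl
@[simp] theorem RIn_fal (S : Z → Prop) {n} (v : Fin n → Z) : RIn S .fal v ↔ False := Iff.rfl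
@[simp] theorem RIn_imp (S : Z → Prop) {n} (φ ψ : SetFormula n) (v) :
  RIn S (.imp φ ψ) v ↔ (RIn S φ v → RIn S ψ v) := Iff.rfl
@[simp] theorem RIn_all (S : Z → Prop) {n} (φ : SetFormula (n+1)) (v) :
  RIn S (.all φ) v ↔ ∀ a, S a → RIn S φ (Fin.snoc v a) := Iff.rfl
@[simp] theorem RIn_not (S : Z → Prop) {n} (φ : SetFormula n) (v) :
  RIn S φ.not v ↔ ¬ RIn S φ v := Iff.rfl
@[simp] theorem RIn_and (S : Z → Prop) {n} (φ ψ : SetFormula n) (v) :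
  RIn S (φ.and ψ) v ↔ (RIn S φ v ∧ RIn S ψ v) := by simp [SetFormula.and]
@[simp] theorem RIn_ex (S : Z → Prop) {n} (φ : SetFormula (n+1)) (v) :
  RIn S φ.ex v ↔ ∃ a, S a ∧ RIn S φ (Fin.snoc v a) := by simp [SetFormula.ex]

/-- lifting of a variable map -/
def liftF {k l : ℕ} (f : Fin k → Fin l) : Fin (k+1) → Fin (l+1) :=
  Fin.snoc (fun i => (f i).castSucc) (Fin.last l)

@[simp] theorem liftF_castSucc {k l : ℕ} (f : Fin k → Fin l) (i : Fin k) :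
  liftF f i.castSucc = (f i).castSucc := by simp [liftF]
@[simp] theorem liftF_last {k l : ℕ} (f : Fin k → Fin l) :
  liftF f (Fin.last k) = Fin.last l := by simp [liftF]

/-- renaming of variables -/
def ren : ∀ {k l : ℕ}, (Fin k → Fin l) → SetFormula k → SetFormula l
  | _, _, f, .mem i j => .mem (f i) (f j)
  | _, _, f, .eq i j => .eq (f i) (f j)
  | _, _, _, .fal => .fal
  | _, _, f, .imp φ ψ => .imp (ren f φ) (ren f ψ)
  | _, _, f, .all φ => .all (ren (liftF f) φ)

theorem snoc_liftF {k l : ℕ} (f : Fin k → Fin l) (v : Fin l → Z) (a : Z) :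
    (fun i => (Fin.snoc v a : Fin (l+1) → Z) (liftF f i)) = Fin.snoc (fun i => v (f i)) a := by
  funext i
  refine Fin.lastCases ?_ (fun i => ?_) i <;> simp

theorem RIn_ren (S : Z → Prop) {k l : ℕ} (f : Fin k → Fin l) (φ : SetFormula k) (v : Fin l → Z) :
    RIn S (ren f φ) v ↔ RIn S φ (fun i => v (f i)) := by
  induction φ generalizing l with
  | mem i j => rfl
  | eq i j => rfl
  | fal => rfl
  | imp φ ψ ih1 ih2 => simp [ren, ih1, ih2]
  | all φ ih => simp [ren, ih, snoc_liftF]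

theorem isDelta0_ren {k l : ℕ} (f : Fin k → Fin l) {φ : SetFormula k} (h : IsDelta0 φ) :
    IsDelta0 (ren f φ) := by
  induction h generalizing l with
  | mem i j => exact .mem _ _
  | eq i j => exact .eq _ _
  | fal => exact .fal
  | imp _ _ ih1 ih2 => exact .imp (ih1 _) (ih2 _)
  | ball j _ ih =>
    simp only [ren, liftF_castSucc, liftF_last]
    exact .ball _ (ih _)
  | bex j _ ih =>
    simp only [ren, liftF_castSucc, liftF_last, SetFormula.ex, SetFormula.and, SetFormula.not]
    exact .bex _ (ih _)

/-- transitive class -/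
def TrC (S : Z → Prop) : Prop := ∀ x, S x → ∀ y ∈ x, S y

theorem delta0_abs {S : Z → Prop} (hS : TrC S) {k : ℕ} {φ : SetFormula k} (h : IsDelta0 φ)
    (v : Fin k → Z) (hv : ∀ i, S (v i)) : RIn S φ v ↔ Tru φ v := by
  induction h with
  | mem i j => rfl
  | eq i j => rfl
  | fal => rfl
  | imp _ _ ih1 ih2 => simp [ih1 v hv, ih2 v hv, Tru]
  | ball j _ ih =>
    simp only [Tru, RIn_all, RIn_imp, RIn_mem, Fin.snoc_last, Fin.snoc_castSucc, true_imp_iff]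
    refine forall_congr' fun a => ⟨fun h ha => ?_, fun h ha ha' => ?_⟩
    · have := hS _ (hv j) _ ha
      exact (ih _ (snoc_sub v hv a this)).1 (h this ha)
    · exact (ih _ (snoc_sub v hv a ha)).2 (h ha')
  | bex j _ ih =>
    simp only [Tru, RIn_ex, RIn_and, RIn_mem, Fin.snoc_last, Fin.snoc_castSucc, true_and]
    refine exists_congr fun a => ⟨fun ⟨h, ha, hh⟩ => ⟨ha, ?_⟩, fun ⟨ha, hh⟩ => ?_⟩
    · exact (ih _ (snoc_sub v hv a h)).1 hh
    · have := hS _ (hv j) _ ha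
      exact ⟨this, ha, (ih _ (snoc_sub v hv a this)).2 hh⟩

/-- `Δ₀`-definable predicates -/
class D0 {k : ℕ} (P : (Fin k → Z) → Prop) : Prop where
  out : ∃ φ : SetFormula k, IsDelta0 φ ∧ ∀ v, Tru φ v ↔ P v

section D0
variable {k : ℕ}

theorem D0.congr {P Q : (Fin k → Z) → Prop} (hP : D0 P) (h : ∀ v, P v ↔ Q v) : D0 Q := by
  obtain ⟨φ, h1, h2⟩ := hP
  exact ⟨φ, h1, fun v => (h2 v).trans (h v)⟩

instance D0.mem (i j : Fin k) : D0 (fun v => v i ∈ v j) := ⟨.mem i j, .mem _ _, fun _ => Iff.rfl⟩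
instance D0.eq (i j : Fin k) : D0 (fun v => v i = v j) := ⟨.eq i j, .eq _ _, fun _ => Iff.rfl⟩
instance D0.false : D0 (fun _ : Fin k → Z => False) := ⟨.fal, .fal, fun _ => Iff.rfl⟩
instance D0.imp {P Q : (Fin k → Z) → Prop} [hP : D0 P] [hQ : D0 Q] : D0 (fun v => P v → Q v) := by
  obtain ⟨φ, h1, h2⟩ := hP
  obtain ⟨ψ, h3, h4⟩ := hQ
  exact ⟨.imp φ ψ, .imp h1 h3, fun v => by simp [← h2, ← h4]⟩
instance D0.not {P : (Fin k → Z) → Prop} [hP : D0 P] : D0 (fun v => ¬ P v) :=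
  D0.congr (inferInstance : D0 fun v => P v → False) fun _ => Iff.rfl
instance D0.true : D0 (fun _ : Fin k → Z => True) :=
  D0.congr (inferInstance : D0 fun _ => ¬ False) fun _ => by simp
instance D0.and {P Q : (Fin k → Z) → Prop} [hP : D0 P] [hQ : D0 Q] : D0 (fun v => P v ∧ Q v) :=
  D0.congr (inferInstance : D0 fun v => ¬ (P v → ¬ Q v)) fun _ => by simp
instance D0.or {P Q : (Fin k → Z) → Prop} [hP : D0 P] [hQ : D0 Q] : D0 (fun v => P v ∨ Q v) :=
  D0.congr (inferInstance : D0 fun v => ¬ P v → Q v) fun v => by tauto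
instance D0.iff {P Q : (Fin k → Z) → Prop} [hP : D0 P] [hQ : D0 Q] : D0 (fun v => P v ↔ Q v) :=
  D0.congr (inferInstance : D0 fun v => (P v → Q v) ∧ (Q v → P v)) fun v => by tauto

theorem snoc_init (v : Fin (k+1) → Z) :
    (Fin.snoc (fun i => v i.castSucc) (v (Fin.last k)) : Fin (k+1) → Z) = v := by
  funext i
  refine Fin.lastCases ?_ (fun i => ?_) i <;> simp

instance D0.ball (j : Fin k) {P : (Fin k → Z) → Z → Prop}
    [h : D0 (fun v : Fin (k+1) → Z => P (fun i => v i.castSucc) (v (Fin.last k)))] :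
    D0 (fun v => ∀ a ∈ v j, P v a) := by
  obtain ⟨φ, h1, h2⟩ := h
  refine ⟨_, .ball j h1, fun v => ?_⟩
  simp [h2]

instance D0.bex (j : Fin k) {P : (Fin k → Z) → Z → Prop}
    [h : D0 (fun v : Fin (k+1) → Z => P (fun i => v i.castSucc) (v (Fin.last k)))] :
    D0 (fun v => ∃ a ∈ v j, P v a) := by
  obtain ⟨φ, h1, h2⟩ := h
  refine ⟨_, .bex j h1, fun v => ?_⟩
  simp [h2]

theorem D0.subst {l : ℕ} {P : (Fin k → Z) → Prop} (h : D0 P) (f : Fin k → Fin l) :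
    D0 (fun v : Fin l → Z => P (fun i => v (f i))) := by
  obtain ⟨φ, h1, h2⟩ := h
  exact ⟨ren f φ, isDelta0_ren f h1, fun v => (RIn_ren _ f φ v).trans (h2 _)⟩

end D0

/-- Semantic Lévy hierarchy. -/
def SgS : ℕ → ∀ {k : ℕ}, ((Fin k → Z) → Prop) → Prop
  | 0, _, P => D0 P
  | n+1, k, P => ∃ Q : (Fin (k+1) → Z) → Prop, SgS n (fun v => ¬ Q v) ∧
      ∀ v, P v ↔ ∃ a, Q (Fin.snoc v a)

/-- `Σₙ`-definable predicates -/
class Sg (n : ℕ) {k : ℕ} (P : (Fin k → Z) → Prop) : Prop where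
  out : SgS n P

/-- `Πₙ`-definable predicates -/
class Pn (n : ℕ) {k : ℕ} (P : (Fin k → Z) → Prop) : Prop where
  out : SgS n (fun v => ¬ P v)

theorem snoc_comp {k l : ℕ} (v : Fin l → Z) (f : Fin k → Fin l) (j : Fin l) :
    (Fin.snoc (fun i => v (f i)) (v j) : Fin (k+1) → Z) =
      fun i => v ((Fin.snoc f j : Fin (k+1) → Fin l) i) := by
  funext i
  refine Fin.lastCases ?_ (fun i => ?_) i <;> simp

theorem Sg.congr {n k : ℕ} {P Q : (Fin k → Z) → Prop} (hP : Sg n P) (h : ∀ v, P v ↔ Q v) :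
    Sg n Q := by
  have : P = Q := funext fun v => propext (h v)
  exact this ▸ hP

theorem Pn.congr {n k : ℕ} {P Q : (Fin k → Z) → Prop} (hP : Pn n P) (h : ∀ v, P v ↔ Q v) :
    Pn n Q := by
  have : P = Q := funext fun v => propext (h v)
  exact this ▸ hP

theorem Sg.not' {n k : ℕ} {P : (Fin k → Z) → Prop} (hP : Pn n P) : Sg n (fun v => ¬ P v) := ⟨hP.out⟩
theorem Pn.not' {n k : ℕ} {P : (Fin k → Z) → Prop} (hP : Sg n P) : Pn n (fun v => ¬ P v) :=
  ⟨by simpa using hP.out⟩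

theorem sg_succ {n k : ℕ} {P : (Fin k → Z) → Prop} :
    Sg (n+1) P ↔ ∃ Q : (Fin (k+1) → Z) → Prop, Pn n Q ∧ ∀ v, P v ↔ ∃ a, Q (Fin.snoc v a) := by
  constructor
  · rintro ⟨Q, h1, h2⟩; exact ⟨Q, ⟨h1⟩, h2⟩
  · rintro ⟨Q, ⟨h1⟩, h2⟩; exact ⟨Q, h1, h2⟩

theorem Sg.subst {n k l : ℕ} {P : (Fin k → Z) → Prop} (h : Sg n P) (f : Fin k → Fin l) :
    Sg n (fun v : Fin l → Z => P (fun i => v (f i))) := by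
  induction n generalizing k l with
  | zero => exact ⟨D0.subst h.out f⟩
  | succ n ih =>
    obtain ⟨Q, ⟨h1⟩, h2⟩ := sg_succ.1 h
    refine sg_succ.2 ⟨fun w => Q (fun i => w (liftF f i)), ⟨?_⟩, fun v => ?_⟩
    · exact (ih ⟨h1⟩ (liftF f)).out
    · simp only [h2, snoc_liftF]

theorem Pn.subst {n k l : ℕ} {P : (Fin k → Z) → Prop} (h : Pn n P) (f : Fin k → Fin l) :
    Pn n (fun v : Fin l → Z => P (fun i => v (f i))) :=
  ⟨(Sg.subst ⟨h.out⟩ f).out⟩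

theorem Pn.toSg {n k : ℕ} {P : (Fin k → Z) → Prop} (h : Pn n P) : Sg (n+1) P :=
  sg_succ.2 ⟨fun w => P (fun i => w i.castSucc), h.subst _, fun v => by simp⟩

theorem D0.toSg {n k : ℕ} {P : (Fin k → Z) → Prop} (h : D0 P) : Sg n P := by
  induction n generalizing P with
  | zero => exact ⟨h⟩
  | succ n ih => exact Pn.toSg ⟨(ih (P := fun v => ¬ P v) inferInstance).out⟩

theorem Sg.succ {n k : ℕ} {P : (Fin k → Z) → Prop} (h : Sg n P) : Sg (n+1) P := by
  induction n generalizing k with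
  | zero => exact D0.toSg h.out
  | succ n ih =>
    obtain ⟨Q, ⟨h1⟩, h2⟩ := sg_succ.1 h
    exact sg_succ.2 ⟨Q, ⟨(ih ⟨h1⟩).out⟩, h2⟩

theorem Sg.mono {m n k : ℕ} {P : (Fin k → Z) → Prop} (h : Sg m P) (hmn : m ≤ n) : Sg n P := by
  induction hmn with
  | refl => exact h
  | step _ ih => exact ih.succ

theorem D0.toPn {n k : ℕ} {P : (Fin k → Z) → Prop} (h : D0 P) : Pn n P :=
  ⟨(D0.toSg (P := fun v => ¬ P v) inferInstance).out⟩
theorem Pn.succ {n k : ℕ} {P : (Fin k → Z) → Prop} (h : Pn n P) : Pn (n+1) P :=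
  ⟨(Sg.succ ⟨h.out⟩).out⟩
theorem Pn.mono {m n k : ℕ} {P : (Fin k → Z) → Prop} (h : Pn m P) (hmn : m ≤ n) : Pn n P :=
  ⟨(Sg.mono ⟨h.out⟩ hmn).out⟩
theorem Sg.toPn {n k : ℕ} {P : (Fin k → Z) → Prop} (h : Sg n P) : Pn (n+1) P :=
  ⟨(Pn.toSg ⟨(by simpa using h.out : SgS n (fun v => ¬ ¬ P v))⟩).out⟩

/-- collection -/
theorem coll (x : Z) (R : Z → Z → Prop) (h : ∀ a ∈ x, ∃ b, R a b) :
    ∃ c : Z, ∀ a ∈ x, ∃ b ∈ c, R a b := by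
  choose! F hF using h
  refine ⟨ZFSet.range (fun a : x => F a), fun a ha => ⟨F a, ?_, hF a ha⟩⟩
  rw [ZFSet.mem_range]
  exact ⟨⟨a, ha⟩, rfl⟩

theorem upair_coll (a b : Z) : ∃ c : Z, a ∈ c ∧ b ∈ c := ⟨{a, b}, by simp, by simp⟩

/-- closure of a level -/
structure Cl (n : ℕ) : Prop where
  and : ∀ {k : ℕ} {P Q : (Fin k → Z) → Prop}, Sg n P → Sg n Q → Sg n (fun v => P v ∧ Q v)
  or : ∀ {k : ℕ} {P Q : (Fin k → Z) → Prop}, Sg n P → Sg n Q → Sg n (fun v => P v ∨ Q v)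
  ball : ∀ {k : ℕ} (j : Fin k) {P : (Fin k → Z) → Z → Prop},
    Sg n (fun v : Fin (k+1) → Z => P (fun i => v i.castSucc) (v (Fin.last k))) →
    Sg n (fun v => ∀ a ∈ v j, P v a)
  bex : ∀ {k : ℕ} (j : Fin k) {P : (Fin k → Z) → Z → Prop},
    Sg n (fun v : Fin (k+1) → Z => P (fun i => v i.castSucc) (v (Fin.last k))) →
    Sg n (fun v => ∃ a ∈ v j, P v a)

theorem Pn.sn {n k l : ℕ} {Q : (Fin (k+1) → Z) → Prop} (h : Pn n Q) (f : Fin k → Fin l) (j : Fin l) :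
    Pn n (fun v : Fin l → Z => Q (Fin.snoc (fun i => v (f i)) (v j))) := by
  simp only [snoc_comp]; exact h.subst _

theorem Cl.pand {n : ℕ} (c : Cl n) {k : ℕ} {P Q : (Fin k → Z) → Prop} (h1 : Pn n P) (h2 : Pn n Q) :
    Pn n (fun v => P v ∧ Q v) := ⟨by
  have := (c.or ⟨h1.out⟩ ⟨h2.out⟩).out
  convert this using 2; tauto⟩
theorem Cl.por {n : ℕ} (c : Cl n) {k : ℕ} {P Q : (Fin k → Z) → Prop} (h1 : Pn n P) (h2 : Pn n Q) :
    Pn n (fun v => P v ∨ Q v) := ⟨by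
  have := (c.and ⟨h1.out⟩ ⟨h2.out⟩).out
  convert this using 2; tauto⟩
theorem Cl.pball {n : ℕ} (c : Cl n) {k : ℕ} (j : Fin k) {P : (Fin k → Z) → Z → Prop}
    (h : Pn n (fun v : Fin (k+1) → Z => P (fun i => v i.castSucc) (v (Fin.last k)))) :
    Pn n (fun v => ∀ a ∈ v j, P v a) := ⟨by
  have := (c.bex j (P := fun v a => ¬ P v a) ⟨h.out⟩).out
  convert this using 2; simp⟩
theorem Cl.pbex {n : ℕ} (c : Cl n) {k : ℕ} (j : Fin k) {P : (Fin k → Z) → Z → Prop}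
    (h : Pn n (fun v : Fin (k+1) → Z => P (fun i => v i.castSucc) (v (Fin.last k)))) :
    Pn n (fun v => ∃ a ∈ v j, P v a) := ⟨by
  have := (c.ball j (P := fun v a => ¬ P v a) ⟨h.out⟩).out
  convert this using 2; simp⟩

theorem cl0 : Cl 0 where
  and h1 h2 := ⟨@D0.and _ _ _ h1.out h2.out⟩
  or h1 h2 := ⟨@D0.or _ _ _ h1.out h2.out⟩
  ball j _ h := ⟨@D0.ball _ j _ h.out⟩
  bex j _ h := ⟨@D0.bex _ j _ h.out⟩

theorem Cl.ex2 {n : ℕ} (c : Cl n) {k : ℕ} {Q : (Fin (k+2) → Z) → Prop} (h : Pn n Q) :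
    Sg (n+1) (fun v : Fin k → Z => ∃ a b, Q (Fin.snoc (Fin.snoc v a : Fin (k+1) → Z) b)) := by
  refine sg_succ.2 ⟨fun w => ∃ a ∈ w (Fin.last k), ∃ b ∈ w (Fin.last k),
    Q (Fin.snoc (Fin.snoc (fun i : Fin k => w i.castSucc) a : Fin (k+1) → Z) b), ?_, fun v => ?_⟩
  · refine c.pbex _ ?_
    refine c.pbex _ ?_
    simp only [snoc_comp]
    exact h.subst _
  · simp only [Fin.snoc_last, Fin.snoc_castSucc]
    constructor
    · rintro ⟨a, b, hh⟩
      obtain ⟨d, h1, h2⟩ := upair_coll a b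
      exact ⟨d, a, h1, b, h2, hh⟩
    · rintro ⟨d, a, -, b, -, hh⟩
      exact ⟨a, b, hh⟩

theorem Cl.ex {n : ℕ} (c : Cl n) {k : ℕ} {P : (Fin (k+1) → Z) → Prop} (h : Sg (n+1) P) :
    Sg (n+1) (fun v : Fin k → Z => ∃ a, P (Fin.snoc v a)) := by
  obtain ⟨Q, h1, h2⟩ := sg_succ.1 h
  simp only [h2]
  exact c.ex2 h1

theorem Cl.next {n : ℕ} (c : Cl n) : Cl (n+1) where
  and {k P Q} h1 h2 := by
    obtain ⟨P', h1, h1'⟩ := sg_succ.1 h1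
    obtain ⟨Q', h2, h2'⟩ := sg_succ.1 h2
    refine (c.ex2 (k := k) (Q := fun w => P' (Fin.snoc (fun i : Fin k => w i.castSucc.castSucc)
      (w (Fin.last k).castSucc)) ∧ Q' (Fin.snoc (fun i : Fin k => w i.castSucc.castSucc)
      (w (Fin.last _)))) (c.pand (h1.sn _ _) (h2.sn _ _))).congr fun v => ?_
    simp [h1', h2']
  or {k P Q} h1 h2 := by
    obtain ⟨P', h1, h1'⟩ := sg_succ.1 h1
    obtain ⟨Q', h2, h2'⟩ := sg_succ.1 h2
    refine sg_succ.2 ⟨_, c.por h1 h2, fun v => ?_⟩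
    simp [h1', h2', exists_or]
  ball {k} j P h := by
    obtain ⟨Q, h1, h2⟩ := sg_succ.1 h
    have h2 : ∀ v a, P v a ↔ ∃ b, Q (Fin.snoc (Fin.snoc v a : Fin (k+1) → Z) b) := by
      intro v a
      simp [← h2]
    refine sg_succ.2 ⟨fun w => ∀ a ∈ w j.castSucc, ∃ b ∈ w (Fin.last k),
      Q (Fin.snoc (Fin.snoc (fun i : Fin k => w i.castSucc) a : Fin (k+1) → Z) b), ?_, fun v => ?_⟩
    · refine c.pball _ ?_
      refine c.pbex _ ?_
      simp only [snoc_comp]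
      exact h1.subst _
    · simp only [Fin.snoc_last, Fin.snoc_castSucc, h2]
      constructor
      · intro hh
        exact coll _ _ hh
      · rintro ⟨d, hd⟩ a ha
        obtain ⟨b, -, hb⟩ := hd a ha
        exact ⟨b, hb⟩
  bex {k} j P h := by
    refine (c.ex (P := fun w : Fin (k+1) → Z => w (Fin.last k) ∈ w j.castSucc ∧
      P (fun i => w i.castSucc) (w (Fin.last k))) ?_).congr fun v => ?_
    · obtain ⟨P', h1, h1'⟩ := sg_succ.1 h
      refine sg_succ.2 ⟨fun w => w (Fin.last k).castSucc ∈ w j.castSucc.castSucc ∧ P' w, ?_, ?_⟩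
      · exact c.pand (D0.toPn (D0.mem _ _)) h1
      · intro v
        simp [h1']
    · simp

theorem cl (n : ℕ) : Cl n := by
  induction n with
  | zero => exact cl0
  | succ n ih => exact ih.next

section
variable {n k : ℕ}

instance (priority := 2000) D0.toSgI {P : (Fin k → Z) → Prop} [h : D0 P] : Sg n P := h.toSg
instance (priority := 2000) D0.toPnI {P : (Fin k → Z) → Prop} [h : D0 P] : Pn n P := h.toPn
instance (priority := 50) Sg.toPnI {P : (Fin k → Z) → Prop} [h : Sg n P] : Pn (n+1) P := h.toPn
instance (priority := 50) Pn.toSgI {P : (Fin k → Z) → Prop} [h : Pn n P] : Sg (n+1) P := h.toSg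
instance Sg.not {P : (Fin k → Z) → Prop} [h : Pn n P] : Sg n (fun v => ¬ P v) := Sg.not' h
instance Pn.not {P : (Fin k → Z) → Prop} [h : Sg n P] : Pn n (fun v => ¬ P v) := Pn.not' h
instance Sg.and {P Q : (Fin k → Z) → Prop} [h : Sg n P] [h' : Sg n Q] : Sg n (fun v => P v ∧ Q v) :=
  (cl n).and h h'
instance Sg.or {P Q : (Fin k → Z) → Prop} [h : Sg n P] [h' : Sg n Q] : Sg n (fun v => P v ∨ Q v) :=
  (cl n).or h h'
instance Pn.and {P Q : (Fin k → Z) → Prop} [h : Pn n P] [h' : Pn n Q] : Pn n (fun v => P v ∧ Q v) :=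
  (cl n).pand h h'
instance Pn.or {P Q : (Fin k → Z) → Prop} [h : Pn n P] [h' : Pn n Q] : Pn n (fun v => P v ∨ Q v) :=
  (cl n).por h h'
instance Sg.imp {P Q : (Fin k → Z) → Prop} [h : Pn n P] [h' : Sg n Q] : Sg n (fun v => P v → Q v) :=
  (inferInstance : Sg n fun v => ¬ P v ∨ Q v).congr fun v => by tauto
instance Pn.imp {P Q : (Fin k → Z) → Prop} [h : Sg n P] [h' : Pn n Q] : Pn n (fun v => P v → Q v) :=
  (inferInstance : Pn n fun v => ¬ P v ∨ Q v).congr fun v => by tauto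
instance Sg.ball (j : Fin k) {P : (Fin k → Z) → Z → Prop}
    [h : Sg n (fun v : Fin (k+1) → Z => P (fun i => v i.castSucc) (v (Fin.last k)))] :
    Sg n (fun v => ∀ a ∈ v j, P v a) := (cl n).ball j h
instance Sg.bex (j : Fin k) {P : (Fin k → Z) → Z → Prop}
    [h : Sg n (fun v : Fin (k+1) → Z => P (fun i => v i.castSucc) (v (Fin.last k)))] :
    Sg n (fun v => ∃ a ∈ v j, P v a) := (cl n).bex j h
instance Pn.ball (j : Fin k) {P : (Fin k → Z) → Z → Prop}
    [h : Pn n (fun v : Fin (k+1) → Z => P (fun i => v i.castSucc) (v (Fin.last k)))] :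
    Pn n (fun v => ∀ a ∈ v j, P v a) := (cl n).pball j h
instance Pn.bex (j : Fin k) {P : (Fin k → Z) → Z → Prop}
    [h : Pn n (fun v : Fin (k+1) → Z => P (fun i => v i.castSucc) (v (Fin.last k)))] :
    Pn n (fun v => ∃ a ∈ v j, P v a) := (cl n).pbex j h
instance Sg.ex {P : (Fin k → Z) → Z → Prop}
    [h : Sg (n+1) (fun v : Fin (k+1) → Z => P (fun i => v i.castSucc) (v (Fin.last k)))] :
    Sg (n+1) (fun v => ∃ a, P v a) := ((cl n).ex h).congr fun v => by simp
instance Pn.all {P : (Fin k → Z) → Z → Prop}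
    [h : Pn (n+1) (fun v : Fin (k+1) → Z => P (fun i => v i.castSucc) (v (Fin.last k)))] :
    Pn (n+1) (fun v => ∀ a, P v a) := by
  have : Sg (n+1) (fun v : Fin (k+1) → Z => ¬ P (fun i => v i.castSucc) (v (Fin.last k))) :=
    Sg.not' h
  refine (Pn.not' (Sg.ex (P := fun v a => ¬ P v a))).congr fun v => by simp
end

/-- Semantic classes are given by formulas. -/
theorem Sg.formula {n k : ℕ} {P : (Fin k → Z) → Prop} (h : Sg n P) :
    (∃ φ : SetFormula k, IsSigma n φ ∧ ∀ v, Tru φ v ↔ P v) ∧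
    (∃ φ : SetFormula k, IsPi n φ ∧ ∀ v, Tru φ v ↔ ¬ P v) := by
  induction n generalizing k with
  | zero =>
    obtain ⟨φ, h1, h2⟩ := h.out
    exact ⟨⟨φ, .ofDelta0 h1, h2⟩, ⟨φ.not, .ofDelta0 (.imp h1 .fal), fun v => by simp [← h2]⟩⟩
  | succ n ih =>
    obtain ⟨Q, ⟨h1⟩, h2⟩ := sg_succ.1 h
    obtain ⟨⟨ψ, h3, h4⟩, φ, h5, h6⟩ := ih ⟨h1⟩
    refine ⟨⟨φ.ex, .ex (.ofPi h5), fun v => ?_⟩, ⟨ψ.all, .all (.ofSigma h3), fun v => ?_⟩⟩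
    · simp [h2, h6]
    · simp [h2, h4]

theorem Pn.formula {n k : ℕ} {P : (Fin k → Z) → Prop} (h : Pn n P) :
    (∃ φ : SetFormula k, IsPi n φ ∧ ∀ v, Tru φ v ↔ P v) ∧
    (∃ φ : SetFormula k, IsSigma n φ ∧ ∀ v, Tru φ v ↔ ¬ P v) := by
  have := (Sg.not' h).formula
  simpa [and_comm] using this

theorem IsSigma.sg {n k : ℕ} {φ : SetFormula k} (h : IsSigma n φ) : Sg n (fun v => Tru φ v) := by
  refine IsSigma.rec (motive_1 := fun n _ φ _ => Sg n (fun v => Tru φ v))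
    (motive_2 := fun n _ φ _ => Pn n (fun v => Tru φ v)) ?_ ?_ ?_ ?_ ?_ ?_ h
  · intro k n φ h; exact D0.toSg ⟨φ, h, fun _ => Iff.rfl⟩
  · intro k n φ _ h; exact h.toSg
  · intro k n φ _ h; simpa using ((cl k).ex h)
  · intro k n φ h; exact D0.toPn ⟨φ, h, fun _ => Iff.rfl⟩
  · intro k n φ _ h; exact h.toPn
  · intro k n φ _ h
    refine (Pn.not' ((cl k).ex (Sg.not' h))).congr fun v => by simp

theorem IsPi.pn {n k : ℕ} {φ : SetFormula k} (h : IsPi n φ) : Pn n (fun v => Tru φ v) := by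
  refine IsPi.rec (motive_1 := fun n _ φ _ => Sg n (fun v => Tru φ v))
    (motive_2 := fun n _ φ _ => Pn n (fun v => Tru φ v)) ?_ ?_ ?_ ?_ ?_ ?_ h
  · intro k n φ h; exact D0.toSg ⟨φ, h, fun _ => Iff.rfl⟩
  · intro k n φ _ h; exact h.toSg
  · intro k n φ _ h; simpa using ((cl k).ex h)
  · intro k n φ h; exact D0.toPn ⟨φ, h, fun _ => Iff.rfl⟩
  · intro k n φ _ h; exact h.toPn
  · intro k n φ _ h
    refine (Pn.not' ((cl k).ex (Sg.not' h))).congr fun v => by simp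

/-- syntactic negation for the hierarchy, valid in all classes -/
theorem IsPi.dual {n k : ℕ} {φ : SetFormula k} (h : IsPi n φ) :
    ∃ ψ : SetFormula k, IsSigma n ψ ∧ ∀ S v, RIn S ψ v ↔ ¬ RIn S φ v := by
  refine IsPi.rec (motive_1 := fun n k φ _ => ∃ ψ : SetFormula k, IsPi n ψ ∧ ∀ S v, RIn S ψ v ↔ ¬ RIn S φ v)
    (motive_2 := fun n k φ _ => ∃ ψ : SetFormula k, IsSigma n ψ ∧ ∀ S v, RIn S ψ v ↔ ¬ RIn S φ v)
      ?_ ?_ ?_ ?_ ?_ ?_ h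
  · intro k n φ h; exact ⟨φ.not, .ofDelta0 (.imp h .fal), fun S v => by simp⟩
  · rintro k n φ _ ⟨ψ, h, h'⟩; exact ⟨ψ, .ofSigma h, h'⟩
  · rintro k n φ _ ⟨ψ, h, h'⟩; exact ⟨ψ.all, .all h, fun S v => by simp [h']⟩
  · intro k n φ h; exact ⟨φ.not, .ofDelta0 (.imp h .fal), fun S v => by simp⟩
  · rintro k n φ _ ⟨ψ, h, h'⟩; exact ⟨ψ, .ofPi h, h'⟩
  · rintro k n φ _ ⟨ψ, h, h'⟩; exact ⟨ψ.ex, .ex h, fun S v => by simp [h']⟩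

/-- relativization to a set is `Δ₀` -/
instance D0.rel {k l : ℕ} (φ : SetFormula k) (j : Fin l) (f : Fin k → Fin l) :
    D0 (fun v : Fin l → Z => RIn (fun x => x ∈ v j) φ (fun i => v (f i))) := by
  induction φ generalizing l with
  | mem a b => exact D0.mem _ _
  | eq a b => exact D0.eq _ _
  | fal => exact D0.false
  | imp φ ψ ih1 ih2 => 
    have := ih1 j f
    have := ih2 j f
    simp only [RIn_imp]; infer_instance
  | all φ ih =>
    simp only [RIn_all]
    have := ih j.castSucc (liftF f)
    refine @D0.ball _ j (fun v a => RIn (fun x => x ∈ v j) φ (Fin.snoc (fun i => v (f i)) a)) ?_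
    convert this using 3 with v
    funext i
    refine Fin.lastCases ?_ (fun i => ?_) i <;> simp

end Paper

namespace Paper
open ZFSet

theorem IsSigma.succ {n k : ℕ} {φ : SetFormula k} (h : IsSigma n φ) : IsSigma (n+1) φ := by
  refine IsSigma.rec (motive_1 := fun n _ φ _ => IsSigma (n+1) φ)
    (motive_2 := fun n _ φ _ => IsPi (n+1) φ) ?_ ?_ ?_ ?_ ?_ ?_ h
  · intro k n φ h; exact .ofDelta0 h
  · intro k n φ _ h; exact .ofPi h
  · intro k n φ _ h; exact .ex h
  · intro k n φ h; exact .ofDelta0 h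
  · intro k n φ _ h; exact .ofSigma h
  · intro k n φ _ h; exact .all h

theorem IsSigma.mono {m n k : ℕ} {φ : SetFormula k} (h : IsSigma m φ) (hmn : m ≤ n) : IsSigma n φ := by
  induction hmn with
  | refl => exact h
  | step _ ih => exact ih.succ

/-- `Σₙ`-elementarity in terms of `RIn` -/
def SgE (n : ℕ) (S T : Z → Prop) : Prop :=
  (∀ x, S x → T x) ∧ ∀ ⦃k : ℕ⦄ (φ : SetFormula k), IsSigma n φ → ∀ v : Fin k → Z, (∀ i, S (v i)) →
    (RIn S φ v ↔ RIn T φ v)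

theorem sgE_iff (n : ℕ) (S T : Z → Prop) : SigmaElemPairE zmem n S T ↔ SgE n S T := by
  unfold SigmaElemPairE SgE
  refine and_congr_right fun h => forall_congr' fun k => forall_congr' fun φ => forall_congr' fun hφ =>
    forall_congr' fun v => forall_congr' fun hv => ?_
  rw [realizeIn_iff, realizeIn_iff]
  have : ∀ i, T (v i) := fun i => h _ (hv i)
  simp [hv, this]

theorem SgE.mono {m n : ℕ} {S T : Z → Prop} (h : SgE n S T) (hmn : m ≤ n) : SgE m S T :=
  ⟨h.1, fun _ φ hφ => h.2 φ (hφ.mono hmn)⟩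

theorem SgE.pi {n : ℕ} {S T : Z → Prop} (h : SgE n S T) {k : ℕ} {φ : SetFormula k} (hφ : IsPi n φ)
    (v : Fin k → Z) (hv : ∀ i, S (v i)) : RIn S φ v ↔ RIn T φ v := by
  obtain ⟨ψ, h1, h2⟩ := hφ.dual
  have := h.2 ψ h1 v hv
  rw [h2, h2] at this
  exact not_iff_not.1 this

theorem SgE.trans {n : ℕ} {S T U : Z → Prop} (h : SgE n S T) (h' : SgE n T U) : SgE n S U :=
  ⟨fun x hx => h'.1 _ (h.1 x hx), fun _ φ hφ v hv =>
    (h.2 φ hφ v hv).trans (h'.2 φ hφ v fun i => h.1 _ (hv i))⟩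

theorem SgE.of_both {n : ℕ} {S T U : Z → Prop} (h : SgE n S U) (h' : SgE n T U) (hs : ∀ x, S x → T x) :
    SgE n S T :=
  ⟨hs, fun _ φ hφ v hv => (h.2 φ hφ v hv).trans (h'.2 φ hφ v fun i => hs _ (hv i)).symm⟩

/-- Tarski-Vaught for `Σₙ` -/
theorem SgE.of_tv {n : ℕ} {S T : Z → Prop} (hS : TrC S) (hT : TrC T) (hST : ∀ x, S x → T x)
    (h : ∀ (k : ℕ) (φ : SetFormula (k+1)), IsSigma n φ → ∀ v : Fin k → Z, (∀ i, S (v i)) →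
      (∃ x, T x ∧ RIn T φ (Fin.snoc v x)) → ∃ x, S x ∧ RIn T φ (Fin.snoc v x)) : SgE n S T := by
  refine ⟨hST, fun k φ hφ => ?_⟩
  refine IsSigma.rec (motive_1 := fun m k φ _ => m ≤ n → ∀ v : Fin k → Z, (∀ i, S (v i)) →
    (RIn S φ v ↔ RIn T φ v)) (motive_2 := fun m k φ _ => m ≤ n → ∀ v : Fin k → Z, (∀ i, S (v i)) →
    (RIn S φ v ↔ RIn T φ v)) ?_ ?_ ?_ ?_ ?_ ?_ hφ le_rfl
  · intro m k φ h _ v hv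
    rw [delta0_abs hS h v hv, delta0_abs hT h v fun i => hST _ (hv i)]
  · intro m k φ _ ih hm v hv
    exact ih (by omega) v hv
  · intro m k φ hφ ih hm v hv
    rw [RIn_ex, RIn_ex]
    constructor
    · rintro ⟨a, ha, h2⟩
      exact ⟨a, hST a ha, (ih hm _ (snoc_sub v hv a ha)).1 h2⟩
    · intro h2
      obtain ⟨a, ha, h3⟩ := h k φ (hφ.mono hm) v hv h2
      exact ⟨a, ha, (ih hm _ (snoc_sub v hv a ha)).2 h3⟩
  · intro m k φ h _ v hv
    rw [delta0_abs hS h v hv, delta0_abs hT h v fun i => hST _ (hv i)]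
  · intro m k φ _ ih hm v hv
    exact ih (by omega) v hv
  · intro m k φ hφ ih hm v hv
    rw [RIn_all, RIn_all]
    constructor
    · intro h2
      by_contra h3
      push Not at h3
      obtain ⟨ψ, h4, h5⟩ := hφ.dual
      obtain ⟨a, ha, h6⟩ := h k ψ (h4.mono hm) v hv (by simpa [h5] using h3)
      rw [h5] at h6
      exact h6 ((ih hm _ (snoc_sub v hv a ha)).1 (h2 a ha))
    · intro h2 a ha
      exact (ih hm _ (snoc_sub v hv a ha)).2 (h2 a (hST a ha))

theorem SgE.of_down {n : ℕ} {S T : Z → Prop} (hS : TrC S) (hT : TrC T) (hST : ∀ x, S x → T x)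
    (h : ∀ (k : ℕ) (φ : SetFormula k), IsSigma n φ → ∀ v : Fin k → Z, (∀ i, S (v i)) →
      RIn T φ v → RIn S φ v) : SgE n S T := by
  refine ⟨hST, fun k φ hφ v hv => ⟨?_, h k φ hφ v hv⟩⟩
  refine IsSigma.rec (motive_1 := fun m k φ _ => m ≤ n → ∀ v : Fin k → Z, (∀ i, S (v i)) →
    (RIn S φ v → RIn T φ v)) (motive_2 := fun m k φ _ => True) ?_ ?_ ?_ ?_ ?_ ?_ hφ le_rfl v hv
  · intro m k φ h _ v hv
    rw [delta0_abs hS h v hv, delta0_abs hT h v fun i => hST _ (hv i)]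
    exact id
  · intro m k φ hφ ih hm v hv
    contrapose
    obtain ⟨ψ, h4, h5⟩ := hφ.dual
    rw [← h5, ← h5]
    exact h k ψ (h4.mono (by omega)) v hv
  · intro m k φ hφ ih hm v hv
    rw [RIn_ex, RIn_ex]
    rintro ⟨a, ha, h2⟩
    exact ⟨a, hST a ha, (ih hm _ (snoc_sub v hv a ha)) h2⟩
  all_goals intros; trivial

/-! ### Basic set-theoretic notions -/

theorem zmem_iff (x y : Z) : zmem x y ↔ x ∈ y := Iff.rfl

theorem upairE_iff (p a b : Z) : UPairE zmem p a b ↔ p = {a, b} := by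
  simp only [UPairE, zmem_iff, ZFSet.ext_iff, ZFSet.mem_pair]

theorem opairE_iff (p a b : Z) : OPairE zmem p a b ↔ p = pair a b := by
  unfold OPairE
  simp only [upairE_iff]
  constructor
  · rintro ⟨s, t, rfl, rfl, rfl⟩
    simp [pair]
  · rintro rfl
    exact ⟨_, _, rfl, rfl, by simp [pair]⟩

theorem pairMemE_iff (f a b : Z) : PairMemE zmem f a b ↔ pair a b ∈ f := by
  simp [PairMemE, opairE_iff, zmem_iff]

theorem ordE_iff (x : Z) : OrdE zmem x ↔ x.IsOrdinal := by
  rw [isOrdinal_iff_forall_mem_isTransitive]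
  simp only [OrdE, TransE, zmem_iff, IsTransitive]
  rfl

/-- `f` is a function from `a` to `b` -/
def Fn (f a b : Z) : Prop :=
  (∀ p ∈ f, ∃ x ∈ a, ∃ y ∈ b, p = pair x y) ∧
    ∀ x ∈ a, ∃ y ∈ b, pair x y ∈ f ∧ ∀ y' ∈ b, pair x y' ∈ f → y' = y
def Sj (f a b : Z) : Prop := Fn f a b ∧ ∀ y ∈ b, ∃ x ∈ a, pair x y ∈ f
def Ij (f a b : Z) : Prop := Fn f a b ∧ ∀ x ∈ a, ∀ x' ∈ a, ∀ y ∈ b, pair x y ∈ f → pair x' y ∈ f → x = x'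
def Bj (f a b : Z) : Prop := Sj f a b ∧ Ij f a b

theorem Fn.dom {f a b x y : Z} (h : Fn f a b) (hp : pair x y ∈ f) : x ∈ a ∧ y ∈ b := by
  obtain ⟨x', hx, y', hy, e⟩ := h.1 _ hp
  obtain ⟨rfl, rfl⟩ := pair_inj.1 e
  exact ⟨hx, hy⟩

theorem Fn.uniq {f a b x y y' : Z} (h : Fn f a b) (hp : pair x y ∈ f) (hp' : pair x y' ∈ f) : y = y' := by
  obtain ⟨z, -, -, hz⟩ := h.2 x (h.dom hp).1
  rw [hz y (h.dom hp).2 hp, hz y' (h.dom hp').2 hp']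

theorem isFuncE_iff (f a b : Z) : IsFuncE zmem f a b ↔ Fn f a b := by
  unfold IsFuncE Fn
  simp only [pairMemE_iff, opairE_iff, zmem_iff]
  constructor
  · rintro ⟨h1, h2⟩
    refine ⟨fun p hp => ?_, fun x hx => ?_⟩
    · obtain ⟨x, y, h3, h4, h5⟩ := h1 p hp
      exact ⟨x, h3, y, h4, h5⟩
    · obtain ⟨⟨y, hy⟩, h4⟩ := h2 x hx
      obtain ⟨x', y', h5, h6, h7⟩ := h1 _ hy
      obtain ⟨rfl, rfl⟩ := pair_inj.1 h7
      exact ⟨y, h6, hy, fun y' _ h => h4 _ _ h hy⟩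
  · intro h
    have h : Fn f a b := h
    refine ⟨fun p hp => ?_, fun x hx => ⟨?_, fun y y' => h.uniq⟩⟩
    · obtain ⟨x, h3, y, h4, h5⟩ := h.1 p hp
      exact ⟨x, y, h3, h4, h5⟩
    · obtain ⟨y, -, hy, -⟩ := h.2 x hx
      exact ⟨y, hy⟩

theorem surjE_iff (f a b : Z) : SurjE zmem f a b ↔ Sj f a b := by
  simp only [SurjE, Sj, isFuncE_iff, pairMemE_iff, zmem_iff]

theorem injE_iff (f a b : Z) : InjE zmem f a b ↔ Ij f a b := by
  simp only [InjE, Ij, isFuncE_iff, pairMemE_iff, zmem_iff]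
  refine and_congr_right fun h => ⟨fun h2 x hx x' hx' y _ => h2 x x' y hx hx', fun h2 x x' y hx hx' h3 =>
    h2 x hx x' hx' y (h.dom h3).2 h3⟩

theorem bijE_iff (f a b : Z) : BijE zmem f a b ↔ Bj f a b := by
  simp only [BijE, Bj, surjE_iff, injE_iff]

/-- graph of a Lean function on a set -/
noncomputable def gr (a : Z) (F : Z → Z) : Z := ZFSet.range (fun x : a => pair x (F x))
/-- image -/
noncomputable def im (a : Z) (F : Z → Z) : Z := ZFSet.range (fun x : a => F x)

theorem mem_gr {a p : Z} {F : Z → Z} : p ∈ gr a F ↔ ∃ x ∈ a, pair x (F x) = p := by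
  simp [gr, ZFSet.mem_range]
theorem mem_im {a p : Z} {F : Z → Z} : p ∈ im a F ↔ ∃ x ∈ a, F x = p := by
  simp [im, ZFSet.mem_range]
theorem pair_mem_gr {a x y : Z} {F : Z → Z} : pair x y ∈ gr a F ↔ x ∈ a ∧ F x = y := by
  rw [mem_gr]
  constructor
  · rintro ⟨x', h, e⟩
    obtain ⟨rfl, rfl⟩ := pair_inj.1 e
    exact ⟨h, rfl⟩
  · rintro ⟨h, rfl⟩; exact ⟨x, h, rfl⟩

theorem gr_fn {a b : Z} {F : Z → Z} (h : ∀ x ∈ a, F x ∈ b) : Fn (gr a F) a b := by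
  refine ⟨fun p hp => ?_, fun x hx => ⟨F x, h x hx, pair_mem_gr.2 ⟨hx, rfl⟩, fun y' _ h => (pair_mem_gr.1 h).2.symm⟩⟩
  obtain ⟨x, hx, rfl⟩ := mem_gr.1 hp
  exact ⟨x, hx, _, h x hx, rfl⟩

theorem gr_sj {a b : Z} {F : Z → Z} (h : ∀ x ∈ a, F x ∈ b) (h' : ∀ y ∈ b, ∃ x ∈ a, F x = y) :
    Sj (gr a F) a b :=
  ⟨gr_fn h, fun y hy => by
    obtain ⟨x, hx, e⟩ := h' y hy
    exact ⟨x, hx, pair_mem_gr.2 ⟨hx, e⟩⟩⟩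

theorem gr_ij {a b : Z} {F : Z → Z} (h : ∀ x ∈ a, F x ∈ b) (h' : ∀ x ∈ a, ∀ x' ∈ a, F x = F x' → x = x') :
    Ij (gr a F) a b :=
  ⟨gr_fn h, fun x hx x' hx' y _ h1 h2 => h' x hx x' hx' (by
    rw [(pair_mem_gr.1 h1).2, (pair_mem_gr.1 h2).2])⟩

theorem Fn.exists_fun {f a b : Z} (h : Fn f a b) : ∃ F : Z → Z, (∀ x ∈ a, F x ∈ b) ∧ f = gr a F := by
  have := h.2
  choose! F h1 h2 h3 using this
  refine ⟨F, h1, ?_⟩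
  ext p
  rw [mem_gr]
  constructor
  · intro hp
    obtain ⟨x, hx, y, hy, rfl⟩ := h.1 p hp
    exact ⟨x, hx, by rw [h3 x hx y hy hp]⟩
  · rintro ⟨x, hx, rfl⟩
    exact h2 x hx

/-- `V_α` for a set `α` -/
noncomputable def VV (α : Z) : Z := ZFSet.vonNeumann (rank α)

theorem mem_VV {x α : Z} : x ∈ VV α ↔ rank x < rank α := ZFSet.mem_vonNeumann
theorem subset_VV {x α : Z} : x ⊆ VV α ↔ rank x ≤ rank α := ZFSet.subset_vonNeumann
theorem rank_VV (α : Z) : rank (VV α) = rank α := ZFSet.rank_vonNeumann _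
theorem VV_trans (α : Z) : (VV α).IsTransitive := ZFSet.isTransitive_vonNeumann _
theorem VV_trC (α : Z) : TrC (fun x => x ∈ VV α) := fun x hx y hy => VV_trans α x hx hy

theorem vhier_uniq {f α : Z} (h : VHierE zmem f α) : ∀ β ∈ α, ∀ w, pair β w ∈ f ↔ w = VV β := by
  intro β
  induction β using ZFSet.inductionOn with
  | _ β ih =>
    intro hβ w
    obtain ⟨⟨u, hu, h1⟩, h2⟩ := h.2 β hβ
    simp only [pairMemE_iff, zmem_iff] at hu h1 h2
    have hu2 : u = VV β := by
      ext z
      rw [h1, mem_VV, lt_rank_iff]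
      refine exists_congr fun γ => and_congr_right fun hγ => ?_
      have hα : (α : Z).IsOrdinal := (ordE_iff α).1 h.1
      have := ih γ hγ (hα.mem_trans hγ hβ)
      simp only [this, exists_eq_left]
      exact subset_VV
    subst hu2
    exact ⟨fun h => h2 _ _ h hu, fun h => h ▸ hu⟩

theorem vhier_ex {α : Z} (hα : α.IsOrdinal) : VHierE zmem (gr α VV) α := by
  refine ⟨(ordE_iff α).2 hα, fun β hβ => ?_⟩
  simp only [pairMemE_iff, zmem_iff, pair_mem_gr]
  have hβ : β ∈ α := hβ
  refine ⟨⟨VV β, ⟨hβ, rfl⟩, fun z => ?_⟩, fun w w' h1 h2 => h1.2.symm.trans h2.2⟩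
  rw [mem_VV, lt_rank_iff]
  refine exists_congr fun γ => and_congr_right fun hγ => ?_
  have := hα.mem_trans hγ hβ
  simp only [this, true_and, exists_eq_left']
  exact subset_VV.symm

theorem vmemE_iff (x α : Z) : VMemE zmem x α ↔ α.IsOrdinal ∧ x ∈ VV α := by
  unfold VMemE
  rw [ordE_iff]
  refine and_congr_right fun hα => ?_
  rw [mem_VV, lt_rank_iff]
  constructor
  · rintro ⟨f, hf, β, u, hβ, hu, hx⟩
    rw [pairMemE_iff, vhier_uniq hf β hβ] at hu
    subst hu
    exact ⟨β, hβ, subset_VV.1 hx⟩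
  · rintro ⟨β, hβ, hx⟩
    exact ⟨_, vhier_ex hα, β, VV β, hβ, by rw [pairMemE_iff, pair_mem_gr]; exact ⟨hβ, rfl⟩, subset_VV.2 hx⟩

theorem cnE_iff (n : ℕ) (α : Z) : CnE zmem n α ↔
    α.IsOrdinal ∧ SgE n (fun x => x ∈ VV α) (fun _ => True) := by
  unfold CnE
  rw [ordE_iff]
  refine and_congr_right fun hα => ?_
  rw [sgE_iff]
  have : (fun x => VMemE zmem x α) = (fun x => x ∈ VV α) := by
    funext x; rw [vmemE_iff]; simp [hα]
  rw [this]

/-! ### `Δ₀` instances -/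
section
variable {k : ℕ}

instance D0.upair (p a b : Fin k) : D0 (fun v => v p = {v a, v b}) := by
  refine D0.congr (inferInstance : D0 fun v => v a ∈ v p ∧ v b ∈ v p ∧ ∀ z ∈ v p, z = v a ∨ z = v b) fun v => ?_
  rw [ZFSet.ext_iff]; simp only [ZFSet.mem_pair]
  constructor
  · rintro ⟨h1, h2, h3⟩ z
    exact ⟨h3 z, by rintro (rfl | rfl) <;> assumption⟩
  · intro h
    exact ⟨(h _).2 (.inl rfl), (h _).2 (.inr rfl), fun z hz => (h z).1 hz⟩

instance D0.opair (p a b : Fin k) : D0 (fun v => v p = pair (v a) (v b)) := by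
  refine D0.congr (inferInstance : D0 fun v => ∃ s ∈ v p, ∃ t ∈ v p, s = {v a, v a} ∧ t = {v a, v b} ∧
    v p = {s, t}) fun v => ?_
  constructor
  · rintro ⟨s, -, t, -, rfl, rfl, h⟩
    rw [h]; simp [pair]
  · intro h
    refine ⟨{v a, v a}, ?_, {v a, v b}, ?_, rfl, rfl, ?_⟩ <;> rw [h] <;> simp [pair]

instance D0.pm (f a b : Fin k) : D0 (fun v => pair (v a) (v b) ∈ v f) := by
  refine D0.congr (inferInstance : D0 fun v => ∃ p ∈ v f, p = pair (v a) (v b)) fun v => ?_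
  simp

instance D0.trans (a : Fin k) : D0 (fun v => (v a).IsTransitive) :=
  D0.congr (inferInstance : D0 fun v => ∀ y ∈ v a, ∀ z ∈ y, z ∈ v a) fun _ => Iff.rfl
instance D0.ord (a : Fin k) : D0 (fun v => (v a).IsOrdinal) := by
  simp only [isOrdinal_iff_forall_mem_isTransitive]; infer_instance
instance D0.sub (a b : Fin k) : D0 (fun v => v a ⊆ v b) :=
  D0.congr (inferInstance : D0 fun v => ∀ y ∈ v a, y ∈ v b) fun _ => Iff.rfl
instance D0.fn (f a b : Fin k) : D0 (fun v => Fn (v f) (v a) (v b)) := by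
  unfold Fn; infer_instance
instance D0.sj (f a b : Fin k) : D0 (fun v => Sj (v f) (v a) (v b)) := by
  unfold Sj; infer_instance
instance D0.ij (f a b : Fin k) : D0 (fun v => Ij (v f) (v a) (v b)) := by
  unfold Ij; infer_instance
instance D0.bj (f a b : Fin k) : D0 (fun v => Bj (v f) (v a) (v b)) := by
  unfold Bj; infer_instance
instance D0.empty (a : Fin k) : D0 (fun v => v a = ∅) :=
  D0.congr (inferInstance : D0 fun v => ∀ y ∈ v a, False) fun v => by simp [ZFSet.eq_empty]
instance D0.ins (a b c : Fin k) : D0 (fun v => v a = insert (v b) (v c)) := by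
  refine D0.congr (inferInstance : D0 fun v => v b ∈ v a ∧ (∀ y ∈ v c, y ∈ v a) ∧ ∀ y ∈ v a, y = v b ∨ y ∈ v c) fun v => ?_
  rw [ZFSet.ext_iff]; simp only [ZFSet.mem_insert_iff]
  constructor
  · rintro ⟨h1, h2, h3⟩ z
    exact ⟨h3 z, by rintro (rfl | h); exacts [h1, h2 _ h]⟩
  · intro h
    exact ⟨(h _).2 (.inl rfl), fun y hy => (h _).2 (.inr hy), fun z hz => (h z).1 hz⟩
end

end Paper

namespace Paper
open ZFSet Ordinal
open scoped Cardinal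

/-- one step of the rank specification -/
def RkB (A α r x : Z) : Prop :=
  (x ∈ A → ∃ ρ ∈ α, pair x ρ ∈ r) ∧ ∀ ρ ∈ α,
    (pair x ρ ∈ r → ∀ y ∈ x, ∃ σ ∈ ρ, pair y σ ∈ r) ∧
    ((∀ y ∈ x, ∃ σ ∈ ρ, pair y σ ∈ r) → x ∈ A ∧ pair x ρ ∈ r)

instance D0.rkB {k : ℕ} (a b c d : Fin k) : D0 (fun v => RkB (v a) (v b) (v c) (v d)) := by
  unfold RkB; infer_instance

theorem RkB.spec {U : Z → Prop} (hU : TrC U) {A α r : Z} (hα : α.IsOrdinal)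
    (h : ∀ x, U x → RkB A α r x) (x : Z) (hx : U x) : x ∈ A ↔ x ∈ VV α := by
  have key : ∀ x, U x → ∀ ρ ∈ α, (pair x ρ ∈ r ↔ rank x ≤ rank ρ) := by
    intro x
    induction x using ZFSet.inductionOn with
    | _ x ih =>
      intro hx ρ hρ
      have h1 := (h x hx).2 ρ hρ
      constructor
      · intro hp
        rw [rank_le_iff]
        intro y hy
        obtain ⟨σ, hσ, h2⟩ := h1.1 hp y hy
        exact ((ih y hy (hU x hx y hy) σ (hα.mem_trans hσ hρ)).1 h2).trans_lt (rank_lt_of_mem hσ)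
      · intro hr
        refine (h1.2 fun y hy => ?_).2
        have := (rank_lt_of_mem hy).trans_le hr
        obtain ⟨σ, hσ, h2⟩ := lt_rank_iff.1 this
        exact ⟨σ, hσ, (ih y hy (hU x hx y hy) σ (hα.mem_trans hσ hρ)).2 h2⟩
  rw [mem_VV]
  constructor
  · intro hA
    obtain ⟨ρ, hρ, h1⟩ := (h x hx).1 hA
    exact ((key x hx ρ hρ).1 h1).trans_lt (rank_lt_of_mem hρ)
  · intro hr
    obtain ⟨ρ, hρ, h1⟩ := lt_rank_iff.1 hr
    have h2 := (h x hx).2 ρ hρ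
    exact (h2.2 (h2.1 ((key x hx ρ hρ).2 h1))).1

/-- the relation witnessing the rank specification -/
noncomputable def rkR (A α : Z) : Z :=
  ZFSet.sep (fun p => ∃ x ρ, p = pair x ρ ∧ rank x ≤ rank ρ) (A.prod α)

theorem mem_rkR {A α x ρ : Z} : pair x ρ ∈ rkR A α ↔ x ∈ A ∧ ρ ∈ α ∧ rank x ≤ rank ρ := by
  simp only [rkR, ZFSet.mem_sep, ZFSet.pair_mem_prod, and_assoc]
  refine and_congr_right fun _ => and_congr_right fun _ => ?_
  constructor
  · rintro ⟨x', ρ', e, h⟩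
    obtain ⟨rfl, rfl⟩ := pair_inj.1 e
    exact h
  · intro h; exact ⟨x, ρ, rfl, h⟩

theorem RkB.ex {U : Z → Prop} (hU : TrC U) {A α : Z} (hα : α.IsOrdinal)
    (hA : ∀ x, x ∈ A ↔ U x ∧ x ∈ VV α) {r : Z} (hr : r = rkR A α) (x : Z) (hx : U x) :
    RkB A α r x := by
  subst hr
  refine ⟨fun h => ?_, fun ρ hρ => ⟨fun h y hy => ?_, fun h => ?_⟩⟩
  · obtain ⟨ρ, hρ, h1⟩ := lt_rank_iff.1 (mem_VV.1 ((hA x).1 h).2)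
    exact ⟨ρ, hρ, mem_rkR.2 ⟨h, hρ, h1⟩⟩
  · obtain ⟨h1, h2, h3⟩ := mem_rkR.1 h
    obtain ⟨σ, hσ, h4⟩ := lt_rank_iff.1 ((rank_lt_of_mem hy).trans_le h3)
    refine ⟨σ, hσ, mem_rkR.2 ⟨(hA y).2 ⟨hU x hx y hy, VV_trans α x ((hA x).1 h1).2 hy⟩,
      hα.mem_trans hσ hρ, h4⟩⟩
  · have : rank x ≤ rank ρ := by
      rw [rank_le_iff]
      intro y hy
      obtain ⟨σ, hσ, h4⟩ := h y hy
      exact (mem_rkR.1 h4).2.2.trans_lt (rank_lt_of_mem hσ)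
    have h2 : x ∈ A := (hA x).2 ⟨hx, mem_VV.2 (this.trans_lt (rank_lt_of_mem hρ))⟩
    exact ⟨h2, mem_rkR.2 ⟨h2, hρ, this⟩⟩

/-- `A = V_α` -/
def IsV (A α : Z) : Prop := α.IsOrdinal ∧ A = VV α

theorem isV_iff (A α : Z) : IsV A α ↔ α.IsOrdinal ∧ ∃ r, ∀ x, RkB A α r x := by
  refine and_congr_right fun hα => ⟨?_, ?_⟩
  · rintro rfl
    exact ⟨_, fun x => RkB.ex (U := fun _ => True) (fun _ _ _ _ => trivial) hα (by simp) rfl x trivial⟩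
  · rintro ⟨r, hr⟩
    ext x
    exact RkB.spec (U := fun _ => True) (fun _ _ _ _ => trivial) hα (fun x _ => hr x) x trivial

instance Sg.isV {n k : ℕ} (a b : Fin k) : Sg (n+2) (fun v => IsV (v a) (v b)) := by
  simp only [isV_iff]; infer_instance

/-! ### Cardinality -/

theorem card_le_of_surj {a b : Z} (F : Z → Z) (h : ∀ y ∈ b, ∃ x ∈ a, F x = y) : card b ≤ card a := by
  have : #b ≤ #a := by
    choose! G hG hG2 using h
    refine Cardinal.mk_le_of_injective (f := fun y : b => (⟨G y.1, hG y.1 y.2⟩ : a)) ?_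
    intro y y' e
    have e : G y.1 = G y'.1 := congrArg Subtype.val e
    apply Subtype.ext
    rw [← hG2 y.1 y.2, ← hG2 y'.1 y'.2, e]
  rw [cardinalMk_coe_sort, cardinalMk_coe_sort] at this
  exact Cardinal.lift_le.1 this

theorem Sj.card_le {f a b : Z} (h : Sj f a b) : card b ≤ card a := by
  obtain ⟨F, h1, rfl⟩ := h.1.exists_fun
  refine card_le_of_surj F fun y hy => ?_
  obtain ⟨x, hx, h2⟩ := h.2 y hy
  exact ⟨x, hx, (pair_mem_gr.1 h2).2⟩

theorem card_le_of_inj {a b : Z} (F : Z → Z) (h : ∀ x ∈ a, F x ∈ b)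
    (h' : ∀ x ∈ a, ∀ x' ∈ a, F x = F x' → x = x') : card a ≤ card b := by
  have : #a ≤ #b := by
    refine Cardinal.mk_le_of_injective (f := fun y : a => (⟨F y.1, h y.1 y.2⟩ : b)) ?_
    intro y y' e
    exact Subtype.ext (h' _ y.2 _ y'.2 (congrArg Subtype.val e))
  rw [cardinalMk_coe_sort, cardinalMk_coe_sort] at this
  exact Cardinal.lift_le.1 this

theorem Ij.card_le {f a b : Z} (h : Ij f a b) : card a ≤ card b := by
  obtain ⟨F, h1, rfl⟩ := h.1.exists_fun
  refine card_le_of_inj F h1 fun x hx x' hx' e => ?_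
  exact h.2 x hx x' hx' (F x) (h1 x hx) (pair_mem_gr.2 ⟨hx, rfl⟩) (pair_mem_gr.2 ⟨hx', e.symm⟩)

theorem exists_ij {a b : Z} (h : card a ≤ card b) : ∃ F : Z → Z, (∀ x ∈ a, F x ∈ b) ∧
    ∀ x ∈ a, ∀ x' ∈ a, F x = F x' → x = x' := by
  have : #a ≤ #b := by
    rw [cardinalMk_coe_sort, cardinalMk_coe_sort]; exact Cardinal.lift_le.2 h
  obtain ⟨e⟩ := this
  classical
  refine ⟨fun x => if hx : x ∈ a then (e ⟨x, hx⟩ : b).1 else ∅, fun x hx => ?_, fun x hx x' hx' => ?_⟩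
  · simp only [hx, dif_pos]; exact (e ⟨x, hx⟩ : b).2
  · simp only [hx, hx', dif_pos]
    intro h
    have := e.injective (Subtype.ext h)
    exact congrArg Subtype.val this

theorem exists_bj {a b : Z} (h : card a = card b) : ∃ F : Z → Z, (∀ x ∈ a, F x ∈ b) ∧
    (∀ x ∈ a, ∀ x' ∈ a, F x = F x' → x = x') ∧ ∀ y ∈ b, ∃ x ∈ a, F x = y := by
  have : #a = #b := by
    rw [cardinalMk_coe_sort, cardinalMk_coe_sort, h]
  obtain ⟨e⟩ := Cardinal.eq.1 this
  classical
  refine ⟨fun x => if hx : x ∈ a then (e ⟨x, hx⟩ : b).1 else ∅, fun x hx => ?_, fun x hx x' hx' => ?_, fun y hy => ?_⟩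
  · simp only [hx, dif_pos]; exact (e ⟨x, hx⟩ : b).2
  · simp only [hx, hx', dif_pos]
    intro h
    have := e.injective (Subtype.ext h)
    exact congrArg Subtype.val this
  · refine ⟨(e.symm ⟨y, hy⟩).1, (e.symm ⟨y, hy⟩).2, ?_⟩
    simp

theorem exists_sj {a b : Z} (h : card b ≤ card a) (hb : ∃ y, y ∈ b) : ∃ F : Z → Z, (∀ x ∈ a, F x ∈ b) ∧
    ∀ y ∈ b, ∃ x ∈ a, F x = y := by
  obtain ⟨G, h1, h2⟩ := exists_ij h
  obtain ⟨y0, hy0⟩ := hb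
  classical
  refine ⟨fun x => if hx : ∃ y ∈ b, G y = x then hx.choose else y0, fun x hx => ?_, fun y hy => ?_⟩
  · by_cases hx : ∃ y ∈ b, G y = x
    · simp only [hx, dif_pos]; exact hx.choose_spec.1
    · simp only [hx, dif_neg, not_false_eq_true]; exact hy0
  · refine ⟨G y, h1 y hy, ?_⟩
    have : ∃ y' ∈ b, G y' = G y := ⟨y, hy, rfl⟩
    simp only [this, dif_pos]
    exact h2 _ this.choose_spec.1 _ hy this.choose_spec.2

theorem Bj.card_eq {f a b : Z} (h : Bj f a b) : card a = card b := le_antisymm h.2.card_le h.1.card_le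

theorem gr_bj {a b : Z} {F : Z → Z} (h : ∀ x ∈ a, F x ∈ b) (h1 : ∀ x ∈ a, ∀ x' ∈ a, F x = F x' → x = x')
   (h' : ∀ y ∈ b, ∃ x ∈ a, F x = y) : Bj (gr a F) a b := ⟨gr_sj h h', gr_ij h h1⟩

theorem ord_card {a : Z} (h : a.IsOrdinal) : card a = (rank a).card := by
  rw [← card_toZFSet, h.toZFSet_rank_eq]

/-- the ordinal `|x|` -/
noncomputable def cardOrd (x : Z) : Z := (card x).ord.toZFSet

theorem cardOrd_ord (x : Z) : (cardOrd x).IsOrdinal := isOrdinal_toZFSet _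
theorem card_cardOrd (x : Z) : card (cardOrd x) = card x := by simp [cardOrd, card_toZFSet]

theorem cardE_iff (κ : Z) : CardE zmem κ ↔ κ.IsOrdinal ∧ (card κ).ord = rank κ := by
  unfold CardE
  rw [ordE_iff]
  refine and_congr_right fun h => ?_
  simp only [bijE_iff, zmem_iff]
  have hle : (card κ).ord ≤ rank κ := by rw [ord_card h]; exact Cardinal.ord_card_le _
  constructor
  · intro h2
    by_contra h3
    have h3 : (card κ).ord < rank κ := lt_of_le_of_ne hle h3
    refine h2 (cardOrd κ) ?_ ?_
    · rw [← h.toZFSet_rank_eq]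
      exact toZFSet_mem_toZFSet_iff.2 (by rwa [h.toZFSet_rank_eq])
    · obtain ⟨F, h4, h5, h6⟩ := exists_bj (card_cardOrd κ)
      exact ⟨_, gr_bj h4 h5 h6⟩
  · rintro h2 α hα ⟨f, hf⟩
    have h3 := hf.card_eq
    have h4 := rank_lt_of_mem hα
    rw [← h2, Cardinal.lt_ord, ← ord_card (h.mem hα), h3] at h4
    exact lt_irrefl _ h4

theorem CardE.lt {κ : Z} (h : CardE zmem κ) {α : Z} (hα : α ∈ κ) : card α < card κ := by
  obtain ⟨h1, h2⟩ := (cardE_iff κ).1 h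
  rw [ord_card (h1.mem hα), ← Cardinal.lt_ord, h2]
  exact rank_lt_of_mem hα

theorem mem_ord_iff {κ : Z} (hκ : κ.IsOrdinal) {x : Z} : x ∈ κ ↔ x.IsOrdinal ∧ rank x < rank κ :=
  ⟨fun h => ⟨hκ.mem h, rank_lt_of_mem h⟩, fun h => (h.1.rank_lt_iff_mem hκ).1 h.2⟩

theorem hMemE_iff (x θ : Z) : HMemE zmem x θ ↔
    ∃ t : Z, t.IsTransitive ∧ x ⊆ t ∧ ∃ β ∈ θ, ∃ f, Sj f β t := by
  unfold HMemE
  simp only [surjE_iff]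
  constructor
  · rintro ⟨t, h1, h2, β, f, h3, h4⟩
    exact ⟨t, h1, h2, β, h3, f, h4⟩
  · rintro ⟨t, h1, h2, β, h3, f, h4⟩
    exact ⟨t, h1, h2, β, f, h3, h4⟩

theorem mem_VV_of_mem {α x : Z} (h : x ∈ α) : x ∈ VV α := mem_VV.2 (rank_lt_of_mem h)

theorem hMem_rank {x θ : Z} (hθ : CardE zmem θ) (h : HMemE zmem x θ) : x ∈ VV θ := by
  obtain ⟨t, h1, h2, β, hβ, f, hf⟩ := (hMemE_iff x θ).1 h
  refine mem_VV.2 ((rank_mono h2).trans_lt ?_)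
  by_contra h3
  push Not at h3
  -- the ranks of elements of t form an ordinal
  have key : ∀ u : Z, ∀ t' : Z, t'.IsTransitive → u ⊆ t' → ∀ o < rank u, ∃ y ∈ t', rank y = o := by
    intro u
    induction u using ZFSet.inductionOn with
    | _ u ih =>
      intro t' ht' hu o ho
      obtain ⟨y, hy, h5⟩ := lt_rank_iff.1 ho
      rcases h5.eq_or_lt with h5 | h5
      · exact ⟨y, hu hy, h5.symm⟩
      · exact ih y hy t' ht' (fun z hz => ht' y (hu hy) hz) o h5
  have : card θ ≤ card t := by
    refine card_le_of_surj (fun y => (rank y).toZFSet) fun α hα => ?_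
    have hα' := (((cardE_iff θ).1 hθ).1.mem hα)
    obtain ⟨y, hy, e⟩ := key t t h1 (fun _ h => h) (rank α) ((rank_lt_of_mem hα).trans_le h3)
    exact ⟨y, hy, by rw [e, hα'.toZFSet_rank_eq]⟩
  have h4 := this.trans hf.card_le
  exact absurd (CardE.lt hθ hβ) (not_lt.2 h4)

end Paper

namespace Paper
open ZFSet Ordinal
open scoped Cardinal

theorem cn_reflect {n k : ℕ} {κ : Z} (hκ : CnE zmem (n+1) κ) {P : (Fin k → Z) → Z → Prop}
    (hP : Sg (n+1) (fun w : Fin (k+1) → Z => P (fun i => w i.castSucc) (w (Fin.last k))))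
    (a : Fin k → Z) (ha : ∀ i, a i ∈ VV κ)
    (h : ∃ x, P a x) : ∃ x ∈ VV κ, P a x := by
  obtain ⟨φ, h1, h2⟩ := hP.formula.1
  have h3 := ((cnE_iff _ _).1 hκ).2
  have h4 := (h3.2 φ.ex (.ex h1) a ha).2 (by
    rw [RIn_ex]
    obtain ⟨x, hx⟩ := h
    exact ⟨x, trivial, (h2 _).2 (by simpa using hx)⟩)
  rw [RIn_ex] at h4
  obtain ⟨x, hx, h5⟩ := h4
  refine ⟨x, hx, ?_⟩
  have := (h2 _).1 ((h3.2 φ h1 _ (snoc_sub a ha x hx)).1 h5)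
  simpa using this

theorem two_three {n : ℕ} {κ : Z} (hc : CardE zmem κ) (hκ : CnE zmem (n+1) κ) :
    ¬ ∃ ε : Z, OrdE zmem ε ∧ (κ ∈ ε ∨ κ = ε) ∧
        SigmaDefinableSingleton (n + 1) ε fun x => HMemE zmem x κ := by
  rintro ⟨ε, h1, h2, k, φ, p, h3, h4, h5, h6⟩
  rw [realize_iff] at h5
  simp only [realize_iff] at h6
  have e : ∀ {l : ℕ} (w : Fin l → Z) (f : Fin k → Fin l) (j : Fin l),
    (Fin.cons (w j) (fun i => w (f i)) : Fin (k+1) → Z) = fun i => w ((Fin.cons j f : Fin (k+1) → Fin l) i) := by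
    intro l w f j
    funext i
    refine Fin.cases ?_ (fun i => ?_) i <;> simp
  obtain ⟨x, hx, hP⟩ := cn_reflect hκ (P := fun v x => Tru φ (Fin.cons x v)) (by
    simp only [e]; exact h3.sg.subst _) p (fun i => hMem_rank hc (h4 i)) ⟨ε, h5⟩
  have := h6 x hP
  subst this
  rw [mem_VV] at hx
  rcases h2 with h2 | rfl
  · exact absurd (rank_lt_of_mem h2) (not_lt.2 hx.le)
  · exact lt_irrefl _ hx

/-- negation of (3), positively phrased -/
theorem sds {n k : ℕ} {P : Z → (Fin k → Z) → Prop}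
    (hP : Sg n (fun w : Fin (k+1) → Z => P (w 0) (fun i => w i.succ))) {ε : Z} {p : Fin k → Z} {H : Z → Prop}
    (hp : ∀ i, H (p i)) (h1 : P ε p) (h2 : ∀ y, P y p → y = ε) :
    SigmaDefinableSingleton n ε H := by
  obtain ⟨φ, h3, h4⟩ := hP.formula.1
  refine ⟨k, φ, p, h3, hp, ?_, fun y => ?_⟩
  · rw [realize_iff, h4]; simpa using h1
  · rw [realize_iff, h4]; intro h; exact h2 y (by simpa using h)

theorem three_star {n k : ℕ} {κ : Z} (hκ : κ.IsOrdinal)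
    (h : ¬ ∃ ε : Z, OrdE zmem ε ∧ (κ ∈ ε ∨ κ = ε) ∧
        SigmaDefinableSingleton (n + 2) ε fun x => HMemE zmem x κ)
    {P : (Fin k → Z) → Z → Prop}
    (hP : Sg (n+2) (fun w : Fin (k+1) → Z => P (fun i => w i.castSucc) (w (Fin.last k))))
    (a : Fin k → Z) (ha : ∀ i, HMemE zmem (a i) κ)
    (hx : ∃ x, P a x) : ∃ x ∈ VV κ, P a x := by
  obtain ⟨Q, h1, h2⟩ := sg_succ.1 hP
  have h2 : ∀ a x, P a x ↔ ∃ y, Q (Fin.snoc (Fin.snoc a x : Fin (k+1) → Z) y) := by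
    intro a x; rw [← h2]; simp
  let Q' : (Fin k → Z) → Z → Prop := fun a s => ∃ x ∈ s, ∃ y ∈ s, Q (Fin.snoc (Fin.snoc a x : Fin (k+1) → Z) y)
  have hQ' : Pn (n+1) (fun w : Fin (k+1) → Z => Q' (fun i => w i.castSucc) (w (Fin.last k))) := by
    have := h1
    refine (cl _).pbex _ ?_
    refine (cl _).pbex _ ?_
    simp only [snoc_comp]
    exact h1.subst _
  have hex : ∃ s, Q' a s := by
    obtain ⟨x, hx⟩ := hx
    obtain ⟨y, hy⟩ := (h2 a x).1 hx
    exact ⟨{x, y}, x, by simp, y, by simp, hy⟩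
  -- least rank
  let I : Set Ordinal.{0} := {o | ∃ s, rank s = o ∧ Q' a s}
  have hI : I.Nonempty := by
    obtain ⟨s, hs⟩ := hex
    exact ⟨_, s, rfl, hs⟩
  obtain ⟨s, hs, hQs⟩ : sInf I ∈ I := csInf_mem hI
  have hmin : ∀ s', Q' a s' → rank s ≤ rank s' := fun s' h' => by
    rw [hs]; exact csInf_le' ⟨s', rfl, h'⟩
  have hlt : rank s < rank κ := by
    by_contra hge
    push Not at hge
    apply h
    refine ⟨(rank s).toZFSet, (ordE_iff _).2 (isOrdinal_toZFSet _), ?_, ?_⟩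
    · rcases hge.eq_or_lt with e | e
      · right; rw [← e, hκ.toZFSet_rank_eq]
      · left; rw [← hκ.toZFSet_rank_eq]; exact toZFSet_mem_toZFSet_iff.2 e
    · refine sds (P := fun ε v => ∃ s B, IsV B ε ∧ s ⊆ B ∧ s ∉ B ∧ Q' v s ∧ ∀ s' ∈ B, ¬ Q' v s') ?_ ha ?_ ?_
      · have i1 : ∀ {l : ℕ} (f : Fin k → Fin l) (j : Fin l), Pn (n+1) (fun w : Fin l → Z => Q' (fun i => w (f i)) (w j)) := by
          intro l f j
          have := hQ'.subst (Fin.snoc f j : Fin (k+1) → Fin l)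
          simpa using this
        clear_value Q'
        have i2 : ∀ {l : ℕ} (f : Fin k → Fin l) (j : Fin l), Sg (n+2) (fun w : Fin l → Z => ¬ Q' (fun i => w (f i)) (w j)) := fun f j => (Sg.not' (i1 f j)).succ
        have i3 : ∀ {l : ℕ} (f : Fin k → Fin l) (j : Fin l), Sg (n+2) (fun w : Fin l → Z => Q' (fun i => w (f i)) (w j)) := fun f j => (i1 f j).toSg
        infer_instance
      · refine ⟨s, VV s, ⟨isOrdinal_toZFSet _, ?_⟩, ?_, ?_, hQs, fun s' hs' hq => ?_⟩
        · simp [VV]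
        · exact subset_VV.2 le_rfl
        · rw [mem_VV]; exact lt_irrefl _
        · exact absurd (hmin s' hq) (not_le.2 (mem_VV.1 hs'))
      · rintro y ⟨s', B, ⟨hy, rfl⟩, h5, h6, h7, h8⟩
        rw [← hy.toZFSet_rank_eq]
        congr 1
        rw [subset_VV] at h5
        rw [mem_VV, not_lt] at h6
        have h9 : rank y ≤ rank s := by
          by_contra h9
          push Not at h9
          exact h8 s (mem_VV.2 h9) hQs
        exact le_antisymm h9 ((hmin s' h7).trans h5)
  obtain ⟨x, hx, y, hy, hq⟩ := hQs
  exact ⟨x, mem_VV.2 ((rank_lt_of_mem hx).trans hlt), (h2 a x).2 ⟨y, hq⟩⟩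

theorem ord_hmem {κ α : Z} (hκ : κ.IsOrdinal) (hα : α ∈ κ) : HMemE zmem α κ := by
  rw [hMemE_iff]
  exact ⟨α, (hκ.mem hα).isTransitive, fun _ h => h, α, hα, gr α id, gr_sj (fun _ h => h) fun y hy => ⟨y, hy, rfl⟩⟩

theorem rank_mem_ord {κ x : Z} (hκ : κ.IsOrdinal) (hx : x ∈ VV κ) : (rank x).toZFSet ∈ κ := by
  rw [mem_ord_iff hκ]
  exact ⟨isOrdinal_toZFSet _, by simpa using mem_VV.1 hx⟩

theorem three_two {n : ℕ} {κ : Z} (hc : CardE zmem κ)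
    (h : ¬ ∃ ε : Z, OrdE zmem ε ∧ (κ ∈ ε ∨ κ = ε) ∧
        SigmaDefinableSingleton (n + 2) ε fun x => HMemE zmem x κ) : CnE zmem (n+2) κ := by
  have hκ := ((cardE_iff κ).1 hc).1
  have hV : ∀ x ∈ VV κ, HMemE zmem x κ := by
    intro x hx
    have hα := rank_mem_ord hκ hx
    obtain ⟨β, hβ, hβ', A, f, hA, hf⟩ := three_star hκ h (k := 1)
      (P := fun v x => x.IsOrdinal ∧ ∃ A f, IsV A (v 0) ∧ Sj f x A)
      (inferInstance) ![(rank x).toZFSet] (by intro i; simpa using ord_hmem hκ hα) (by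
        refine ⟨cardOrd (VV x), cardOrd_ord _, VV x, ?_⟩
        obtain ⟨F, h1, h2, h3⟩ := exists_bj (card_cardOrd (VV x))
        exact ⟨gr _ F, ⟨isOrdinal_toZFSet _, by simp [VV]⟩, gr_sj h1 h3⟩)
    have hA2 : A = VV x := by rw [hA.2]; simp [VV]
    subst hA2
    rw [hMemE_iff]
    exact ⟨VV x, VV_trans x, subset_VV.2 le_rfl, β, (mem_ord_iff hκ).2 ⟨hβ', mem_VV.1 hβ⟩, f, hf⟩
  rw [cnE_iff]
  refine ⟨hκ, SgE.of_tv (VV_trC κ) (fun _ _ _ _ => trivial) (fun _ _ => trivial) fun k φ hφ v hv hx => ?_⟩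
  refine three_star hκ h (P := fun a x => Tru φ (Fin.snoc a x)) ?_ v (fun i => hV _ (hv i)) (by simpa using hx)
  simp only [snoc_init]
  exact hφ.sg

end Paper

namespace Paper
open ZFSet Ordinal
open scoped Cardinal

/-- full elementarity -/
def El (S T : Z → Prop) : Prop := (∀ x, S x → T x) ∧
  ∀ ⦃k : ℕ⦄ (φ : SetFormula k) (v : Fin k → Z), (∀ i, S (v i)) → (RIn S φ v ↔ RIn T φ v)

theorem El.of_tv {S T : Z → Prop} (hST : ∀ x, S x → T x)
    (h : ∀ (k : ℕ) (φ : SetFormula (k+1)) (v : Fin k → Z), (∀ i, S (v i)) →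
      (∃ x, T x ∧ RIn T φ (Fin.snoc v x)) → ∃ x, S x ∧ RIn T φ (Fin.snoc v x)) : El S T := by
  refine ⟨hST, fun k φ v hv => ?_⟩
  induction φ with
  | mem i j => rfl
  | eq i j => rfl
  | fal => rfl
  | imp φ ψ ih1 ih2 => simp [ih1 v hv, ih2 v hv]
  | all φ ih =>
    rw [RIn_all, RIn_all]
    constructor
    · intro h2
      by_contra h3
      push Not at h3
      obtain ⟨a, ha, h6⟩ := h _ φ.not v hv (by simpa using h3)
      rw [RIn_not] at h6
      exact h6 ((ih _ (snoc_sub v hv a ha)).1 (h2 a ha))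
    · intro h2 a ha
      exact (ih _ (snoc_sub v hv a ha)).2 (h2 a (hST a ha))

theorem El.sgE {S T : Z → Prop} (h : El S T) (n : ℕ) : SgE n S T := ⟨h.1, fun _ φ _ v hv => h.2 φ v hv⟩

open Classical in
/-- Skolem functions -/
noncomputable def sk (T : Z → Prop) {k : ℕ} (φ : SetFormula (k+1)) (v : Fin k → Z) : Z :=
  if h : ∃ x, T x ∧ RIn T φ (Fin.snoc v x) then h.choose else ∅

theorem sk_spec {T : Z → Prop} {k : ℕ} {φ : SetFormula (k+1)} {v : Fin k → Z}
    (h : ∃ x, T x ∧ RIn T φ (Fin.snoc v x)) : T (sk T φ v) ∧ RIn T φ (Fin.snoc v (sk T φ v)) := by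
  unfold sk
  rw [dif_pos h]; exact h.choose_spec

theorem El.of_sk {S T : Z → Prop} (hST : ∀ x, S x → T x)
    (h : ∀ (k : ℕ) (φ : SetFormula (k+1)) (v : Fin k → Z), (∀ i, S (v i)) →
      (∃ x, T x ∧ RIn T φ (Fin.snoc v x)) → S (sk T φ v)) : El S T :=
  El.of_tv hST fun k φ v hv hx => ⟨_, h k φ v hv hx, (sk_spec hx).2⟩

/-- type of all formulas with a distinguished variable -/
abbrev Fm := Σ k : ℕ, SetFormula (k+1)

theorem exists_club (o : Ordinal.{0}) : ∃ l : Ordinal.{0}, o < l ∧ El (fun x => x ∈ V_ l) (fun _ => True) := by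
  let T : Z → Prop := fun _ => True
  let st : Ordinal.{0} → Ordinal.{0} := fun o => max (Order.succ o)
    (⨆ p : (Σ φ : Fm, Fin φ.1 → V_ o), Order.succ (rank (sk T p.1.2 (fun i => (p.2 i).1))))
  have hst1 : ∀ o, o < st o := fun o => (Order.lt_succ o).trans_le (le_max_left _ _)
  have hst2 : ∀ o (φ : Fm) (v : Fin φ.1 → Z), (∀ i, v i ∈ V_ o) → sk T φ.2 v ∈ V_ (st o) := by
    intro o φ v hv
    rw [mem_vonNeumann]
    have : Order.succ (rank (sk T φ.2 v)) ≤ ⨆ p : (Σ φ : Fm, Fin φ.1 → V_ o), Order.succ (rank (sk T p.1.2 (fun i => (p.2 i).1))) :=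
      le_ciSup (bddAbove_of_small) (⟨φ, fun i => ⟨v i, hv i⟩⟩ : Σ φ : Fm, Fin φ.1 → V_ o)
    exact (Order.lt_succ _).trans_le (this.trans (le_max_right _ _))
  let a : ℕ → Ordinal.{0} := fun n => st^[n] o
  have ha : ∀ n, a (n+1) = st (a n) := fun n => Function.iterate_succ_apply' st n o
  have hmono : StrictMono a := strictMono_nat_of_lt_succ fun n => by rw [ha]; exact hst1 _
  have hle : ∀ n, a n ≤ ⨆ n, a n := fun n => le_ciSup (bddAbove_of_small) n
  refine ⟨⨆ n, a n, (hst1 o).trans_le (by have := hle 1; rwa [ha] at this), El.of_sk (fun _ _ => trivial) fun k φ v hv _ => ?_⟩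
  have : ∀ i, ∃ n, v i ∈ V_ (a n) := fun i => by
    have := mem_vonNeumann.1 (hv i)
    obtain ⟨n, hn⟩ := (lt_ciSup_iff (bddAbove_of_small)).1 this
    exact ⟨n, mem_vonNeumann.2 hn⟩
  choose N hN using this
  obtain ⟨m, hm⟩ : ∃ m, ∀ i, N i ≤ m := ⟨Finset.univ.sup N, fun i => Finset.le_sup (Finset.mem_univ i)⟩
  have := hst2 (a m) ⟨k, φ⟩ v fun i => vonNeumann_subset_of_le (hmono.monotone (hm i)) (hN i)
  rw [← ha] at this
  exact vonNeumann_subset_of_le (hle _) this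

theorem exists_cn (x : Z) : ∃ θ : Z, θ.IsOrdinal ∧ x ∈ VV θ ∧ El (fun x => x ∈ VV θ) (fun _ => True) ∧
    ∀ n, CnE zmem n θ := by
  obtain ⟨l, h1, h2⟩ := exists_club (rank x)
  have e : VV l.toZFSet = V_ l := by simp [VV]
  refine ⟨l.toZFSet, isOrdinal_toZFSet _, mem_VV.2 (by simpa using h1), by rw [e]; exact h2, fun n => ?_⟩
  rw [cnE_iff, e]
  exact ⟨isOrdinal_toZFSet _, h2.sgE n⟩

/-! ### facts on `C¹` -/

theorem CnE.ord {n : ℕ} {θ : Z} (h : CnE zmem n θ) : θ.IsOrdinal := (ordE_iff θ).1 h.1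

/-- inductive sets -/
def Ind (w : Z) : Prop := (∃ e ∈ w, e = ∅) ∧ ∀ x ∈ w, ∃ s ∈ w, s = insert x x
instance D0.indI {k : ℕ} (a : Fin k) : D0 (fun v => Ind (v a)) := by unfold Ind; infer_instance

noncomputable def om : Z := (ω : Ordinal.{0}).toZFSet

theorem mem_om {x : Z} : x ∈ om ↔ ∃ n : ℕ, x = (n : Ordinal.{0}).toZFSet := by
  rw [om, mem_toZFSet_iff]
  constructor
  · rintro ⟨a, ha, rfl⟩
    obtain ⟨n, rfl⟩ := lt_omega0.1 ha
    exact ⟨n, rfl⟩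
  · rintro ⟨n, rfl⟩; exact ⟨n, natCast_lt_omega0 n, rfl⟩

/-- natural numbers as sets -/
noncomputable def nt (n : ℕ) : Z := (n : Ordinal.{0}).toZFSet
theorem nt_zero : nt 0 = ∅ := by simp [nt]
theorem nt_succ (n : ℕ) : nt (n+1) = insert (nt n) (nt n) := by
  simp only [nt, Nat.cast_add, Nat.cast_one, toZFSet_add_one]
theorem nt_inj {m n : ℕ} (h : nt m = nt n) : m = n := by
  have := toZFSet_injective h
  exact_mod_cast this

theorem Ind.nt {w : Z} (h : Ind w) (n : ℕ) : nt n ∈ w := by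
  induction n with
  | zero => rw [nt_zero]; obtain ⟨e, he, rfl⟩ := h.1; exact he
  | succ n ih => rw [nt_succ]; obtain ⟨s, hs, rfl⟩ := h.2 _ ih; exact hs

theorem ind_om : Ind om := by
  refine ⟨⟨_, mem_om.2 ⟨0, rfl⟩, by simp⟩, fun x hx => ?_⟩
  obtain ⟨n, rfl⟩ := mem_om.1 hx
  exact ⟨_, mem_om.2 ⟨n+1, rfl⟩, nt_succ n⟩

theorem om_ord : om.IsOrdinal := isOrdinal_toZFSet _

theorem omegaSpec_om : OmegaSpecE zmem om := by
  have h0 : (∅ : Z) ∈ om := mem_om.2 ⟨0, by simp⟩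
  refine ⟨⟨(ordE_iff _).2 om_ord, ⟨∅, h0⟩, fun α hα => ?_⟩, fun x hx hl => ?_⟩
  · obtain ⟨n, rfl⟩ := mem_om.1 hα
    refine ⟨_, mem_om.2 ⟨n+1, rfl⟩, ?_⟩
    exact toZFSet_mem_toZFSet_iff.2 (by exact_mod_cast Nat.lt_succ_self n)
  · obtain ⟨n, rfl⟩ := mem_om.1 hx
    obtain ⟨-, ⟨y, hy⟩, h2⟩ := hl
    cases n with
    | zero => simp [zmem] at hy
    | succ n =>
      obtain ⟨β, hβ, h3⟩ := h2 (nt n) (by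
        exact toZFSet_mem_toZFSet_iff.2 (by exact_mod_cast Nat.lt_succ_self n))
      have h4 : β ∈ insert (nt n) (nt n) := by rw [← nt_succ]; exact hβ
      rcases ZFSet.mem_insert_iff.1 h4 with rfl | h4
      · exact ZFSet.mem_irrefl _ h3
      · exact ZFSet.mem_asymm h3 h4

theorem Ind.rank {w : Z} (h : Ind w) : ω ≤ rank w := by
  rw [omega0_le]
  intro n
  have := rank_lt_of_mem (h.nt n)
  simp only [Paper.nt, rank_toZFSet] at this
  exact this.le

/-- description of `C¹` -/
def C1 (l A : Z) : Prop := l.IsOrdinal ∧ (∃ w ∈ A, Ind w) ∧ (∀ α ∈ l, ∃ β ∈ l, α ∈ β) ∧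
  ∀ x ∈ A, ∃ t ∈ A, ∃ β ∈ A, ∃ f ∈ A, t.IsTransitive ∧ x ⊆ t ∧ β.IsOrdinal ∧ Sj f β t

instance D0.c1 {k : ℕ} (a b : Fin k) : D0 (fun v => C1 (v a) (v b)) := by unfold C1; infer_instance

theorem CnE.c1 {n : ℕ} {θ : Z} (h : CnE zmem (n+1) θ) : C1 θ (VV θ) := by
  have ho := h.ord
  refine ⟨ho, ?_, fun α hα => ?_, fun x hx => ?_⟩
  · exact cn_reflect h (k := 0) (P := fun _ x => Ind x) inferInstance ![] (by simp) ⟨om, ind_om⟩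
  · obtain ⟨x, hx, e⟩ := cn_reflect h (k := 1) (P := fun v x => x = insert (v 0) (v 0)) inferInstance ![α]
      (by simpa using mem_VV_of_mem hα) ⟨insert α α, by simp⟩
    simp at e
    subst e
    exact ⟨insert α α, (mem_ord_iff ho).2 ⟨isOrdinal_succ (ho.mem hα), mem_VV.1 hx⟩, by simp⟩
  · obtain ⟨c, hc, t, ht, β, hβ, f, hf, h1⟩ := cn_reflect h (k := 1) (P := fun v c => ∃ t ∈ c, ∃ β ∈ c, ∃ f ∈ c,
        t.IsTransitive ∧ v 0 ⊆ t ∧ β.IsOrdinal ∧ Sj f β t) inferInstance ![x]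
      (by simpa using hx) (by
        obtain ⟨F, h1, h2, h3⟩ := exists_bj (card_cardOrd (VV x))
        refine ⟨{VV x, cardOrd (VV x), gr (cardOrd (VV x)) F}, VV x, by simp, cardOrd (VV x), by simp, gr (cardOrd (VV x)) F, by simp, VV_trans x,
          subset_VV.2 le_rfl, cardOrd_ord _, gr_sj h1 h3⟩)
    have := VV_trans θ _ hc
    exact ⟨t, this ht, β, this hβ, f, this hf, by simpa using h1⟩

theorem C1.cardE {θ : Z} (h : C1 θ (VV θ)) : CardE zmem θ := by
  have ho := h.1
  unfold CardE
  rw [ordE_iff]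
  refine ⟨ho, ?_⟩
  rintro α (hα : α ∈ θ) ⟨f, hf⟩
  rw [bijE_iff] at hf
  have h1 := hf.card_eq
  obtain ⟨β, hβ, hαβ⟩ := h.2.2.1 α hα
  have : powerset α ∈ VV θ := by
    rw [mem_VV, rank_powerset]
    exact (Order.succ_le_of_lt (rank_lt_of_mem hαβ)).trans_lt (rank_lt_of_mem hβ)
  obtain ⟨t, ht, γ, hγ, g, hg, h2, h3, h4, h5⟩ := h.2.2.2 _ this
  have h6 : card (powerset α) ≤ card γ := (card_mono h3).trans h5.card_le
  have h7 : γ ∈ θ := (mem_ord_iff ho).2 ⟨h4, mem_VV.1 hγ⟩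
  have h8 : card γ ≤ card θ := card_mono (ho.subset_of_mem h7)
  rw [card_powerset] at h6
  have := h6.trans h8
  rw [← h1] at this
  exact absurd (Cardinal.cantor _) (not_lt.2 this)

theorem C1.hmem {θ : Z} (h : C1 θ (VV θ)) (x : Z) : HMemE zmem x θ ↔ x ∈ VV θ := by
  refine ⟨hMem_rank h.cardE, fun hx => ?_⟩
  obtain ⟨t, ht, γ, hγ, g, hg, h2, h3, h4, h5⟩ := h.2.2.2 _ hx
  rw [hMemE_iff]
  exact ⟨t, h2, h3, γ, (mem_ord_iff h.1).2 ⟨h4, mem_VV.1 hγ⟩, g, h5⟩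

theorem C1.om_mem {θ : Z} (h : C1 θ (VV θ)) : om ∈ θ := by
  obtain ⟨w, hw, h1⟩ := h.2.1
  rw [mem_ord_iff h.1]
  exact ⟨om_ord, by simpa [om] using h1.rank.trans_lt (mem_VV.1 hw)⟩

end Paper

namespace Paper
open ZFSet Ordinal
open scoped Cardinal

theorem exists_surj {A B : Type} [Nonempty B] (h : #B ≤ #A) : ∃ s : A → B, Function.Surjective s := by
  obtain ⟨f⟩ := h
  exact ⟨Function.invFun f, Function.invFun_surjective f.injective⟩

theorem exists_closure {P : Type} (ar : P → Type) (op : ∀ p, (ar p → Z) → Z) (κ μ : Cardinal.{0})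
    (hκ : κ.IsRegular) (hκμ : κ ≤ μ) (hP : #P ≤ μ) (har : ∀ p, #(ar p) < κ) (hpow : ∀ p, μ ^ #(ar p) ≤ μ)
    (base : Z) (hb : base.card ≤ μ) (b0 : Z) (hb0 : b0 ∈ base) :
    ∃ X : Z, base ⊆ X ∧ (∀ p v, (∀ i, v i ∈ X) → op p v ∈ X) ∧ X.card ≤ μ ∧
      ∀ T : Z → Prop, (∀ x ∈ base, T x) → (∀ p v, (∀ i, T (v i)) → T (op p v)) → ∀ x ∈ X, T x := by
  have hμ : ℵ₀ ≤ μ := hκ.aleph0_le.trans hκμ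
  let W := κ.ord.ToType
  have hW : #W = κ := by simp [W]
  let D := μ.out
  have hD : #D = μ := μ.mk_out
  let B := (W × Σ p, (ar p → D)) ⊕ Shrink.{0} base
  have hnb : Nonempty (Shrink.{0} base) := ⟨equivShrink _ ⟨b0, hb0⟩⟩
  have hB : #B ≤ #D := by
    have h1 : #(Σ p, (ar p → D)) ≤ μ := by
      rw [Cardinal.mk_sigma]
      refine (Cardinal.sum_le_sum _ (fun _ => μ) fun p => ?_).trans ?_
      · simpa [hD] using hpow p
      · rw [Cardinal.sum_const']; exact Cardinal.mul_le_of_le hμ hP le_rfl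
    simp only [B, Cardinal.mk_sum, Cardinal.mk_prod, Cardinal.lift_id, hW, hD]
    exact Cardinal.add_le_of_le hμ (Cardinal.mul_le_of_le hμ hκμ h1) hb
  obtain ⟨s, hs⟩ := exists_surj hB
  classical
  let c : W → D → Z := WellFounded.fix (C := fun _ => D → Z) (wellFounded_lt (α := W)) fun i c d =>
    match s d with
    | .inr b => ((equivShrink _).symm b).1
    | .inl q => if h : q.1 < i then op q.2.1 (fun a => c q.1 h (q.2.2 a)) else b0
  have hc : ∀ i d, c i d = match s d with
    | .inr b => ((equivShrink _).symm b).1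
    | .inl q => if q.1 < i then op q.2.1 (fun a => c q.1 (q.2.2 a)) else b0 := by
    intro i d
    simp only [c]
    rw [WellFounded.fix_eq]
    split
    · rfl
    · split <;> rfl
  have hbase : ∀ x ∈ base, ∀ i, ∃ d, c i d = x := by
    intro x hx i
    obtain ⟨d, hd⟩ := hs (.inr (equivShrink _ ⟨x, hx⟩))
    exact ⟨d, by rw [hc, hd]; simp⟩
  have hmono : ∀ i j, i ≤ j → ∀ d, ∃ d', c j d' = c i d := by
    intro i j hij d
    rw [hc]
    rcases h : s d with q | b
    · by_cases h1 : q.1 < i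
      · exact ⟨d, by rw [hc, h]; simp [h1, h1.trans_le hij]⟩
      · simp only [h1, if_false]; exact hbase _ hb0 j
    · exact ⟨d, by rw [hc, h]⟩
  have hnW : Nonempty W := by
    rw [nonempty_toType_iff]; intro h; simp at h; exact absurd (h ▸ hκ.aleph0_le) (not_le.2 Cardinal.aleph0_pos)
  obtain ⟨w0⟩ := hnW
  have hlim : ∀ w : W, ∃ w', w < w' := by
    intro w
    have : Order.succ w.toOrd.1 < κ.ord := (Cardinal.isSuccLimit_ord hκ.aleph0_le).succ_lt (Set.mem_Iio.1 w.toOrd.2)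
    refine ⟨ToType.mk ⟨Order.succ w.toOrd.1, this⟩, ?_⟩
    rw [← ToType.mk.symm.lt_iff_lt, OrderIso.symm_apply_apply]
    exact Order.lt_succ w.toOrd.1
  have hbdd : ∀ (A : Type), #A < κ → ∀ f : A → W, ∃ w, ∀ a, f a ≤ w := by
    intro A hA f
    have := iSup_lt_of_lt_cof (a := κ.ord) (by rwa [hκ.cof_ord]) (f := fun a => (f a).toOrd.1) (fun a => (f a).toOrd.2)
    refine ⟨ToType.mk ⟨_, this⟩, fun a => ?_⟩
    rw [← ToType.mk.symm.le_iff_le, OrderIso.symm_apply_apply]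
    exact le_ciSup (f := fun a => (f a).toOrd.1) bddAbove_of_small a
  refine ⟨ZFSet.range (fun q : W × D => c q.1 q.2), fun x hx => ?_, fun p v hv => ?_, ?_, fun T h1 h2 x hx => ?_⟩
  · obtain ⟨d, hd⟩ := hbase x hx w0
    exact ZFSet.mem_range.2 ⟨(w0, d), hd⟩
  · simp only [ZFSet.mem_range, Prod.exists] at hv ⊢
    choose i d hid using hv
    obtain ⟨w, hw⟩ := hbdd _ (har p) i
    have : ∀ a, ∃ d', c w d' = v a := fun a => by rw [← hid]; exact hmono _ _ (hw a) _
    choose u hu using this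
    obtain ⟨w', hw'⟩ := hlim w
    obtain ⟨e, he⟩ := hs (.inl (w, ⟨p, u⟩))
    exact ⟨w', e, by rw [hc, he]; simp [hw', hu]⟩
  · have := lift_card_range_le (f := fun q : W × D => c q.1 q.2)
    simp only [Cardinal.lift_id, Cardinal.mk_prod, hW, hD] at this
    exact this.trans (Cardinal.mul_le_of_le hμ hκμ le_rfl)
  · obtain ⟨⟨i, d⟩, rfl⟩ := ZFSet.mem_range.1 hx
    show T (c i d)
    clear hx
    induction i using WellFoundedLT.induction generalizing d with
    | ind i ih =>
      rw [hc]
      rcases h : s d with q | b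
      · by_cases h3 : q.1 < i
        · simp only [h3, if_true]; exact h2 _ _ fun a => ih _ h3 _
        · simp only [h3, if_false]; exact h1 _ hb0
      · exact h1 _ ((equivShrink _).symm b).2

/-- formulas are countable -/
def encF : ∀ {k : ℕ}, SetFormula k → ℕ
  | _, .mem i j => Nat.pair 0 (Nat.pair i j)
  | _, .eq i j => Nat.pair 1 (Nat.pair i j)
  | _, .fal => Nat.pair 2 0
  | _, .imp φ ψ => Nat.pair 3 (Nat.pair (encF φ) (encF ψ))
  | _, .all φ => Nat.pair 4 (encF φ)

theorem encF_inj {k : ℕ} (φ ψ : SetFormula k) (h : encF φ = encF ψ) : φ = ψ := by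
  induction φ with
  | mem i j => cases ψ <;> simp [encF, Fin.val_inj] at h ⊢; exact h
  | eq i j => cases ψ <;> simp [encF, Fin.val_inj] at h ⊢; exact h
  | fal => cases ψ <;> simp [encF] at h ⊢
  | imp φ ψ h1 h2 => cases ψ <;> simp [encF] at h ⊢; exact ⟨h1 _ h.1, h2 _ h.2⟩
  | all φ ih => cases ψ <;> simp [encF] at h ⊢; exact ih _ h

instance {k : ℕ} : Countable (SetFormula k) :=
  Function.Injective.countable (f := encF) fun φ ψ h => encF_inj φ ψ h

theorem mk_Fm : #Fm ≤ ℵ₀ := Cardinal.mk_le_aleph0_iff.2 inferInstance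

/-- Löwenheim–Skolem -/
theorem exists_hull (T : Z → Prop) (hT0 : T ∅) (base : Z) (hb : ∀ x ∈ base, T x) (b0 : Z) (hb0 : b0 ∈ base) :
    ∃ X : Z, base ⊆ X ∧ El (fun x => x ∈ X) T ∧ X.card ≤ max base.card ℵ₀ := by
  obtain ⟨X, h1, h2, h3, h4⟩ := exists_closure (P := Fm) (fun p => Fin p.1) (fun p v => sk T p.2 v) ℵ₀ (max base.card ℵ₀)
    Cardinal.isRegular_aleph0 (le_max_right _ _) (mk_Fm.trans (le_max_right _ _)) (fun p => by simp)
    (fun p => by simpa using Cardinal.power_nat_le (le_max_right _ _)) base (le_max_left _ _) b0 hb0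
  refine ⟨X, h1, El.of_sk ?_ fun k φ v hv _ => h2 ⟨k, φ⟩ v hv, h3⟩
  refine h4 T hb fun p v _ => ?_
  by_cases h : ∃ x, T x ∧ RIn T p.2 (Fin.snoc v x)
  · exact (sk_spec h).1
  · simp only [sk, dif_neg h]; exact hT0

theorem SgE.up {k : ℕ} {T U : Z → Prop} (h : SgE k T U) {l : ℕ} {φ : SetFormula l} (hφ : IsSigma (k+1) φ)
    (v : Fin l → Z) (hv : ∀ i, T (v i)) (hT : RIn T φ v) : RIn U φ v := by
  refine IsSigma.rec (motive_1 := fun m l φ _ => m ≤ k+1 → ∀ v : Fin l → Z, (∀ i, T (v i)) →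
    RIn T φ v → RIn U φ v) (motive_2 := fun m l φ _ => True) ?_ ?_ ?_ ?_ ?_ ?_ hφ le_rfl v hv hT
  · intro m l φ hφ _ v hv
    exact (h.2 φ (.ofDelta0 hφ) v hv).1
  · intro m l φ hφ _ hm v hv
    obtain ⟨ψ, h1, h2⟩ := hφ.dual
    have := h.2 ψ (h1.mono (by omega)) v hv
    rw [h2, h2] at this
    exact (not_iff_not.1 this).1
  · intro m l φ hφ ih hm v hv
    rw [RIn_ex, RIn_ex]
    rintro ⟨a, ha, h2⟩
    exact ⟨a, h.1 a ha, ih hm _ (snoc_sub v hv a ha) h2⟩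
  all_goals intros; trivial

theorem sgE_zero {S T : Z → Prop} (hS : TrC S) (hT : TrC T) (hST : ∀ x, S x → T x) : SgE 0 S T := by
  refine ⟨hST, fun k φ hφ v hv => ?_⟩
  cases hφ with
  | ofDelta0 h => rw [delta0_abs hS h v hv, delta0_abs hT h v fun i => hST _ (hv i)]

theorem comp_snoc {k : ℕ} (F : Z → Z) (v : Fin k → Z) (a : Z) :
    (fun i => F ((Fin.snoc v a : Fin (k+1) → Z) i)) = Fin.snoc (fun i => F (v i)) (F a) := by
  funext i
  refine Fin.lastCases ?_ (fun i => ?_) i <;> simp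

theorem RIn_iso {S T : Z → Prop} (F : Z → Z) (h1 : ∀ x, S x → T (F x)) (h2 : ∀ y, T y → ∃ x, S x ∧ F x = y)
    (h3 : ∀ x y, S x → S y → (F x ∈ F y ↔ x ∈ y)) (h4 : ∀ x y, S x → S y → F x = F y → x = y)
    {k : ℕ} (φ : SetFormula k) (v : Fin k → Z) (hv : ∀ i, S (v i)) :
    RIn S φ v ↔ RIn T φ (fun i => F (v i)) := by
  induction φ with
  | mem i j => exact (h3 _ _ (hv i) (hv j)).symm
  | eq i j => exact ⟨fun h => congrArg F h, h4 _ _ (hv i) (hv j)⟩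
  | fal => rfl
  | imp φ ψ ih1 ih2 => simp [ih1 v hv, ih2 v hv]
  | all φ ih =>
    rw [RIn_all, RIn_all]
    constructor
    · intro h y hy
      obtain ⟨x, hx, rfl⟩ := h2 y hy
      rw [← comp_snoc]
      exact (ih _ (snoc_sub v hv x hx)).1 (h x hx)
    · intro h x hx
      have := h _ (h1 x hx)
      rw [← comp_snoc] at this
      exact (ih _ (snoc_sub v hv x hx)).2 this

/-- Mostowski collapse -/
noncomputable def mos (X : Z) : Z → Z :=
  WellFounded.fix (C := fun _ => Z) ZFSet.mem_wf fun x c =>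
    ZFSet.range (fun y : {y : Shrink.{0} x // ((equivShrink _).symm y).1 ∈ X} => c _ ((equivShrink _).symm y.1).2)

theorem mem_mos {X x z : Z} : z ∈ mos X x ↔ ∃ y ∈ x, y ∈ X ∧ mos X y = z := by
  unfold mos
  rw [WellFounded.fix_eq, ZFSet.mem_range]
  constructor
  · rintro ⟨⟨y, hy⟩, h⟩
    exact ⟨_, ((equivShrink _).symm y).2, hy, h⟩
  · rintro ⟨y, h1, h2, h3⟩
    refine ⟨⟨equivShrink _ ⟨y, h1⟩, by simpa using h2⟩, ?_⟩
    have e : ((equivShrink x).symm (equivShrink x ⟨y, h1⟩)).1 = y := by simp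
    dsimp only
    rw [e]; exact h3

theorem mos_inj {X : Z} (hX : ∀ x ∈ X, ∀ y ∈ X, (∀ z ∈ X, z ∈ x ↔ z ∈ y) → x = y) :
    ∀ x ∈ X, ∀ y ∈ X, mos X x = mos X y → x = y := by
  intro x
  induction x using ZFSet.inductionOn with
  | _ x ih =>
    intro hx y hy e
    refine hX x hx y hy fun z hz => ?_
    constructor
    · intro h
      have : mos X z ∈ mos X y := by rw [← e]; exact mem_mos.2 ⟨z, h, hz, rfl⟩
      obtain ⟨z', h1, h2, h3⟩ := mem_mos.1 this
      rw [ih z h hz z' h2 h3.symm]; exact h1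
    · intro h
      have : mos X z ∈ mos X x := by rw [e]; exact mem_mos.2 ⟨z, h, hz, rfl⟩
      obtain ⟨z', h1, h2, h3⟩ := mem_mos.1 this
      rw [← ih z' h1 h2 z hz h3]; exact h1

theorem mos_mem {X : Z} (hX : ∀ x ∈ X, ∀ y ∈ X, (∀ z ∈ X, z ∈ x ↔ z ∈ y) → x = y) {x y : Z} (hx : x ∈ X)
    (hy : y ∈ X) : mos X x ∈ mos X y ↔ x ∈ y := by
  rw [mem_mos]
  constructor
  · rintro ⟨z, h1, h2, h3⟩
    rw [← mos_inj hX z h2 x hx h3]; exact h1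
  · intro h; exact ⟨x, h, hx, rfl⟩

theorem mos_fix {X b : Z} (hb : b.IsTransitive) (hbX : b ⊆ X) : ∀ x ∈ b, mos X x = x := by
  intro x
  induction x using ZFSet.inductionOn with
  | _ x ih =>
    intro hx
    ext z
    rw [mem_mos]
    constructor
    · rintro ⟨y, h1, h2, h3⟩
      rw [← h3, ih y h1 (hb x hx h1)]; exact h1
    · intro h; exact ⟨z, h, hbX (hb x hx h), ih z h (hb x hx h)⟩

theorem El.ext {X : Z} {T : Z → Prop} (hT : TrC T) (h : El (fun x => x ∈ X) T) :
    ∀ x ∈ X, ∀ y ∈ X, (∀ z ∈ X, z ∈ x ↔ z ∈ y) → x = y := by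
  intro x hx y hy hz
  have h1 := h.2 (k := 2) (.all (((SetFormula.mem 2 0).imp (.mem 2 1)).and ((SetFormula.mem 2 1).imp (.mem 2 0)))) ![x, y]
    (by intro i; fin_cases i <;> simp [hx, hy])
  have e : ∀ a, (Fin.snoc ![x, y] a : Fin 3 → Z) = ![x, y, a] := by
    intro a; funext i; fin_cases i <;> rfl
  simp [RIn, e] at h1
  have h2 := h1.1 fun z hz' => by rw [hz z hz']; simp
  ext z
  exact ⟨fun hzx => (h2 z (hT x (h.1 x hx) z hzx)).1 hzx, fun hzy => (h2 z (hT y (h.1 y hy) z hzy)).2 hzy⟩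

theorem C1.cn {l : Z} (h : C1 l (VV l)) : CnE zmem 1 l := by
  rw [cnE_iff]
  refine ⟨h.1, SgE.of_down (VV_trC l) (fun _ _ _ _ => trivial) (fun _ _ => trivial) fun k φ hφ v hv ht => ?_⟩
  have hl : ω < rank l := by simpa [om] using rank_lt_of_mem h.om_mem
  have hlim : ∀ o < rank l, Order.succ o < rank l := by
    intro o ho
    have h1 : o.toZFSet ∈ l := (mem_ord_iff h.1).2 ⟨isOrdinal_toZFSet _, by simpa using ho⟩
    obtain ⟨β, hβ, h2⟩ := h.2.2.1 _ h1
    have := rank_lt_of_mem h2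
    rw [rank_toZFSet] at this
    exact (Order.succ_le_of_lt this).trans_lt (rank_lt_of_mem hβ)
  obtain ⟨m, hm, hvm⟩ : ∃ m < rank l, ∀ i, rank (v i) ≤ m := by
    refine ⟨Finset.univ.sup fun i => rank (v i), ?_, fun i => Finset.le_sup (f := fun i => rank (v i)) (Finset.mem_univ i)⟩
    rw [Finset.sup_lt_iff (by simpa using omega0_pos.trans hl)]
    intro i _; exact mem_VV.1 (hv i)
  let b := V_ (Order.succ m)
  have hb : b.IsTransitive := isTransitive_vonNeumann _
  have hvb : ∀ i, v i ∈ b := fun i => mem_vonNeumann.2 (Order.lt_succ_of_le (hvm i))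
  have hb0 : ∅ ∈ b := mem_vonNeumann.2 (by simp)
  have hbl : b ∈ VV l := mem_VV.2 (by rw [rank_vonNeumann]; exact hlim _ hm)
  obtain ⟨t, ht1, β, hβ, f, hf, h2, h3, h4, h5⟩ := h.2.2.2 b hbl
  have hbc : card b < card l := ((card_mono h3).trans h5.card_le).trans_lt
    (h.cardE.lt ((mem_ord_iff h.1).2 ⟨h4, mem_VV.1 hβ⟩))
  have hoc : ℵ₀ < card l := by
    have := h.cardE.lt h.om_mem
    simpa [om, card_toZFSet] using this
  obtain ⟨X, hX1, hX2, hX3⟩ := exists_hull (fun _ => True) trivial b (fun _ _ => trivial) ∅ hb0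
  have hXc : card X < card l := hX3.trans_lt (max_lt hbc hoc)
  have hext := hX2.ext (fun _ _ _ _ => trivial)
  let t' := im X (mos X)
  have ht' : t'.IsTransitive := by
    intro x hx y hy
    obtain ⟨x, hx, rfl⟩ := mem_im.1 hx
    obtain ⟨y, h1, h2, rfl⟩ := mem_mos.1 hy
    exact mem_im.2 ⟨y, h2, rfl⟩
  have htc : card t' < card l := (card_le_of_surj (mos X) fun y hy => mem_im.1 hy).trans_lt hXc
  have htl : t' ∈ VV l := by
    refine hMem_rank h.cardE ((hMemE_iff _ _).2 ⟨t', ht', fun _ h => h, cardOrd t', ?_, ?_⟩)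
    · rw [mem_ord_iff h.1]
      refine ⟨cardOrd_ord _, ?_⟩
      rw [← ((cardE_iff l).1 h.cardE).2]
      simpa [cardOrd] using htc
    · obtain ⟨F, h6, h7, h8⟩ := exists_bj (card_cardOrd t')
      exact ⟨_, gr_sj h6 h8⟩
  have h6 : RIn (fun x => x ∈ X) φ v := (hX2.2 φ v fun i => hX1 (hvb i)).2 ht
  have h7 := (RIn_iso (S := fun x => x ∈ X) (T := fun x => x ∈ t') (mos X) (fun x hx => mem_im.2 ⟨x, hx, rfl⟩)
    (fun y hy => mem_im.1 hy) (fun x y hx hy => mos_mem hext hx hy) (fun x y hx hy => mos_inj hext x hx y hy) φ v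
    fun i => hX1 (hvb i)).1 h6
  have e : (fun i => mos X (v i)) = v := funext fun i => mos_fix hb hX1 _ (hvb i)
  rw [e] at h7
  have h8 : SgE 0 (fun x => x ∈ t') (fun x => x ∈ VV l) := sgE_zero (fun x hx y hy => ht' x hx hy) (VV_trC l)
    fun x hx => VV_trC l _ htl _ hx
  refine h8.up hφ v (fun i => ?_) h7
  rw [← e]
  exact mem_im.2 ⟨v i, hX1 (hvb i), rfl⟩

end Paper

namespace Paper
open ZFSet Ordinal
open scoped Cardinal

/-! ### cylindric families of definable sets -/

open Classical in
/-- value of a function -/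
noncomputable def vl (s i : Z) : Z := if h : ∃ b, pair i b ∈ s then h.choose else ∅

theorem Fn.vl_mem {s w B i : Z} (h : Fn s w B) (hi : i ∈ w) : pair i (vl s i) ∈ s := by
  obtain ⟨b, hb, h1, h2⟩ := h.2 i hi
  have : ∃ b, pair i b ∈ s := ⟨b, h1⟩
  unfold vl; rw [dif_pos this]; exact this.choose_spec

theorem Fn.vl_in {s w B i : Z} (h : Fn s w B) (hi : i ∈ w) : vl s i ∈ B := (h.dom (h.vl_mem hi)).2

theorem Fn.vl_iff {s w B i b : Z} (h : Fn s w B) (hi : i ∈ w) : pair i b ∈ s ↔ vl s i = b :=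
  ⟨fun h1 => h.uniq (h.vl_mem hi) h1, fun e => e ▸ h.vl_mem hi⟩

/-- agreement off `i` -/
def Agr (w B i s s' : Z) : Prop := ∀ j ∈ w, j ≠ i → ∀ b ∈ B, (pair j b ∈ s ↔ pair j b ∈ s')

instance D0.agr {k : ℕ} (w B i s s' : Fin k) : D0 (fun v => Agr (v w) (v B) (v i) (v s) (v s')) := by
  unfold Agr; infer_instance

theorem agr_iff {w B i s s' : Z} (h : Fn s w B) (h' : Fn s' w B) :
    Agr w B i s s' ↔ ∀ j ∈ w, j ≠ i → vl s j = vl s' j := by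
  unfold Agr
  constructor
  · intro h1 j hj hji
    have := (h1 j hj hji _ (h.vl_in hj)).1 (h.vl_mem hj)
    exact ((h'.vl_iff hj).1 this).symm
  · intro h1 j hj hji b _
    rw [h.vl_iff hj, h'.vl_iff hj, h1 j hj hji]

structure Cyl (w S B : Z) : Prop where
  ind : Ind w
  fn : ∀ s ∈ S, Fn s w B
  upd : ∀ s ∈ S, ∀ i ∈ w, ∀ b ∈ B, ∃ s' ∈ S, Agr w B i s s' ∧ pair i b ∈ s'

theorem cyl_iff (w S B : Z) : Cyl w S B ↔ Ind w ∧ (∀ s ∈ S, Fn s w B) ∧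
   ∀ s ∈ S, ∀ i ∈ w, ∀ b ∈ B, ∃ s' ∈ S, Agr w B i s s' ∧ pair i b ∈ s' :=
  ⟨fun h => ⟨h.1, h.2, h.3⟩, fun h => ⟨h.1, h.2.1, h.2.2⟩⟩

instance D0.cyl {k : ℕ} (w S B : Fin k) : D0 (fun v => Cyl (v w) (v S) (v B)) := by
  simp only [cyl_iff]; infer_instance

/-- closure of `G` under the atomic operations and implication -/
def GFa (w S B G : Z) : Prop :=
  (∀ i ∈ w, ∀ j ∈ w, ∃ Q ∈ G, ∀ s ∈ S, s ∈ Q ↔ ∃ b ∈ B, pair i b ∈ s ∧ pair j b ∈ s) ∧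
  (∀ i ∈ w, ∀ j ∈ w, ∃ Q ∈ G, ∀ s ∈ S, s ∈ Q ↔ ∃ b ∈ B, ∃ c ∈ B, pair i b ∈ s ∧ pair j c ∈ s ∧ b ∈ c) ∧
  (∃ Q ∈ G, ∀ s ∈ S, s ∉ Q) ∧
  (∀ Q ∈ G, ∀ R ∈ G, ∃ U ∈ G, ∀ s ∈ S, s ∈ U ↔ (s ∈ Q → s ∈ R))

/-- closure under bounded quantification -/
def GFb (w S B G : Z) : Prop :=
  ∀ Q ∈ G, ∀ i ∈ w, ∀ j ∈ w, i ≠ j → ∃ U ∈ G, ∀ s ∈ S, s ∈ U ↔ ∀ s' ∈ S, Agr w B i s s' →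
      (∃ b ∈ B, ∃ c ∈ B, pair i b ∈ s' ∧ pair j c ∈ s' ∧ b ∈ c) → s' ∈ Q

/-- closure under universal quantification -/
def GFu (w S B G : Z) : Prop :=
  ∀ Q ∈ G, ∀ i ∈ w, ∃ U ∈ G, ∀ s ∈ S, s ∈ U ↔ ∀ s' ∈ S, Agr w B i s s' → s' ∈ Q

/-- closure under existential quantification -/
def GFe (w S B G : Z) : Prop :=
  ∀ Q ∈ G, ∀ i ∈ w, ∃ U ∈ G, ∀ s ∈ S, s ∈ U ↔ ∃ s' ∈ S, Agr w B i s s' ∧ s' ∈ Q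

def GF (w S B : Z) : ℕ → Z → Prop
  | 0, G => GFa w S B G ∧ GFb w S B G
  | n+1, G => ∃ G', GF w S B n G' ∧ (∀ Q ∈ G', Q ∈ G) ∧ (∀ Q ∈ G', ∃ U ∈ G, ∀ s ∈ S, s ∈ U ↔ s ∉ Q) ∧ GFe w S B G

instance D0.gfa {k : ℕ} (w S B G : Fin k) : D0 (fun v => GFa (v w) (v S) (v B) (v G)) := by
  unfold GFa; infer_instance
instance D0.gfb {k : ℕ} (w S B G : Fin k) : D0 (fun v => GFb (v w) (v S) (v B) (v G)) := by
  unfold GFb; infer_instance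
instance D0.gfu {k : ℕ} (w S B G : Fin k) : D0 (fun v => GFu (v w) (v S) (v B) (v G)) := by
  unfold GFu; infer_instance
instance D0.gfe {k : ℕ} (w S B G : Fin k) : D0 (fun v => GFe (v w) (v S) (v B) (v G)) := by
  unfold GFe; infer_instance
instance Sg.gf {k : ℕ} (n : ℕ) (w S B G : Fin k) : Sg 1 (fun v => GF (v w) (v S) (v B) n (v G)) := by
  induction n generalizing k with
  | zero => simp only [GF]; infer_instance
  | succ n ih => simp only [GF]; infer_instance

/-- `Q` represents `φ(f)` -/
def Rp (S B Q : Z) {k : ℕ} (φ : SetFormula k) (f : Fin k → Z) : Prop :=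
  ∀ s ∈ S, s ∈ Q ↔ RIn (fun x => x ∈ B) φ (fun i => vl s (f i))

theorem snoc_fn {k : ℕ} (F : Z → Z) (f : Fin k → Z) (a : Z) :
    (fun i => F ((Fin.snoc f a : Fin (k+1) → Z) i)) = Fin.snoc (fun i => F (f i)) (F a) := comp_snoc F f a

section
variable {w S B G : Z} (hc : Cyl w S B)
include hc

theorem Cyl.nt (n : ℕ) : nt n ∈ w := hc.ind.nt n

theorem Cyl.fresh {k : ℕ} (f : Fin k → Z) : ∃ i ∈ w, ∀ a, f a ≠ i := by
  by_contra h
  push Not at h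
  have : ∀ n : ℕ, ∃ a, f a = Paper.nt n := fun n => h _ (hc.nt n)
  choose g hg using this
  have : Function.Injective g := fun m n e => nt_inj (by rw [← hg, ← hg, e])
  exact not_injective_infinite_finite g this

theorem Cyl.update {s i b : Z} (hs : s ∈ S) (hi : i ∈ w) (hb : b ∈ B) :
    ∃ s' ∈ S, Agr w B i s s' ∧ vl s' i = b := by
  obtain ⟨s', h1, h2, h3⟩ := hc.upd s hs i hi b hb
  exact ⟨s', h1, h2, ((hc.fn _ h1).vl_iff hi).1 h3⟩

theorem Cyl.agr {s s' i : Z} (hs : s ∈ S) (hs' : s' ∈ S) :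
    Agr w B i s s' ↔ ∀ j ∈ w, j ≠ i → vl s j = vl s' j := agr_iff (hc.fn _ hs) (hc.fn _ hs')

theorem Cyl.ev_snoc {s s' i : Z} (hs : s ∈ S) (hs' : s' ∈ S) (ha : Agr w B i s s') {k : ℕ} {f : Fin k → Z}
    (hf : ∀ a, f a ∈ w) (hfi : ∀ a, f a ≠ i) :
    (fun a => vl s' ((Fin.snoc f i : Fin (k+1) → Z) a)) = Fin.snoc (fun a => vl s (f a)) (vl s' i) := by
  rw [snoc_fn (vl s')]
  congr 1
  funext a
  exact ((hc.agr hs hs').1 ha _ (hf a) (hfi a)).symm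

theorem Cyl.neg (hG : GFa w S B G) {k : ℕ} {φ : SetFormula k} {f : Fin k → Z} (h : ∃ Q ∈ G, Rp S B Q φ f) :
    ∃ Q ∈ G, Rp S B Q φ.not f := by
  obtain ⟨Q, hQ, h⟩ := h
  obtain ⟨F, hF, h1⟩ := hG.2.2.1
  obtain ⟨U, hU, h2⟩ := hG.2.2.2 Q hQ F hF
  exact ⟨U, hU, fun s hs => by rw [h2 s hs, RIn_not, ← h s hs]; simp [h1 s hs]⟩

theorem Cyl.atom_mem (hG : GFa w S B G) {k : ℕ} (i j : Fin k) {f : Fin k → Z} (hf : ∀ a, f a ∈ w) :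
    ∃ Q ∈ G, Rp S B Q (.mem i j) f := by
  obtain ⟨Q, hQ, h⟩ := hG.2.1 _ (hf i) _ (hf j)
  refine ⟨Q, hQ, fun s hs => ?_⟩
  have hs' := hc.fn s hs
  rw [h s hs, RIn_mem]
  simp only [hs'.vl_iff (hf i), hs'.vl_iff (hf j)]
  constructor
  · rintro ⟨b, _, c, _, rfl, rfl, h⟩; exact h
  · intro h; exact ⟨_, hs'.vl_in (hf i), _, hs'.vl_in (hf j), rfl, rfl, h⟩

theorem Cyl.atom_eq (hG : GFa w S B G) {k : ℕ} (i j : Fin k) {f : Fin k → Z} (hf : ∀ a, f a ∈ w) :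
    ∃ Q ∈ G, Rp S B Q (.eq i j) f := by
  obtain ⟨Q, hQ, h⟩ := hG.1 _ (hf i) _ (hf j)
  refine ⟨Q, hQ, fun s hs => ?_⟩
  have hs' := hc.fn s hs
  rw [h s hs, RIn_eq]
  simp only [hs'.vl_iff (hf i), hs'.vl_iff (hf j)]
  constructor
  · rintro ⟨b, _, rfl, h⟩; exact h.symm
  · intro h; exact ⟨_, hs'.vl_in (hf i), rfl, h.symm⟩

theorem Cyl.bot (hG : GFa w S B G) {k : ℕ} {f : Fin k → Z} : ∃ Q ∈ G, Rp S B Q .fal f := by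
  obtain ⟨Q, hQ, h⟩ := hG.2.2.1
  exact ⟨Q, hQ, fun s hs => by simp [h s hs]⟩

theorem Cyl.imp (hG : GFa w S B G) {k : ℕ} {φ ψ : SetFormula k} {f : Fin k → Z} (h : ∃ Q ∈ G, Rp S B Q φ f)
    (h' : ∃ Q ∈ G, Rp S B Q ψ f) : ∃ Q ∈ G, Rp S B Q (φ.imp ψ) f := by
  obtain ⟨Q, hQ, h⟩ := h
  obtain ⟨R, hR, h'⟩ := h'
  obtain ⟨U, hU, h2⟩ := hG.2.2.2 Q hQ R hR
  exact ⟨U, hU, fun s hs => by rw [h2 s hs, RIn_imp, ← h s hs, ← h' s hs]⟩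

theorem Cyl.all (hG : GFu w S B G) {k : ℕ} {φ : SetFormula (k+1)} {f : Fin k → Z} (hf : ∀ a, f a ∈ w) {i : Z}
    (hi : i ∈ w) (hfi : ∀ a, f a ≠ i)
    (h : ∃ Q ∈ G, Rp S B Q φ (Fin.snoc f i)) : ∃ Q ∈ G, Rp S B Q φ.all f := by
  obtain ⟨Q, hQ, h⟩ := h
  obtain ⟨U, hU, h2⟩ := hG Q hQ i hi
  refine ⟨U, hU, fun s hs => ?_⟩
  rw [h2 s hs, RIn_all]
  constructor
  · intro h3 b hb
    obtain ⟨s', h4, h5, rfl⟩ := hc.update hs hi hb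
    have := (h s' h4).1 (h3 s' h4 h5)
    rwa [hc.ev_snoc hs h4 h5 hf hfi] at this
  · intro h3 s' hs' ha
    rw [h s' hs', hc.ev_snoc hs hs' ha hf hfi]
    exact h3 _ ((hc.fn _ hs').vl_in hi)

theorem Cyl.ex (hG : GFe w S B G) {k : ℕ} {φ : SetFormula (k+1)} {f : Fin k → Z} (hf : ∀ a, f a ∈ w) {i : Z}
    (hi : i ∈ w) (hfi : ∀ a, f a ≠ i)
    (h : ∃ Q ∈ G, Rp S B Q φ (Fin.snoc f i)) : ∃ Q ∈ G, Rp S B Q φ.ex f := by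
  obtain ⟨Q, hQ, h⟩ := h
  obtain ⟨U, hU, h2⟩ := hG Q hQ i hi
  refine ⟨U, hU, fun s hs => ?_⟩
  rw [h2 s hs, RIn_ex]
  constructor
  · rintro ⟨s', hs', ha, h3⟩
    rw [h s' hs', hc.ev_snoc hs hs' ha hf hfi] at h3
    exact ⟨_, ((hc.fn _ hs').vl_in hi), h3⟩
  · rintro ⟨b, hb, h3⟩
    obtain ⟨s', h4, h5, rfl⟩ := hc.update hs hi hb
    refine ⟨s', h4, h5, ?_⟩
    rw [h s' h4, hc.ev_snoc hs h4 h5 hf hfi]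
    exact h3

theorem Cyl.ball (hG : GFb w S B G) {k : ℕ} (j : Fin k) {φ : SetFormula (k+1)} {f : Fin k → Z} (hf : ∀ a, f a ∈ w)
    {i : Z} (hi : i ∈ w) (hfi : ∀ a, f a ≠ i)
    (h : ∃ Q ∈ G, Rp S B Q φ (Fin.snoc f i)) :
    ∃ Q ∈ G, Rp S B Q (.all ((SetFormula.mem (Fin.last k) j.castSucc).imp φ)) f := by
  obtain ⟨Q, hQ, h⟩ := h
  obtain ⟨U, hU, h2⟩ := hG Q hQ i hi _ (hf j) (hfi j).symm
  refine ⟨U, hU, fun s hs => ?_⟩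
  have key : ∀ s' ∈ S, Agr w B i s s' → ((∃ b ∈ B, ∃ c ∈ B, pair i b ∈ s' ∧ pair (f j) c ∈ s' ∧ b ∈ c) ↔
      vl s' i ∈ vl s (f j)) := by
    intro s' hs' ha
    have h3 := hc.fn s' hs'
    rw [(hc.agr hs hs').1 ha _ (hf j) (hfi j)]
    simp only [h3.vl_iff hi, h3.vl_iff (hf j)]
    constructor
    · rintro ⟨b, _, c, _, rfl, rfl, h⟩; exact h
    · intro h; exact ⟨_, h3.vl_in hi, _, h3.vl_in (hf j), rfl, rfl, h⟩
  rw [h2 s hs, RIn_all]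
  simp only [RIn_imp, RIn_mem, Fin.snoc_last, Fin.snoc_castSucc]
  constructor
  · intro h3 b hb hbj
    obtain ⟨s', h4, h5, rfl⟩ := hc.update hs hi hb
    have := (h s' h4).1 (h3 s' h4 h5 ((key s' h4 h5).2 hbj))
    rwa [hc.ev_snoc hs h4 h5 hf hfi] at this
  · intro h3 s' hs' ha hbj
    rw [h s' hs', hc.ev_snoc hs hs' ha hf hfi]
    exact h3 _ ((hc.fn _ hs').vl_in hi) ((key s' hs' ha).1 hbj)

omit hc in
theorem snoc_inj {k : ℕ} {f : Fin k → Z} (hf : Function.Injective f) {i : Z} (hfi : ∀ a, f a ≠ i) :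
    Function.Injective (Fin.snoc f i : Fin (k+1) → Z) := by
  intro a b
  refine Fin.lastCases ?_ (fun a => ?_) a <;> refine Fin.lastCases ?_ (fun b => ?_) b <;> simp [hfi, (hfi _).symm, hf.eq_iff]

omit hc in
theorem snoc_mem {k : ℕ} {f : Fin k → Z} (hf : ∀ a, f a ∈ w) {i : Z} (hi : i ∈ w) :
    ∀ a, (Fin.snoc f i : Fin (k+1) → Z) a ∈ w := snoc_sub (S := fun x => x ∈ w) f hf i hi

theorem Rp.congr {Q : Z} {k : ℕ} {φ ψ : SetFormula k} {f : Fin k → Z} (hf : ∀ a, f a ∈ w)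
    (e : ∀ v, (∀ i, v i ∈ B) → (RIn (fun x => x ∈ B) φ v ↔ RIn (fun x => x ∈ B) ψ v)) (h : Rp S B Q φ f) : Rp S B Q ψ f :=
  fun s hs => (h s hs).trans (e _ fun i => (hc.fn s hs).vl_in (hf i))

theorem Cyl.delta0 (hG : GFa w S B G) (hG' : GFb w S B G) {k : ℕ} {φ : SetFormula k} (hφ : IsDelta0 φ) :
    ∀ {f : Fin k → Z}, (∀ a, f a ∈ w) → ∃ Q ∈ G, Rp S B Q φ f := by
  induction hφ with
  | mem i j => exact fun hf => hc.atom_mem hG i j hf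
  | eq i j => exact fun hf => hc.atom_eq hG i j hf
  | fal => exact fun hf => hc.bot hG
  | imp _ _ h1 h2 => exact fun hf => hc.imp hG (h1 hf) (h2 hf)
  | ball j _ ih =>
    intro f hf
    obtain ⟨i, hi, hfi⟩ := hc.fresh f
    exact hc.ball hG' j hf hi hfi (ih (snoc_mem hf hi))
  | bex j _ ih =>
    intro f hf
    obtain ⟨i, hi, hfi⟩ := hc.fresh f
    obtain ⟨Q, hQ, h⟩ := hc.neg hG (hc.ball hG' j hf hi hfi (hc.neg hG (ih (snoc_mem hf hi))))
    refine ⟨Q, hQ, Rp.congr hc hf (fun v hv => ?_) h⟩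
    simp

theorem Cyl.full (hG : GFa w S B G) (hG' : GFu w S B G) {k : ℕ} (φ : SetFormula k) :
    ∀ {f : Fin k → Z}, (∀ a, f a ∈ w) → ∃ Q ∈ G, Rp S B Q φ f := by
  induction φ with
  | mem i j => exact fun hf => hc.atom_mem hG i j hf
  | eq i j => exact fun hf => hc.atom_eq hG i j hf
  | fal => exact fun hf => hc.bot hG
  | imp _ _ h1 h2 => exact fun hf => hc.imp hG (h1 hf) (h2 hf)
  | all _ ih =>
    intro f hf
    obtain ⟨i, hi, hfi⟩ := hc.fresh f
    exact hc.all hG' hf hi hfi (ih (snoc_mem hf hi))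

theorem Cyl.sigma (n : ℕ) : ∀ {G : Z}, GF w S B n G → ∀ {k : ℕ} {φ : SetFormula k}, IsSigma n φ →
    ∀ {f : Fin k → Z}, (∀ a, f a ∈ w) → ∃ Q ∈ G, Rp S B Q φ f := by
  induction n with
  | zero =>
    intro G hG k φ hφ f hf
    cases hφ with
    | ofDelta0 h => exact hc.delta0 hG.1 hG.2 h hf
  | succ n ih =>
    rintro G ⟨G', h1, h2, h3, h4⟩ k φ hφ
    refine IsSigma.rec (motive_1 := fun m k φ _ => m = n + 1 → ∀ {f : Fin k → Z}, (∀ a, f a ∈ w) → ∃ Q ∈ G, Rp S B Q φ f)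
      (motive_2 := fun m k φ _ => True) ?_ ?_ ?_ ?_ ?_ ?_ hφ rfl
    · intro m k φ h _ f hf
      obtain ⟨Q, hQ, h⟩ := ih h1 (.ofDelta0 h) hf
      exact ⟨Q, h2 Q hQ, h⟩
    · intro m k φ h _ hm f hf
      obtain rfl : m = n := by omega
      obtain ⟨ψ, h5, h6⟩ := h.dual
      obtain ⟨Q, hQ, h⟩ := ih h1 h5 hf
      obtain ⟨U, hU, h7⟩ := h3 Q hQ
      exact ⟨U, hU, fun s hs => by rw [h7 s hs, h s hs, h6, not_not]⟩
    · intro m k φ _ ih2 hm f hf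
      obtain ⟨i, hi, hfi⟩ := hc.fresh f
      exact hc.ex h4 hf hi hfi (ih2 hm (snoc_mem hf hi))
    all_goals intros; trivial

end

/-- Tarski–Vaught condition -/
def TVc (w S B G A : Z) : Prop := (∃ s ∈ S, ∀ j ∈ w, ∀ b ∈ B, pair j b ∈ s → b ∈ A) ∧
  ∀ Q ∈ G, ∀ i ∈ w, ∀ s ∈ S, s ∈ Q → (∀ j ∈ w, j ≠ i → ∀ b ∈ B, pair j b ∈ s → b ∈ A) →
    ∃ s' ∈ S, s' ∈ Q ∧ Agr w B i s s' ∧ ∀ b ∈ B, pair i b ∈ s' → b ∈ A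

instance D0.tvc {k : ℕ} (w S B G A : Fin k) : D0 (fun v => TVc (v w) (v S) (v B) (v G) (v A)) := by
  unfold TVc; infer_instance

theorem TVc.tv {w S B G A : Z} (hc : Cyl w S B) (hAB : ∀ x ∈ A, x ∈ B) (h : TVc w S B G A) {k : ℕ}
    {φ : SetFormula (k+1)} (hφ : ∀ {f : Fin (k+1) → Z}, (∀ a, f a ∈ w) → ∃ Q ∈ G, Rp S B Q φ f) (v : Fin k → Z)
    (hv : ∀ i, v i ∈ A) (hx : ∃ x, x ∈ B ∧ RIn (fun x => x ∈ B) φ (Fin.snoc v x)) :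
    ∃ x, x ∈ A ∧ RIn (fun x => x ∈ B) φ (Fin.snoc v x) := by
  have h0 : ∀ m ≤ k, ∃ s ∈ S, (∀ j ∈ w, vl s j ∈ A) ∧ ∀ i : Fin k, i.1 < m → vl s (nt i) = v i := by
    intro m
    induction m with
    | zero =>
      intro _
      obtain ⟨s, hs, h1⟩ := h.1
      exact ⟨s, hs, fun j hj => h1 j hj _ ((hc.fn s hs).vl_in hj) ((hc.fn s hs).vl_mem hj), by simp⟩
    | succ m ih =>
      intro hm
      obtain ⟨s, hs, h1, h2⟩ := ih (by omega)
      obtain ⟨s', hs', h3, h4⟩ := hc.update hs (hc.nt m) (hAB _ (hv ⟨m, by omega⟩))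
      have h5 := (hc.agr hs hs').1 h3
      refine ⟨s', hs', fun j hj => ?_, fun i hi => ?_⟩
      · by_cases e : j = nt m
        · rw [e, h4]; exact hv _
        · rw [← h5 j hj e]; exact h1 j hj
      · by_cases e : i.1 = m
        · subst e; exact h4
        · rw [← h5 _ (hc.nt _) fun h => e (nt_inj h)]; exact h2 i (by omega)
  obtain ⟨s, hs, h1, h2⟩ := h0 k le_rfl
  obtain ⟨x, hx, hφx⟩ := hx
  obtain ⟨s', hs', h3, h4⟩ := hc.update hs (hc.nt k) hx
  have h5 := (hc.agr hs hs').1 h3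
  have hk : ∀ i : Fin k, nt i.1 ≠ nt k := fun i h => by have := nt_inj h; omega
  obtain ⟨Q, hQ, hr⟩ := hφ (f := Fin.snoc (fun i : Fin k => nt i) (nt k)) (snoc_mem (fun i => hc.nt _) (hc.nt _))
  have e : ∀ t ∈ S, Agr w B (nt k) s t → (fun a => vl t ((Fin.snoc (fun i : Fin k => nt i) (nt k) : Fin (k+1) → Z) a))
      = Fin.snoc v (vl t (nt k)) := by
    intro t ht hst
    rw [hc.ev_snoc hs ht hst (fun i => hc.nt _) hk]
    congr 1; funext a; exact h2 a a.2
  have h6 : s' ∈ Q := by rw [hr s' hs', e s' hs' h3, h4]; exact hφx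
  obtain ⟨t, ht, h7, h8, h9⟩ := h.2 Q hQ _ (hc.nt k) s' hs' h6 (fun j hj hji b hb hp => by
    rw [← ((hc.fn s' hs').vl_iff hj).1 hp, ← h5 j hj hji]; exact h1 j hj)
  have h10 : Agr w B (nt k) s t := (hc.agr hs ht).2 fun j hj hji => (h5 j hj hji).trans ((hc.agr hs' ht).1 h8 j hj hji)
  rw [hr t ht, e t ht h10] at h7
  exact ⟨_, h9 _ ((hc.fn t ht).vl_in (hc.nt k)) ((hc.fn t ht).vl_mem (hc.nt k)), h7⟩

end Paper

namespace Paper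
open ZFSet Ordinal
open scoped Cardinal

theorem ren_not {k l : ℕ} (f : Fin k → Fin l) (φ : SetFormula k) : ren f φ.not = (ren f φ).not := rfl
theorem ren_ex {k l : ℕ} (f : Fin k → Fin l) (φ : SetFormula (k+1)) : ren f φ.ex = (ren (liftF f) φ).ex := rfl

theorem isSigma_ren {n k l : ℕ} (f : Fin k → Fin l) {φ : SetFormula k} (h : IsSigma n φ) : IsSigma n (ren f φ) := by
  refine IsSigma.rec (motive_1 := fun n k φ _ => ∀ l (f : Fin k → Fin l), IsSigma n (ren f φ))
    (motive_2 := fun n k φ _ => ∀ l (f : Fin k → Fin l), IsPi n (ren f φ)) ?_ ?_ ?_ ?_ ?_ ?_ h l f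
  · intro n k φ h l f; exact .ofDelta0 (isDelta0_ren f h)
  · intro n k φ _ h l f; exact .ofPi (h l f)
  · intro n k φ _ h l f; rw [ren_ex]; exact .ex (h _ _)
  · intro n k φ h l f; exact .ofDelta0 (isDelta0_ren f h)
  · intro n k φ _ h l f; exact .ofSigma (h l f)
  · intro n k φ _ h l f; exact .all (h _ _)

theorem IsSigma.dual {n k : ℕ} {φ : SetFormula k} (h : IsSigma n φ) :
    ∃ ψ : SetFormula k, IsPi n ψ ∧ ∀ S v, RIn S ψ v ↔ ¬ RIn S φ v := by
  refine IsSigma.rec (motive_1 := fun n k φ _ => ∃ ψ : SetFormula k, IsPi n ψ ∧ ∀ S v, RIn S ψ v ↔ ¬ RIn S φ v)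
    (motive_2 := fun n k φ _ => True) ?_ ?_ ?_ ?_ ?_ ?_ h
  · intro k n φ h; exact ⟨φ.not, .ofDelta0 (.imp h .fal), fun S v => by simp⟩
  · rintro k n φ h _
    obtain ⟨ψ, h, h'⟩ := h.dual
    exact ⟨ψ, .ofSigma h, h'⟩
  · rintro k n φ _ ⟨ψ, h, h'⟩; exact ⟨ψ.all, .all h, fun S v => by simp [h']⟩
  all_goals intros; trivial

/-- all functions from `ω` to `B` -/
noncomputable def S0 (B : Z) : Z := ZFSet.sep (fun s => Fn s om B) (powerset (om.prod B))

theorem mem_S0 {s B : Z} : s ∈ S0 B ↔ Fn s om B := by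
  rw [S0, ZFSet.mem_sep, ZFSet.mem_powerset]
  refine ⟨fun h => h.2, fun h => ⟨fun p hp => ?_, h⟩⟩
  obtain ⟨x, hx, y, hy, rfl⟩ := h.1 p hp
  exact pair_mem_prod.2 ⟨hx, hy⟩

theorem vl_gr {a b i : Z} {F : Z → Z} (h : ∀ x ∈ a, F x ∈ b) (hi : i ∈ a) : vl (gr a F) i = F i :=
  ((gr_fn h).vl_iff hi).1 (pair_mem_gr.2 ⟨hi, rfl⟩)

open Classical in
theorem cyl_S0 (B : Z) : Cyl om (S0 B) B := by
  refine ⟨ind_om, fun s hs => mem_S0.1 hs, fun s hs i hi b hb => ?_⟩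
  have hs' := mem_S0.1 hs
  let F : Z → Z := fun j => if j = i then b else vl s j
  have hF : ∀ x ∈ om, F x ∈ B := by
    intro x hx
    simp only [F]; split
    · exact hb
    · exact hs'.vl_in hx
  refine ⟨gr om F, mem_S0.2 (gr_fn hF), ?_, pair_mem_gr.2 ⟨hi, by simp [F]⟩⟩
  rw [agr_iff hs' (gr_fn hF)]
  intro j hj hji
  rw [vl_gr hF hj]; simp [F, hji]

/-- sets definable by formulas in `Γ` -/
noncomputable def G0 (Γ : ∀ k, SetFormula k → Prop) (B : Z) : Z :=
  ZFSet.sep (fun Q => ∃ k φ, Γ k φ ∧ ∃ f : Fin k → Z, (∀ a, f a ∈ om) ∧ Rp (S0 B) B Q φ f) (powerset (S0 B))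

section
variable {Γ : ∀ k, SetFormula k → Prop} {B : Z}

theorem G0_mk {k : ℕ} {φ : SetFormula k} (h : Γ k φ) {f : Fin k → Z} (hf : ∀ a, f a ∈ om) :
    ∃ Q ∈ G0 Γ B, Rp (S0 B) B Q φ f := by
  have : Rp (S0 B) B (ZFSet.sep (fun s => RIn (fun x => x ∈ B) φ (fun i => vl s (f i))) (S0 B)) φ f :=
    fun s hs => by simp [hs]
  refine ⟨_, ?_, this⟩
  rw [G0, ZFSet.mem_sep, ZFSet.mem_powerset]
  exact ⟨fun s hs => (ZFSet.mem_sep.1 hs).1, k, φ, h, f, hf, this⟩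

theorem G0_out {Q : Z} (h : Q ∈ G0 Γ B) : ∃ k φ, Γ k φ ∧ ∃ f : Fin k → Z, (∀ a, f a ∈ om) ∧ Rp (S0 B) B Q φ f :=
  (ZFSet.mem_sep.1 h).2

theorem G0_gfa (hm : ∀ k (i j : Fin k), Γ k (.mem i j)) (he : ∀ k (i j : Fin k), Γ k (.eq i j)) (hf : Γ 0 .fal)
    (hi : ∀ k φ ψ, Γ k φ → Γ k ψ → Γ k (φ.imp ψ)) (hr : ∀ k l (f : Fin k → Fin l) φ, Γ k φ → Γ l (ren f φ)) :
    GFa om (S0 B) B (G0 Γ B) := by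
  refine ⟨fun i hi j hj => ?_, fun i hi j hj => ?_, ?_, fun Q hQ R hR => ?_⟩
  · obtain ⟨Q, hQ, h⟩ := G0_mk (B := B) (he 2 0 1) (f := ![i, j]) (by intro a; fin_cases a <;> simp [hi, hj])
    refine ⟨Q, hQ, fun s hs => ?_⟩
    have hs' := mem_S0.1 hs
    rw [h s hs, RIn_eq]
    simp only [hs'.vl_iff hi, hs'.vl_iff hj]
    constructor
    · intro h; exact ⟨_, hs'.vl_in hi, rfl, h.symm⟩
    · rintro ⟨b, hb, h1, h2⟩; exact h1.trans h2.symm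
  · obtain ⟨Q, hQ, h⟩ := G0_mk (B := B) (hm 2 0 1) (f := ![i, j]) (by intro a; fin_cases a <;> simp [hi, hj])
    refine ⟨Q, hQ, fun s hs => ?_⟩
    have hs' := mem_S0.1 hs
    rw [h s hs, RIn_mem]
    simp only [hs'.vl_iff hi, hs'.vl_iff hj]
    constructor
    · intro h; exact ⟨_, hs'.vl_in hi, _, hs'.vl_in hj, rfl, rfl, h⟩
    · rintro ⟨b, hb, c, hc, rfl, rfl, h2⟩; exact h2
  · obtain ⟨Q, hQ, h⟩ := G0_mk (B := B) hf (f := ![]) (by simp)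
    exact ⟨Q, hQ, fun s hs => by rw [h s hs]; simp⟩
  · obtain ⟨k, φ, hφ, f, hf, h⟩ := G0_out hQ
    obtain ⟨l, ψ, hψ, g, hg, h'⟩ := G0_out hR
    obtain ⟨U, hU, h2⟩ := G0_mk (B := B) (hi _ _ _ (hr _ _ (Fin.castAdd l) φ hφ) (hr _ _ (Fin.natAdd k) ψ hψ))
      (f := Fin.append f g) (fun a => by refine Fin.addCases (fun a => ?_) (fun a => ?_) a <;> simp [hf, hg])
    refine ⟨U, hU, fun s hs => ?_⟩
    rw [h2 s hs, h s hs, h' s hs, RIn_imp, RIn_ren, RIn_ren]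
    simp

open Classical in
/-- renaming used for quantification over coordinate `i` -/
noncomputable def rg {k l : ℕ} (f : Fin k → Z) (e : Fin k → Fin l) (i : Z) : Fin k → Fin (l+1) :=
  fun a => if f a = i then Fin.last l else (e a).castSucc

theorem rg_ev {s s' i : Z} (hs : s ∈ S0 B) (hs' : s' ∈ S0 B) (ha : Agr om B i s s') {k l : ℕ}
    {f : Fin k → Z} (hf : ∀ a, f a ∈ om) (f' : Fin l → Z) (e : Fin k → Fin l) (he : ∀ a, f' (e a) = f a) :
    (fun a => (Fin.snoc (fun c => vl s (f' c)) (vl s' i) : Fin (l+1) → Z) (rg f e i a)) = fun a => vl s' (f a) := by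
  funext a
  unfold rg
  split
  · rename_i h; simp [h]
  · rename_i h; simp [he, ((cyl_S0 B).agr hs hs').1 ha _ (hf a) h]

theorem G0_gfu (hq : ∀ k φ, Γ (k+1) φ → Γ k φ.all) (hr : ∀ k l (f : Fin k → Fin l) φ, Γ k φ → Γ l (ren f φ)) :
    GFu om (S0 B) B (G0 Γ B) := by
  intro Q hQ i hi
  obtain ⟨k, φ, hφ, f, hf, h⟩ := G0_out hQ
  obtain ⟨U, hU, h2⟩ := G0_mk (B := B) (hq _ _ (hr _ _ (rg f id i) φ hφ)) hf
  refine ⟨U, hU, fun s hs => ?_⟩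
  rw [h2 s hs, RIn_all]
  constructor
  · intro h3 s' hs' ha
    have := h3 _ ((mem_S0.1 hs').vl_in hi)
    rw [RIn_ren, rg_ev hs hs' ha hf f id (fun _ => rfl)] at this
    exact (h s' hs').2 this
  · intro h3 b hb
    obtain ⟨s', hs', ha, rfl⟩ := (cyl_S0 B).update hs hi hb
    rw [RIn_ren, rg_ev hs hs' ha hf f id (fun _ => rfl)]
    exact (h s' hs').1 (h3 s' hs' ha)

theorem G0_gfe (hq : ∀ k φ, Γ (k+1) φ → Γ k φ.ex) (hr : ∀ k l (f : Fin k → Fin l) φ, Γ k φ → Γ l (ren f φ)) :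
    GFe om (S0 B) B (G0 Γ B) := by
  intro Q hQ i hi
  obtain ⟨k, φ, hφ, f, hf, h⟩ := G0_out hQ
  obtain ⟨U, hU, h2⟩ := G0_mk (B := B) (hq _ _ (hr _ _ (rg f id i) φ hφ)) hf
  refine ⟨U, hU, fun s hs => ?_⟩
  rw [h2 s hs, RIn_ex]
  constructor
  · rintro ⟨b, hb, h3⟩
    obtain ⟨s', hs', ha, rfl⟩ := (cyl_S0 B).update hs hi hb
    rw [RIn_ren, rg_ev hs hs' ha hf f id (fun _ => rfl)] at h3
    exact ⟨s', hs', ha, (h s' hs').2 h3⟩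
  · rintro ⟨s', hs', ha, h3⟩
    refine ⟨_, ((mem_S0.1 hs').vl_in hi), ?_⟩
    rw [RIn_ren, rg_ev hs hs' ha hf f id (fun _ => rfl)]
    exact (h s' hs').1 h3

theorem G0_gfb (hq : ∀ k (j : Fin k) φ, Γ (k+1) φ → Γ k (.all ((SetFormula.mem (Fin.last k) j.castSucc).imp φ)))
    (hr : ∀ k l (f : Fin k → Fin l) φ, Γ k φ → Γ l (ren f φ)) :
    GFb om (S0 B) B (G0 Γ B) := by
  intro Q hQ i hi j hj hij
  obtain ⟨k, φ, hφ, f, hf, h⟩ := G0_out hQ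
  let f' : Fin (k+1) → Z := Fin.snoc f j
  obtain ⟨U, hU, h2⟩ := G0_mk (B := B) (f := f') (hq _ (Fin.last k) _ (hr _ _ (rg f Fin.castSucc i) φ hφ)) (snoc_mem hf hj)
  have he : ∀ a, f' (Fin.castSucc a) = f a := by simp [f']
  refine ⟨U, hU, fun s hs => ?_⟩
  have key : ∀ s' ∈ S0 B, Agr om B i s s' → ((∃ b ∈ B, ∃ c ∈ B, pair i b ∈ s' ∧ pair j c ∈ s' ∧ b ∈ c) ↔
      vl s' i ∈ vl s j) := by
    intro s' hs' ha
    have h3 := mem_S0.1 hs'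
    rw [((cyl_S0 B).agr hs hs').1 ha _ hj hij.symm]
    simp only [h3.vl_iff hi, h3.vl_iff hj]
    constructor
    · rintro ⟨b, _, c, _, rfl, rfl, h⟩; exact h
    · intro h; exact ⟨_, h3.vl_in hi, _, h3.vl_in hj, rfl, rfl, h⟩
  rw [h2 s hs, RIn_all]
  simp only [RIn_imp, RIn_mem, Fin.snoc_last, Fin.snoc_castSucc]
  have ej : f' (Fin.last k) = j := by simp [f']
  rw [ej]
  constructor
  · intro h3 s' hs' ha hb
    have := h3 _ ((mem_S0.1 hs').vl_in hi) ((key s' hs' ha).1 hb)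
    rw [RIn_ren, rg_ev hs hs' ha hf f' Fin.castSucc he] at this
    exact (h s' hs').2 this
  · intro h3 b hb hbj
    obtain ⟨s', hs', ha, rfl⟩ := (cyl_S0 B).update hs hi hb
    rw [RIn_ren, rg_ev hs hs' ha hf f' Fin.castSucc he]
    exact (h s' hs').1 (h3 s' hs' ha ((key s' hs' ha).2 hbj))

open Classical in
theorem G0_tv {A : Z} (hAB : ∀ x ∈ A, x ∈ B) (a0 : Z) (ha0 : a0 ∈ A) (hr : ∀ k l (f : Fin k → Fin l) φ, Γ k φ → Γ l (ren f φ))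
    (htv : ∀ k (φ : SetFormula (k+1)), Γ _ φ → ∀ v : Fin k → Z, (∀ i, v i ∈ A) →
      (∃ x, x ∈ B ∧ RIn (fun x => x ∈ B) φ (Fin.snoc v x)) → ∃ x, x ∈ A ∧ RIn (fun x => x ∈ B) φ (Fin.snoc v x)) :
    TVc om (S0 B) B (G0 Γ B) A := by
  refine ⟨⟨gr om (fun _ => a0), mem_S0.2 (gr_fn fun _ _ => hAB _ ha0), fun j _ b _ h => by
    rw [pair_mem_gr] at h; rw [← h.2]; exact ha0⟩, fun Q hQ i hi s hs hsQ hsA => ?_⟩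
  obtain ⟨k, φ, hφ, f, hf, h⟩ := G0_out hQ
  have hs1 := mem_S0.1 hs
  let v : Fin k → Z := fun a => if f a = i then a0 else vl s (f a)
  have hv : ∀ a, v a ∈ A := by
    intro a
    simp only [v]; split
    · exact ha0
    · rename_i h; exact hsA _ (hf a) h _ (hs1.vl_in (hf a)) (hs1.vl_mem (hf a))
  have ev : ∀ s' ∈ S0 B, Agr om B i s s' → (fun a => (Fin.snoc v (vl s' i) : Fin (k+1) → Z) (rg f id i a)) = fun a => vl s' (f a) := by
    intro s' hs' ha
    rw [← rg_ev hs hs' ha hf f id fun _ => rfl]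
    funext a
    unfold rg
    split
    · simp
    · rename_i h; simp [v, h]
  obtain ⟨x, hx, h1⟩ := htv k (ren (rg f id i) φ) (hr _ _ _ _ hφ) v hv ⟨vl s i, hs1.vl_in hi, by
    rw [RIn_ren, ev s hs (by rw [(cyl_S0 B).agr hs hs]; simp)]
    exact (h s hs).1 hsQ⟩
  obtain ⟨s', hs', ha, rfl⟩ := (cyl_S0 B).update hs hi (hAB _ hx)
  rw [RIn_ren, ev s' hs' ha] at h1
  refine ⟨s', hs', (h s' hs').2 h1, ha, fun b _ hb => ?_⟩
  rw [← ((mem_S0.1 hs').vl_iff hi).1 hb]; exact hx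

theorem G0_gf (n : ℕ) : GF om (S0 B) B n (G0 (fun _ φ => IsSigma n φ) B) := by
  induction n with
  | zero =>
    have e : ∀ k (φ : SetFormula k), IsSigma 0 φ → IsDelta0 φ := fun k φ h => by cases h; assumption
    exact ⟨G0_gfa (fun _ _ _ => .ofDelta0 (.mem _ _)) (fun _ _ _ => .ofDelta0 (.eq _ _)) (.ofDelta0 .fal)
      (fun k φ ψ h1 h2 => .ofDelta0 (.imp (e _ _ h1) (e _ _ h2))) (fun _ _ f _ h => isSigma_ren f h),
      G0_gfb (fun k j φ h => .ofDelta0 (.ball j (e _ _ h))) (fun _ _ f _ h => isSigma_ren f h)⟩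
  | succ n ih =>
    refine ⟨_, ih, fun Q hQ => ?_, fun Q hQ => ?_, G0_gfe (fun k φ h => .ex h) (fun _ _ f _ h => isSigma_ren f h)⟩
    · rw [G0, ZFSet.mem_sep] at hQ ⊢
      obtain ⟨h1, k, φ, h2, h3⟩ := hQ
      exact ⟨h1, k, φ, h2.succ, h3⟩
    · obtain ⟨k, φ, hφ, f, hf, h⟩ := G0_out hQ
      obtain ⟨ψ, h1, h2⟩ := hφ.dual
      obtain ⟨U, hU, h3⟩ := G0_mk (Γ := fun _ φ => IsSigma (n+1) φ) (B := B) (φ := ψ) (.ofPi h1) hf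
      exact ⟨U, hU, fun s hs => by rw [h3 s hs, h2, h s hs]⟩
end

/-- `A ≺_{Σₙ} B`, internally -/
def SE (n : ℕ) (A B : Z) : Prop := ∃ w S G, Cyl w S B ∧ GF w S B n G ∧ TVc w S B G A
/-- `A ≺ B`, internally -/
def FE (A B : Z) : Prop := ∃ w S G, Cyl w S B ∧ (GFa w S B G ∧ GFu w S B G) ∧ TVc w S B G A

instance Sg.gf' {k m : ℕ} (n : ℕ) (w S B G : Fin k) : Sg (m+1) (fun v => GF (v w) (v S) (v B) n (v G)) :=
  (Sg.gf n w S B G).mono (by omega)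
instance Sg.se {k m : ℕ} (n : ℕ) (A B : Fin k) : Sg (m+1) (fun v => SE n (v A) (v B)) := by
  unfold SE; infer_instance
instance Sg.fe {k m : ℕ} (A B : Fin k) : Sg (m+1) (fun v => FE (v A) (v B)) := by
  unfold FE; infer_instance

theorem SE.sgE {n : ℕ} {A B : Z} (hA : A.IsTransitive) (hB : B.IsTransitive) (hAB : ∀ x ∈ A, x ∈ B) (h : SE n A B) :
    SgE n (fun x => x ∈ A) (fun x => x ∈ B) := by
  obtain ⟨w, S, G, h1, h2, h3⟩ := h
  exact SgE.of_tv (fun x hx y hy => hA x hx hy) (fun x hx y hy => hB x hx hy) hAB fun k φ hφ v hv hx =>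
    h3.tv h1 hAB (fun hf => h1.sigma n h2 hφ hf) v hv hx

theorem SgE.se {n : ℕ} {A B : Z} (hA0 : ∃ a, a ∈ A)
    (h : SgE (n+1) (fun x => x ∈ A) (fun x => x ∈ B)) : SE (n+1) A B := by
  obtain ⟨a0, ha0⟩ := hA0
  refine ⟨om, S0 B, _, cyl_S0 B, G0_gf (n+1), G0_tv h.1 a0 ha0 (fun _ _ f _ h => isSigma_ren f h) fun k φ hφ v hv hx => ?_⟩
  have := (h.2 φ.ex (.ex hφ) v hv).2 (by simpa using hx)
  obtain ⟨x, hx, h1⟩ := (RIn_ex _ _ _).1 this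
  exact ⟨x, hx, (h.2 φ hφ _ (snoc_sub (S := fun x => x ∈ A) v hv x hx)).1 h1⟩

theorem FE.el {A B : Z} (hAB : ∀ x ∈ A, x ∈ B) (h : FE A B) : El (fun x => x ∈ A) (fun x => x ∈ B) := by
  obtain ⟨w, S, G, h1, h2, h3⟩ := h
  exact El.of_tv hAB fun k φ v hv hx =>
    h3.tv h1 hAB (fun hf => h1.full h2.1 h2.2 φ hf) v hv hx

theorem El.fe {A B : Z} (hA0 : ∃ a, a ∈ A) (h : El (fun x => x ∈ A) (fun x => x ∈ B)) : FE A B := by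
  obtain ⟨a0, ha0⟩ := hA0
  refine ⟨om, S0 B, G0 (fun _ _ => True) B, cyl_S0 B, ⟨G0_gfa (by intros; trivial) (by intros; trivial) trivial (by intros; trivial) (by intros; trivial),
      G0_gfu (by intros; trivial) (by intros; trivial)⟩,
    G0_tv h.1 a0 ha0 (fun _ _ f _ h => trivial) fun k φ hφ v hv hx => ?_⟩
  have := (h.2 φ.ex v hv).2 (by simpa using hx)
  obtain ⟨x, hx, h1⟩ := (RIn_ex _ _ _).1 this
  exact ⟨x, hx, (h.2 φ _ (snoc_sub (S := fun x => x ∈ A) v hv x hx)).1 h1⟩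

/-! ### complexity of `Cⁿ` -/

theorem cnE_zero {l : Z} (h : l.IsOrdinal) : CnE zmem 0 l :=
  (cnE_iff 0 l).2 ⟨h, sgE_zero (VV_trC l) (fun _ _ _ _ => trivial) fun _ _ => trivial⟩

theorem cnE_one_iff (l : Z) : CnE zmem 1 l ↔ ∃ A, IsV A l ∧ C1 l A :=
  ⟨fun h => ⟨VV l, ⟨h.ord, rfl⟩, CnE.c1 h⟩, fun ⟨A, ⟨_, h1⟩, h2⟩ => C1.cn (h1 ▸ h2)⟩

theorem CnE.mono {m n : ℕ} {l : Z} (h : CnE zmem n l) (hmn : m ≤ n) : CnE zmem m l := by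
  rw [cnE_iff] at h ⊢
  exact ⟨h.1, h.2.mono hmn⟩

theorem VV_mono {a b : Z} (hb : b.IsOrdinal) (h : a ∈ b) : ∀ x ∈ VV a, x ∈ VV b :=
  fun _ hx => mem_VV.2 ((mem_VV.1 hx).trans (rank_lt_of_mem h))

theorem cnE_succ_iff (k : ℕ) (l : Z) : CnE zmem (k+2) l ↔ CnE zmem (k+1) l ∧
    ∀ μ A B, l ∈ μ ∧ CnE zmem (k+1) μ ∧ IsV A l ∧ IsV B μ → SE (k+2) A B := by
  constructor
  · refine fun h => ⟨h.mono (by omega), ?_⟩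
    rintro μ A B ⟨h1, h2, ⟨_, rfl⟩, ⟨_, rfl⟩⟩
    have hne : ∃ a, a ∈ VV l := ⟨∅, mem_VV.2 (by
      have := rank_lt_of_mem (CnE.c1 (n := k+1) h).om_mem
      simpa using (zero_le).trans_lt this)⟩
    refine SgE.se hne ?_
    have e1 := ((cnE_iff _ _).1 h).2
    have e2 := ((cnE_iff _ _).1 h2).2
    refine SgE.of_down (VV_trC l) (VV_trC μ) (VV_mono h2.ord h1) fun k φ hφ v hv hx => ?_
    exact (e1.2 φ hφ v hv).2 (e2.up hφ v (fun i => VV_mono h2.ord h1 _ (hv i)) hx)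
  · rintro ⟨h1, h2⟩
    obtain ⟨θ, h3, h4, h5, h6⟩ := exists_cn l
    have hl : l ∈ θ := (mem_ord_iff h3).2 ⟨h1.ord, mem_VV.1 h4⟩
    have := (h2 θ _ _ ⟨hl, h6 _, ⟨h1.ord, rfl⟩, ⟨h3, rfl⟩⟩).sgE (VV_trans _) (VV_trans _) (VV_mono h3 hl)
    rw [cnE_iff]
    exact ⟨h1.ord, this.trans (h5.sgE _)⟩

instance Sg.cn (n : ℕ) {k : ℕ} (a : Fin k) : Sg (n+2) (fun v => CnE zmem (n+1) (v a)) := by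
  induction n generalizing k with
  | zero => simp only [zero_add, cnE_one_iff]; infer_instance
  | succ n ih =>
    simp only [cnE_succ_iff]
    have i1 : ∀ {l} (A B : Fin l), Pn (n+2) (fun v => SE (n+2) (v A) (v B)) := fun A B =>
      (Sg.se (m := n) (n+2) A B).toPn
    have : Pn (n+2) (fun v : Fin k → Z => ∀ μ A B, v a ∈ μ ∧ CnE zmem (n+1) μ ∧ IsV A (v a) ∧ IsV B μ → SE (n+2) A B) := by
      infer_instance
    have i2 := this.toSg
    have i3 := (ih a).succ
    infer_instance

end Paper

namespace Paper
open ZFSet Ordinal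
open scoped Cardinal

theorem reflect0 {m : ℕ} {κ : Z} (hs : CnWeaklyShrewdE zmem (m+1) κ) {P : Z → Z → Prop}
    (hP : ∀ {l : ℕ} (a b : Fin l), Sg (m+2) (fun v => P (v a) (v b))) {z : Z} (hz : z ⊆ κ) (h : P z κ) :
    ∃ κ' ∈ κ, ∃ z', CardE zmem κ' ∧ (∀ x, x ∈ z' ↔ x ∈ z ∧ x ∈ κ') ∧ P z' κ' := by
  obtain ⟨φ, h1, h2⟩ := (hP (l := 2) 0 1).formula.1
  have hκ : κ.IsOrdinal := ((cardE_iff κ).1 hs.1).1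
  obtain ⟨θ, t1, t2, t3, t4⟩ := exists_cn κ
  have hθ := (t4 1).c1
  have hκθ : κ ∈ θ := (mem_ord_iff t1).2 ⟨hκ, mem_VV.1 t2⟩
  have hzθ : z ∈ VV θ := mem_VV.2 ((rank_mono hz).trans_lt (mem_VV.1 t2))
  have hv : ∀ i, (![z, κ] : Fin 2 → Z) i ∈ VV θ := by
    intro i; fin_cases i
    · exact hzθ
    · exact t2
  obtain ⟨κ', θ', z', s1, s2, s3, s4, s5, s6, s7⟩ := hs.2 φ θ z hθ.cardE (t4 _) hκθ hz (by
    simp only [hθ.hmem]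
    rw [realizeIn_iff]
    exact ⟨hv, (t3.2 φ _ hv).2 ((h2 _).2 h)⟩)
  refine ⟨κ', s5, z', s1, s6, ?_⟩
  simp only [(CnE.c1 s3).hmem] at s7
  rw [realizeIn_iff] at s7
  exact (h2 _).1 (((cnE_iff _ _).1 s3).2.up h1 _ s7.1 s7.2)

/-! ### Gödel pairing -/
def GM (a b c d : Z) : Prop := (a ∈ c ∧ b ∈ c) ∨ (a ∈ d ∧ b ∈ d)
def GLt (a b c d : Z) : Prop := GM a b c d ∨ (¬ GM a b c d ∧ ¬ GM c d a b ∧ (a ∈ c ∨ (a = c ∧ b ∈ d)))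

instance D0.gl {k : ℕ} (a b c d : Fin k) : D0 (fun v => GLt (v a) (v b) (v c) (v d)) := by
  unfold GLt GM; infer_instance

theorem ord_mem_rank {a b : Z} (ha : a.IsOrdinal) (hb : b.IsOrdinal) : a ∈ b ↔ rank a < rank b := by
  rw [mem_ord_iff hb]; simp [ha]
theorem ord_eq_rank {a b : Z} (ha : a.IsOrdinal) (hb : b.IsOrdinal) : a = b ↔ rank a = rank b := by
  constructor
  · rintro rfl; rfl
  · intro h
    ext x
    rw [mem_ord_iff ha, mem_ord_iff hb, h]

/-- the key of a pair -/
noncomputable def gk (a b : Z) : Ordinal.{0} ×ₗ (Ordinal.{0} ×ₗ Ordinal.{0}) :=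
  toLex (max (rank a) (rank b), toLex (rank a, rank b))

theorem gm_iff {a b c d : Z} (ha : a.IsOrdinal) (hb : b.IsOrdinal) (hc : c.IsOrdinal) (hd : d.IsOrdinal) :
    GM a b c d ↔ max (rank a) (rank b) < max (rank c) (rank d) := by
  unfold GM
  rw [ord_mem_rank ha hc, ord_mem_rank hb hc, ord_mem_rank ha hd, ord_mem_rank hb hd, ← max_lt_iff, ← max_lt_iff]
  exact lt_max_iff.symm

theorem gl_iff {a b c d : Z} (ha : a.IsOrdinal) (hb : b.IsOrdinal) (hc : c.IsOrdinal) (hd : d.IsOrdinal) :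
    GLt a b c d ↔ gk a b < gk c d := by
  unfold GLt gk
  rw [gm_iff ha hb hc hd, gm_iff hc hd ha hb, Prod.Lex.toLex_lt_toLex, Prod.Lex.toLex_lt_toLex, ord_mem_rank ha hc,
    ord_mem_rank hb hd, ord_eq_rank ha hc]
  simp only
  constructor
  · rintro (h | ⟨h1, h2, h3⟩)
    · exact .inl h
    · exact .inr ⟨le_antisymm (not_lt.1 h2) (not_lt.1 h1), h3⟩
  · rintro (h | ⟨h1, h3⟩)
    · exact .inl h
    · exact .inr ⟨by rw [h1]; exact lt_irrefl _, by rw [h1]; exact lt_irrefl _, h3⟩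

theorem gk_inj {a b c d : Z} (ha : a.IsOrdinal) (hb : b.IsOrdinal) (hc : c.IsOrdinal) (hd : d.IsOrdinal)
    (h : gk a b = gk c d) : a = c ∧ b = d := by
  unfold gk at h
  have h1 := (Prod.mk.inj (toLex_inj.1 h)).2
  have h2 := Prod.mk.inj (toLex_inj.1 h1)
  exact ⟨(ord_eq_rank ha hc).2 h2.1, (ord_eq_rank hb hd).2 h2.2⟩

/-- the rank in the Gödel ordering, by recursion on keys. -/
noncomputable def gg (κ : Z) : Ordinal.{0} ×ₗ (Ordinal.{0} ×ₗ Ordinal.{0}) → Z :=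
  WellFounded.fix (r := (· < ·)) wellFounded_lt fun p G =>
    ZFSet.range (fun q : {q : κ × κ // gk q.1 q.2 < p} => G (gk q.1.1 q.1.2) q.2)

theorem mem_gg {κ x : Z} {p : Ordinal.{0} ×ₗ (Ordinal.{0} ×ₗ Ordinal.{0})} :
    x ∈ gg κ p ↔ ∃ c ∈ κ, ∃ d ∈ κ, gk c d < p ∧ gg κ (gk c d) = x := by
  rw [gg, WellFounded.fix_eq]
  simp only [ZFSet.mem_range, Subtype.exists, Prod.exists]
  constructor
  · rintro ⟨a, ha, b, hb, h1, h2⟩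
    exact ⟨a, ha, b, hb, h1, h2⟩
  · rintro ⟨a, ha, b, hb, h1, h2⟩
    exact ⟨a, ha, b, hb, h1, h2⟩

theorem gg_ord (κ : Z) (p) : (gg κ p).IsOrdinal := by
  induction p using WellFoundedLT.induction with
  | ind p ih =>
    rw [isOrdinal_iff_forall_mem_isOrdinal]
    refine ⟨fun x hx y hy => ?_, fun x hx => ?_⟩
    · rw [mem_gg] at hx
      obtain ⟨c, hc, d, hd, h1, rfl⟩ := hx
      rw [mem_gg] at hy ⊢
      obtain ⟨e, he, f, hf, h2, rfl⟩ := hy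
      exact ⟨e, he, f, hf, h2.trans h1, rfl⟩
    · rw [mem_gg] at hx
      obtain ⟨c, hc, d, hd, h1, rfl⟩ := hx
      exact ih _ h1

theorem gg_inj {κ a b c d : Z} (hκ : κ.IsOrdinal) (ha : a ∈ κ) (hb : b ∈ κ) (hc : c ∈ κ) (hd : d ∈ κ)
    (h : gg κ (gk a b) = gg κ (gk c d)) : a = c ∧ b = d := by
  refine gk_inj (hκ.mem ha) (hκ.mem hb) (hκ.mem hc) (hκ.mem hd) ?_
  rcases lt_trichotomy (gk a b) (gk c d) with h1 | h1 | h1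
  · have : gg κ (gk a b) ∈ gg κ (gk c d) := mem_gg.2 ⟨a, ha, b, hb, h1, rfl⟩
    rw [h] at this
    exact absurd this (ZFSet.mem_irrefl _)
  · exact h1
  · have : gg κ (gk c d) ∈ gg κ (gk a b) := mem_gg.2 ⟨c, hc, d, hd, h1, rfl⟩
    rw [h] at this
    exact absurd this (ZFSet.mem_irrefl _)

theorem card_le_prod {s b : Z} (F : Z → Z → Z) (h : ∀ y ∈ b, ∃ x ∈ s, ∃ x' ∈ s, F x x' = y) :
    card b ≤ card s * card s := by
  have : #b ≤ #s * #s := by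
    choose! G hG G' hG' e using h
    rw [Cardinal.mul_def]
    refine Cardinal.mk_le_of_injective (f := fun y : b => ((⟨G y.1, hG y.1 y.2⟩, ⟨G' y.1, hG' y.1 y.2⟩) : s × s)) ?_
    intro y y' e'
    have e1 : G y.1 = G y'.1 := congrArg (fun p => p.1.1) e'
    have e2 : G' y.1 = G' y'.1 := congrArg (fun p => p.2.1) e'
    apply Subtype.ext
    rw [← e y.1 y.2, ← e y'.1 y'.2, e1, e2]
  rw [cardinalMk_coe_sort, cardinalMk_coe_sort, ← Cardinal.lift_mul, Cardinal.lift_le] at this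
  exact this

theorem ord_mem_of_card {κ x : Z} (hκ : CardE zmem κ) (hx : x.IsOrdinal) (h : card x < card κ) : x ∈ κ := by
  have h1 := (cardE_iff κ).1 hκ
  rw [mem_ord_iff h1.1]
  refine ⟨hx, ?_⟩
  rw [← h1.2, Cardinal.lt_ord, ← ord_card hx]
  exact h

theorem gg_mem {κ a b : Z} (hκ : CardE zmem κ) (hom : om ∈ κ) (ha : a ∈ κ) (hb : b ∈ κ) : gg κ (gk a b) ∈ κ := by
  have hκo := ((cardE_iff κ).1 hκ).1
  refine ord_mem_of_card hκ (gg_ord _ _) ?_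
  set s : Z := (max (rank a) (rank b)).toZFSet ∪ {(max (rank a) (rank b)).toZFSet} ∪ om with hs
  have hinf : ℵ₀ ≤ card s := by
    have : card om ≤ card s := card_mono (by intro x hx; simp [hs, hx])
    simpa [om, card_toZFSet] using this
  have hmu : (max (rank a) (rank b)).toZFSet ∈ κ := by
    rw [mem_ord_iff hκo]
    exact ⟨isOrdinal_toZFSet _, by simp [rank_lt_of_mem ha, rank_lt_of_mem hb]⟩
  have hinf' : ℵ₀ < card κ := by
    have := hκ.lt hom
    simpa [om, card_toZFSet] using this
  have hsk : card s < card κ := by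
    refine (card_union_le).trans_lt (Cardinal.add_lt_of_lt hinf'.le (card_union_le.trans_lt
      (Cardinal.add_lt_of_lt hinf'.le (hκ.lt hmu) ?_)) (hκ.lt hom))
    simpa using Cardinal.one_lt_aleph0.trans hinf'
  refine (card_le_prod (s := s) (fun c d => gg κ (gk c d)) fun y hy => ?_).trans_lt ?_
  · obtain ⟨c, hc, d, hd, h1, h2⟩ := mem_gg.1 hy
    have h3 : max (rank c) (rank d) ≤ max (rank a) (rank b) := by
      unfold gk at h1
      rw [Prod.Lex.toLex_lt_toLex] at h1
      rcases h1 with h1 | h1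
      · exact h1.le
      · exact h1.1.le
    have key : ∀ x ∈ κ, rank x ≤ max (rank a) (rank b) → x ∈ s := by
      intro x hx hr
      rw [hs, mem_union, mem_union, mem_singleton, ord_eq_rank (hκo.mem hx) (isOrdinal_toZFSet _),
        ord_mem_rank (hκo.mem hx) (isOrdinal_toZFSet _)]
      left
      simpa using lt_or_eq_of_le hr
    exact ⟨c, key c hc ((le_max_left _ _).trans h3), d, key d hd ((le_max_right _ _).trans h3), h2⟩
  · rwa [Cardinal.mul_eq_self hinf]

/-- triples -/
def T3 (g a b c : Z) : Prop := ∃ q ∈ g, ∃ s ∈ q, ∃ p ∈ s, q = pair a p ∧ p = pair b c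
theorem t3_iff {g a b c : Z} : T3 g a b c ↔ pair a (pair b c) ∈ g := by
  constructor
  · rintro ⟨q, hq, s, hs, p, hp, rfl, rfl⟩; exact hq
  · intro h
    exact ⟨_, h, {a, pair b c}, by simp [pair], _, by simp, rfl, rfl⟩
instance D0.t3 {k : ℕ} (a b c d : Fin k) : D0 (fun v => T3 (v a) (v b) (v c) (v d)) := by
  unfold T3; infer_instance

/-- `g` is the graph of the Gödel pairing on `κ` -/
def Go (g κ : Z) : Prop := ∀ a ∈ κ, ∀ b ∈ κ, ∃ c ∈ κ, (∀ c' ∈ κ, T3 g a b c' ↔ c' = c) ∧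
  (∀ x ∈ c, ∃ a' ∈ κ, ∃ b' ∈ κ, GLt a' b' a b ∧ T3 g a' b' x) ∧
  ∀ a' ∈ κ, ∀ b' ∈ κ, GLt a' b' a b → ∃ x ∈ c, T3 g a' b' x
instance D0.go {k : ℕ} (a b : Fin k) : D0 (fun v => Go (v a) (v b)) := by
  unfold Go; infer_instance

theorem Go.uniq {g κ κ' : Z} (hκ : κ.IsOrdinal) (hκ' : κ' ∈ κ ∨ κ' = κ) (h : Go g κ') :
    ∀ p, ∀ a ∈ κ', ∀ b ∈ κ', gk a b = p → gg κ p ∈ κ' ∧ ∀ c ∈ κ', (T3 g a b c ↔ c = gg κ p) := by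
  have hκo : κ'.IsOrdinal := by
    rcases hκ' with h | h
    · exact hκ.mem h
    · rwa [h]
  have hsub : ∀ x ∈ κ', x ∈ κ := by
    rcases hκ' with h | h
    · exact fun x hx => hκ.isTransitive _ h hx
    · intro x hx; rwa [← h]
  intro p
  induction p using WellFoundedLT.induction with
  | ind p ih =>
    rintro a ha b hb rfl
    obtain ⟨c, hc, h1, h2, h3⟩ := h a ha b hb
    have e : c = gg κ (gk a b) := by
      ext x
      rw [mem_gg]
      constructor
      · intro hx
        obtain ⟨a', ha', b', hb', h4, h5⟩ := h2 x hx
        rw [gl_iff (hκo.mem ha') (hκo.mem hb') (hκo.mem ha) (hκo.mem hb)] at h4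
        have hxκ := hκo.isTransitive _ hc hx
        exact ⟨a', hsub _ ha', b', hsub _ hb', h4, ((ih _ h4 a' ha' b' hb' rfl).2 x hxκ).1 h5 |>.symm⟩
      · rintro ⟨a', ha', b', hb', h4, rfl⟩
        have h5 : max (rank a') (rank b') ≤ max (rank a) (rank b) := by
          have h1 := h4
          unfold gk at h1
          rw [Prod.Lex.toLex_lt_toLex] at h1
          rcases h1 with h1 | h1
          · exact h1.le
          · exact h1.1.le
        have h6 : max (rank a) (rank b) < rank κ' := max_lt (rank_lt_of_mem ha) (rank_lt_of_mem hb)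
        have ha2 : a' ∈ κ' := (mem_ord_iff hκo).2 ⟨hκ.mem ha', ((le_max_left _ _).trans h5).trans_lt h6⟩
        have hb2 : b' ∈ κ' := (mem_ord_iff hκo).2 ⟨hκ.mem hb', ((le_max_right _ _).trans h5).trans_lt h6⟩
        obtain ⟨x, hx, h7⟩ := h3 a' ha2 b' hb2 ((gl_iff (hκo.mem ha2) (hκo.mem hb2) (hκo.mem ha) (hκo.mem hb)).2 h4)
        have := ((ih _ h4 a' ha2 b' hb2 rfl).2 x (hκo.isTransitive _ hc hx)).1 h7
        rwa [← this]
    rw [← e]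
    exact ⟨hc, h1⟩

/-- the graph of Gödel pairing -/
noncomputable def gG (κ : Z) : Z := ZFSet.range (fun q : κ × κ => pair q.1 (pair q.2 (gg κ (gk q.1 q.2))))

theorem t3_gG {κ a b c : Z} : T3 (gG κ) a b c ↔ a ∈ κ ∧ b ∈ κ ∧ c = gg κ (gk a b) := by
  rw [t3_iff, gG]
  simp only [ZFSet.mem_range, Prod.exists, Subtype.exists, pair_inj]
  constructor
  · rintro ⟨a', ha, b', hb, rfl, rfl, rfl⟩; exact ⟨ha, hb, rfl⟩
  · rintro ⟨ha, hb, rfl⟩; exact ⟨a, ha, b, hb, rfl, rfl, rfl⟩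

theorem go_gG {κ : Z} (hκ : CardE zmem κ) (hom : om ∈ κ) : Go (gG κ) κ := by
  have hκo := ((cardE_iff κ).1 hκ).1
  intro a ha b hb
  refine ⟨_, gg_mem hκ hom ha hb, fun c' _ => ?_, fun x hx => ?_, fun a' ha' b' hb' h => ?_⟩
  · rw [t3_gG]; simp [ha, hb]
  · obtain ⟨c, hc, d, hd, h1, rfl⟩ := mem_gg.1 hx
    exact ⟨c, hc, d, hd, (gl_iff (hκo.mem hc) (hκo.mem hd) (hκo.mem ha) (hκo.mem hb)).2 h1, t3_gG.2 ⟨hc, hd, rfl⟩⟩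
  · exact ⟨_, mem_gg.2 ⟨a', ha', b', hb', (gl_iff (hκo.mem ha') (hκo.mem hb') (hκo.mem ha) (hκo.mem hb)).1 h, rfl⟩,
      t3_gG.2 ⟨ha', hb', rfl⟩⟩

/-- reflection of binary relations -/
theorem reflect {m : ℕ} {κ : Z} (hs : CnWeaklyShrewdE zmem (m+1) κ) (hom : om ∈ κ) {P : Z → Z → Prop}
    (hP : ∀ {l : ℕ} (a b : Fin l), Sg (m+2) (fun v => P (v a) (v b))) (D : Z → Z → Prop)
    (h : ∀ d, (∀ ξ ∈ κ, ∀ η ∈ κ, pair ξ η ∈ d ↔ D ξ η) → P d κ) :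
    ∃ κ' ∈ κ, ∃ d', CardE zmem κ' ∧ (∀ p ∈ d', ∃ ξ ∈ κ', ∃ η ∈ κ', p = pair ξ η) ∧
      (∀ ξ ∈ κ', ∀ η ∈ κ', pair ξ η ∈ d' ↔ D ξ η) ∧ P d' κ' := by
  have hκo := ((cardE_iff κ).1 hs.1).1
  have hP' : ∀ {l : ℕ} (a b : Fin l), Sg (m+2) (fun v => ∃ g d, Go g (v b) ∧ (∀ p ∈ d, ∃ ξ ∈ v b, ∃ η ∈ v b, p = pair ξ η) ∧
      (∀ ξ ∈ v b, ∀ η ∈ v b, pair ξ η ∈ d ↔ ∃ γ ∈ v a, T3 g ξ η γ) ∧ P d (v b)) := fun a b => by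
    infer_instance
  let z : Z := ZFSet.sep (fun γ => ∃ ξ ∈ κ, ∃ η ∈ κ, D ξ η ∧ γ = gg κ (gk ξ η)) κ
  let d : Z := ZFSet.sep (fun p => ∃ ξ ∈ κ, ∃ η ∈ κ, D ξ η ∧ p = pair ξ η) (prod κ κ)
  have hd : ∀ ξ ∈ κ, ∀ η ∈ κ, pair ξ η ∈ d ↔ D ξ η := by
    intro ξ hξ η hη
    simp only [d, ZFSet.mem_sep, pair_mem_prod, pair_inj]
    constructor
    · rintro ⟨_, a, _, b, _, h, rfl, rfl⟩; exact h
    · intro h; exact ⟨⟨hξ, hη⟩, ξ, hξ, η, hη, h, rfl, rfl⟩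
  have hz : ∀ ξ ∈ κ, ∀ η ∈ κ, gg κ (gk ξ η) ∈ z ↔ D ξ η := by
    intro ξ hξ η hη
    simp only [z, ZFSet.mem_sep]
    constructor
    · rintro ⟨_, a, ha, b, hb, h, e⟩
      obtain ⟨rfl, rfl⟩ := gg_inj hκo hξ hη ha hb e
      exact h
    · intro h; exact ⟨gg_mem hs.1 hom hξ hη, ξ, hξ, η, hη, h, rfl⟩
  obtain ⟨κ', hκ', z', h1, h2, g, d', h3, h0, h4, h5⟩ := reflect0 hs (P := fun z κ => ∃ g d, Go g κ ∧ (∀ p ∈ d, ∃ ξ ∈ κ, ∃ η ∈ κ, p = pair ξ η) ∧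
      (∀ ξ ∈ κ, ∀ η ∈ κ, pair ξ η ∈ d ↔ ∃ γ ∈ z, T3 g ξ η γ) ∧ P d κ) hP' (z := z)
    (fun x hx => (ZFSet.mem_sep.1 hx).1) ⟨gG κ, d, go_gG hs.1 hom, fun p hp => by
      obtain ⟨_, a, ha, b, hb, _, e⟩ := ZFSet.mem_sep.1 hp
      exact ⟨a, ha, b, hb, e⟩, fun ξ hξ η hη => by
      rw [hd ξ hξ η hη, ← hz ξ hξ η hη]
      simp only [t3_gG, hξ, hη]
      simp, h d hd⟩
  refine ⟨κ', hκ', d', h1, h0, fun ξ hξ η hη => ?_, h5⟩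
  have hsub : ∀ x ∈ κ', x ∈ κ := fun x hx => hκo.isTransitive _ hκ' hx
  have hu := h3.uniq hκo (.inl hκ') _ ξ hξ η hη rfl
  rw [h4 ξ hξ η hη, ← hz ξ (hsub _ hξ) η (hsub _ hη)]
  constructor
  · rintro ⟨γ, hγ, h6⟩
    rw [h2] at hγ
    rw [← (hu.2 γ hγ.2).1 h6]; exact hγ.1
  · intro h6
    exact ⟨_, (h2 _).2 ⟨h6, hu.1⟩, (hu.2 _ hu.1).2 rfl⟩

end Paper

namespace Paper
open ZFSet Ordinal
open scoped Cardinal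

theorem strongLimit_of_c1 {κ : Z} (h : C1 κ (VV κ)) : StrongLimitE zmem κ := by
  intro α hα p hp
  have hp' : p = powerset α := by
    ext z
    rw [mem_powerset]
    exact hp z
  subst hp'
  obtain ⟨β, hβ, hαβ⟩ := h.2.2.1 α hα
  obtain ⟨t, ht, β, hβ, f, hf, h1, h2, h3, h4⟩ := h.2.2.2 (powerset α) (by
    refine mem_VV.2 (lt_of_le_of_lt ?_ (rank_lt_of_mem hβ))
    rw [rank_powerset]
    exact Order.succ_le_of_lt (rank_lt_of_mem hαβ))
  obtain ⟨F, hF, hF'⟩ := exists_ij ((card_mono h2).trans h4.card_le)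
  exact ⟨β, gr _ F, (mem_ord_iff h.1).2 ⟨h3, mem_VV.1 hβ⟩, (injE_iff _ _ _).2 (gr_ij hF hF')⟩

theorem regular_of {m : ℕ} {κ : Z} (hs : CnWeaklyShrewdE zmem (m+1) κ) (h : C1 κ (VV κ)) : RegularE zmem κ := by
  have hκo := h.1
  refine ⟨(ordE_iff _).2 h.1, fun γ f (hγ : γ ∈ κ) hf => ?_⟩
  rw [isFuncE_iff] at hf
  obtain ⟨F, hF, rfl⟩ := hf.exists_fun
  let s : Z → Z := fun ξ => (max (rank (F ξ)) (rank γ) + 1).toZFSet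
  have hlim : ∀ o < rank κ, o + 1 < rank κ := by
    intro o ho
    obtain ⟨β, hβ, h1⟩ := h.2.2.1 o.toZFSet ((mem_ord_iff hκo).2 ⟨isOrdinal_toZFSet _, by simpa using ho⟩)
    have h2 := rank_lt_of_mem h1
    rw [rank_toZFSet] at h2
    exact (Order.add_one_le_of_lt h2).trans_lt (rank_lt_of_mem hβ)
  have hsκ : ∀ ξ ∈ γ, s ξ ∈ κ := fun ξ hξ => (mem_ord_iff hκo).2 ⟨isOrdinal_toZFSet _, by
    rw [rank_toZFSet]
    exact hlim _ (max_lt (rank_lt_of_mem (hF ξ hξ)) (rank_lt_of_mem hγ))⟩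
  obtain ⟨κ', hκ', d, h1, _, h2, γ', h3, h4, h5⟩ := reflect hs h.om_mem
    (P := fun d κ => ∃ γ ∈ κ, pair γ γ ∈ d ∧ ∀ α ∈ γ, ∃ δ ∈ κ, pair α δ ∈ d) (fun a b => inferInstance)
    (fun ξ η => (ξ = γ ∧ η = γ) ∨ (ξ ∈ γ ∧ η = s ξ)) (by
      intro d hd
      refine ⟨γ, hγ, (hd γ hγ γ hγ).2 (.inl ⟨rfl, rfl⟩), fun α hα => ⟨s α, hsκ α hα,
        (hd α (hκo.isTransitive _ hγ hα) _ (hsκ α hα)).2 (.inr ⟨hα, rfl⟩)⟩⟩)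
  have hκ'o := hκo.mem hκ'
  have e : γ' = γ := by
    rcases (h2 γ' h3 γ' h3).1 h4 with h6 | h6
    · exact h6.1
    · have a1 := rank_lt_of_mem h6.1
      have a2 : rank γ' = max (rank (F γ')) (rank γ) + 1 := by
        conv_lhs => rw [h6.2]
        exact rank_toZFSet _
      rw [a2] at a1
      exact absurd ((le_max_right (rank (F γ')) (rank γ)).trans_lt ((lt_add_one _).trans a1)) (lt_irrefl _)
  subst e
  refine ⟨κ', hκ', fun x y hxy => ?_⟩
  rw [pairMemE_iff, pair_mem_gr] at hxy
  obtain ⟨hx, rfl⟩ := hxy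
  obtain ⟨δ, hδ, h6⟩ := h5 x hx
  rcases (h2 x (hκ'o.isTransitive _ h3 hx) δ hδ).1 h6 with h7 | h7
  · rw [h7.1] at hx; exact absurd hx (ZFSet.mem_irrefl _)
  · have a1 := rank_lt_of_mem hδ
    rw [h7.2, rank_toZFSet] at a1
    exact (mem_ord_iff hκ'o).2 ⟨hκo.mem (hF x hx), (le_max_left _ (rank γ')).trans_lt ((lt_add_one _).trans a1)⟩

theorem inacc_of {m : ℕ} {κ : Z} (hs : CnWeaklyShrewdE zmem (m+1) κ) (h : C1 κ (VV κ)) : InaccE zmem κ :=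
  ⟨hs.1, ⟨om, omegaSpec_om, h.om_mem⟩, regular_of hs h, strongLimit_of_c1 h⟩

theorem VV_sub_m {κ m : Z} (h : C1 κ (VV κ)) (hm : m.IsTransitive) (hz : ZFMinusModelE zmem m) (hκ : κ ∈ m)
    (hc : SmallSeqClosedE zmem m κ) : ∀ x ∈ VV κ, x ∈ m := by
  intro x
  induction x using ZFSet.inductionOn with
  | _ x ih =>
    intro hx
    have hxm : ∀ y ∈ x, y ∈ m := fun y hy => ih y hy (VV_trans κ _ hx hy)
    by_cases hne : ∃ y, y ∈ x
    swap
    · have : x = ∅ := by ext y; simpa using fun hy => hne ⟨y, hy⟩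
      subst this
      have : (∅ : Z) ∈ om := by rw [← nt_zero]; exact ind_om.nt 0
      exact hm _ hκ (h.1.isTransitive _ h.om_mem this)
    obtain ⟨t, ht, β, hβ, f, hf, h1, h2, h3, h4⟩ := h.2.2.2 x hx
    have hβκ : β ∈ κ := (mem_ord_iff h.1).2 ⟨h3, mem_VV.1 hβ⟩
    obtain ⟨F, hF, hF'⟩ := exists_sj ((card_mono h2).trans h4.card_le) hne
    have hfm : gr β F ∈ m := hc β _ hβκ ((isFuncE_iff _ _ _).2 (gr_fn fun y hy => hxm _ (hF y hy)))
    obtain ⟨φ, hφ, hφ'⟩ := (inferInstance : D0 (fun v : Fin 3 → Z => pair (v 0) (v 1) ∈ v 2))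
    have hr : ∀ a b c : {x // zmem x m}, Realize (fun a b : {x // zmem x m} => zmem a.1 b.1) φ
        (Fin.cons a (Fin.cons b (fun _ : Fin 1 => c)) : Fin 3 → _) ↔ pair a.1 b.1 ∈ c.1 := by
      intro a b c
      rw [realize_sub_iff, delta0_abs (S := fun x => zmem x m) (fun x hx y hy => hm _ hx hy) hφ, hφ']
      · rfl
      · exact fun i => Subtype.property _
    obtain ⟨b, hb⟩ := hz.2.2.2.2.2.2 1 φ (fun _ => ⟨gr β F, hfm⟩) ⟨β, hm _ hκ hβκ⟩ (by
      intro x hx y y' h1 h2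
      rw [hr, pair_mem_gr] at h1 h2
      exact Subtype.ext (h1.2.symm.trans h2.2))
    have : b.1 = x := by
      ext y
      constructor
      · intro hy
        obtain ⟨ξ, h5, h6⟩ := (hb ⟨y, hm _ b.2 hy⟩).1 hy
        rw [hr, pair_mem_gr] at h6
        have := hF _ h6.1
        rwa [h6.2] at this
      · intro hy
        obtain ⟨ξ, hξ, rfl⟩ := hF' y hy
        exact (hb ⟨F ξ, hxm _ hy⟩).2 ⟨⟨ξ, hm _ (hm _ hκ hβκ) hξ⟩, hξ, by rw [hr, pair_mem_gr]; exact ⟨hξ, rfl⟩⟩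
    rw [← this]; exact b.2

end Paper

namespace Paper
open ZFSet Ordinal
open scoped Cardinal

def Good (n : ℕ) (κ M A l : Z) : Prop := ∃ N j κ' X C r, N.IsTransitive ∧ A ⊆ N ∧ Fn j M N ∧
  (∀ x ∈ M, ∀ y ∈ M, ∀ x' ∈ N, ∀ y' ∈ N, pair x x' ∈ j → pair y y' ∈ j → (x ∈ y ↔ x' ∈ y') ∧ (x' = y' → x = y)) ∧
  (X ⊆ N ∧ ∀ y ∈ N, y ∈ X ↔ ∃ x ∈ M, pair x y ∈ j) ∧ FE X N ∧ (∀ α ∈ κ, pair α α ∈ j) ∧ pair κ κ' ∈ j ∧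
  l ∈ κ' ∧ κ'.IsOrdinal ∧ C ⊆ N ∧ (∀ x ∈ N, RkB C κ' r x) ∧ SE n A C

instance Sg.good {m k : ℕ} (n : ℕ) (a b c d : Fin k) : Sg (m+1) (fun v => Good n (v a) (v b) (v c) (v d)) := by
  unfold Good; infer_instance

theorem Good.wit {n : ℕ} {κ M l : Z} (hl : l.IsOrdinal) (h : Good n κ M (VV l) l) :
      ∃ N j κ', TransE zmem N ∧ (∀ x, VMemE zmem x l → zmem x N) ∧ IsFuncE zmem j M N ∧
        (∀ ⦃k : ℕ⦄ (φ : SetFormula k) (v w : Fin k → Z), (∀ i, zmem (v i) M) →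
          (∀ i, PairMemE zmem j (v i) (w i)) →
          (RealizeIn zmem (fun x => zmem x M) φ v ↔ RealizeIn zmem (fun x => zmem x N) φ w)) ∧
        (∀ α, zmem α κ → PairMemE zmem j α α) ∧ PairMemE zmem j κ κ' ∧ zmem l κ' ∧
        SigmaElemPairE zmem n (fun x => VMemE zmem x l) fun x => zmem x N ∧ VMemE zmem x κ' := by
  obtain ⟨N, j, κ', X, C, r, h1, h2, h3, h4, ⟨h5, h6⟩, h7, h8, h9, h10, h11, h12, h13, h14⟩ := h
  refine ⟨N, j, κ', fun y hy z hz => h1 y hy hz, fun x hx => h2 ((vmemE_iff _ _).1 hx).2, (isFuncE_iff _ _ _).2 h3,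
    fun k φ v w hv hw => ?_, fun α hα => (pairMemE_iff _ _ _).2 (h8 α hα), (pairMemE_iff _ _ _).2 h9, h10, ?_⟩
  · simp only [pairMemE_iff] at hw
    have hw' : ∀ i, w i ∈ N := fun i => (h3.dom (hw i)).2
    rw [realizeIn_iff, realizeIn_iff]
    simp only [hv, hw', zmem_iff, implies_true, true_and]
    obtain ⟨F, hF, rfl⟩ := h3.exists_fun
    simp only [pair_mem_gr] at hw h4 h6
    have e : w = fun i => F (v i) := funext fun i => (hw i).2.symm
    subst e
    rw [RIn_iso (T := fun x => x ∈ X) F (fun x hx => (h6 _ (hF x hx)).2 ⟨x, hx, hx, rfl⟩) (fun y hy => by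
      obtain ⟨x, hx, _, e⟩ := (h6 y (h5 hy)).1 hy
      exact ⟨x, hx, e⟩) (fun x y hx hy => (h4 x hx y hy _ (hF x hx) _ (hF y hy) ⟨hx, rfl⟩ ⟨hy, rfl⟩).1.symm)
      (fun x y hx hy => (h4 x hx y hy _ (hF x hx) _ (hF y hy) ⟨hx, rfl⟩ ⟨hy, rfl⟩).2) φ v hv]
    exact (h7.el fun x hx => h5 hx).2 φ _ fun i => (h6 _ (hw' i)).2 ⟨v i, hv i, hv i, rfl⟩
  · rw [sgE_iff]
    have hC : ∀ x, x ∈ C ↔ x ∈ N ∧ x ∈ VV κ' := by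
      intro x
      have := fun hx => RkB.spec (U := fun x => x ∈ N) (fun x hx y hy => h1 x hx hy) h11 h13 x hx
      constructor
      · intro hx
        exact ⟨h12 hx, (this (h12 hx)).1 hx⟩
      · rintro ⟨a, b⟩
        exact (this a).2 b
    have := h14.sgE (VV_trans l) (fun x hx y hy => (hC y).2 ⟨h1 x ((hC x).1 hx).1 hy, VV_trans _ _ ((hC x).1 hx).2 hy⟩)
      (fun x hx => (hC x).2 ⟨h2 hx, VV_mono h11 h10 x hx⟩)
    have e1 : (fun x => VMemE zmem x l) = fun x => x ∈ VV l := funext fun x => by simp [vmemE_iff, hl]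
    have e2 : (fun x => zmem x N ∧ VMemE zmem x κ') = fun x => x ∈ C := funext fun x => by
      simp [vmemE_iff, h11, hC, zmem_iff]
    rw [e1, e2]; exact this

/-! ### The club -/

theorem fin_bdd {ξ : Z} (hξ : ξ.IsOrdinal) (hne : ∃ x, x ∈ ξ) (hl : ∀ α ∈ ξ, ∃ β ∈ ξ, α ∈ β) {k : ℕ} (ζ : Fin k → Z)
    (h : ∀ i, ζ i ∈ ξ) : ∃ η ∈ ξ, ∀ i, ζ i ∈ η := by
  induction k with
  | zero => obtain ⟨x, hx⟩ := hne; exact ⟨x, hx, fun i => i.elim0⟩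
  | succ k ih =>
    obtain ⟨η, hη, h1⟩ := ih (fun i => ζ i.succ) fun i => h _
    obtain ⟨β, hβ, h2⟩ := hl _ (h 0)
    have o1 := hξ.mem hη
    have o2 := hξ.mem hβ
    rcases le_total (rank η) (rank β) with h3 | h3
    · refine ⟨β, hβ, fun i => Fin.cases h2 (fun i => ?_) i⟩
      rw [mem_ord_iff o2]
      exact ⟨o1.mem (h1 i), (rank_lt_of_mem (h1 i)).trans_le h3⟩
    · refine ⟨η, hη, fun i => Fin.cases ?_ h1 i⟩
      rw [mem_ord_iff o1]
      exact ⟨o2.mem h2, (rank_lt_of_mem h2).trans_le h3⟩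

theorem elU {ξ m : Z} {B : Z → Z} (hξ : ξ.IsOrdinal) (hne : ∃ x, x ∈ ξ) (hl : ∀ α ∈ ξ, ∃ β ∈ ξ, α ∈ β)
    (h : ∀ η ∈ ξ, ∃ X, im η B ⊆ X ∧ X ⊆ im ξ B ∧ El (fun x => x ∈ X) (fun x => x ∈ m)) :
    El (fun x => x ∈ im ξ B) (fun x => x ∈ m) := by
  refine El.of_tv (fun x hx => ?_) fun k φ v hv hx => ?_
  · obtain ⟨ζ, hζ, rfl⟩ := mem_im.1 hx
    obtain ⟨η, hη, h1⟩ := hl ζ hζ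
    obtain ⟨X, a1, a2, a3⟩ := h η hη
    exact a3.1 _ (a1 (mem_im.2 ⟨ζ, h1, rfl⟩))
  · have := fun i => mem_im.1 (hv i)
    choose ζ hζ hζ' using this
    obtain ⟨η, hη, h1⟩ := fin_bdd hξ hne hl ζ hζ
    obtain ⟨X, a1, a2, a3⟩ := h η hη
    have hvX : ∀ i, v i ∈ X := fun i => a1 (mem_im.2 ⟨ζ i, h1 i, hζ' i⟩)
    obtain ⟨x, hx, h2⟩ := (RIn_ex _ _ _).1 ((a3.2 φ.ex v hvX).2 ((RIn_ex _ _ _).2 hx))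
    exact ⟨x, a2 hx, (a3.2 φ _ (snoc_sub (S := fun x => x ∈ X) v hvX x hx)).1 h2⟩

theorem reg_bdd {κ X : Z} (hr : RegularE zmem κ) (hκ : CardE zmem κ) (hX : card X < card κ) (F : Z → Z)
    (hF : ∀ x ∈ X, F x ∈ κ) : ∃ β ∈ κ, ∀ x ∈ X, F x ∈ β := by
  have hγ : cardOrd X ∈ κ := ord_mem_of_card hκ (cardOrd_ord X) (by rwa [card_cardOrd])
  by_cases hne : ∃ x, x ∈ X
  · obtain ⟨G, hG, hG'⟩ := exists_sj (a := cardOrd X) (b := X) (card_cardOrd X).ge hne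
    obtain ⟨β, hβ, h⟩ := hr.2 _ (gr (cardOrd X) fun ζ => F (G ζ)) hγ
      ((isFuncE_iff _ _ _).2 (gr_fn fun ζ hζ => hF _ (hG ζ hζ)))
    refine ⟨β, hβ, fun x hx => ?_⟩
    obtain ⟨ζ, hζ, rfl⟩ := hG' x hx
    exact h ζ _ ((pairMemE_iff _ _ _).2 (pair_mem_gr.2 ⟨hζ, rfl⟩))
  · exact ⟨_, hγ, fun x hx => absurd ⟨x, hx⟩ hne⟩

def Clb (κ m : Z) (B : Z → Z) (α : Z) : Prop := El (fun x => x ∈ im α B) (fun x => x ∈ m) ∧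
  (∀ x ∈ κ, x ∈ im α B ↔ x ∈ α) ∧ κ ∈ im α B

theorem im_mono {a b : Z} (h : a ⊆ b) (B : Z → Z) : im a B ⊆ im b B := by
  intro x hx
  obtain ⟨y, hy, rfl⟩ := mem_im.1 hx
  exact mem_im.2 ⟨y, h hy, rfl⟩

theorem clb_closed {κ m : Z} {B : Z → Z} {ξ : Z} (hκ : κ.IsOrdinal) (hξ : ξ ∈ κ) (hne : ∃ x, x ∈ ξ)
    (hl : ∀ α ∈ ξ, ∃ β ∈ ξ, α ∈ β ∧ Clb κ m B β) : Clb κ m B ξ := by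
  have hξo := hκ.mem hξ
  have hs : ∀ β ∈ ξ, β ⊆ ξ := fun β hβ x hx => hξo.isTransitive _ hβ hx
  refine ⟨elU hξo hne (fun α hα => ?_) (fun η hη => ?_), fun x hx => ⟨fun h => ?_, fun h => ?_⟩, ?_⟩
  · obtain ⟨β, h1, h2, _⟩ := hl α hα; exact ⟨β, h1, h2⟩
  · obtain ⟨β, h1, h2, h3⟩ := hl η hη
    exact ⟨im β B, im_mono (fun x hx => (hξo.mem h1).isTransitive _ h2 hx) B, im_mono (hs β h1) B, h3.1⟩
  · obtain ⟨ζ, hζ, rfl⟩ := mem_im.1 h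
    obtain ⟨β, h1, h2, h3⟩ := hl ζ hζ
    exact hs β h1 ((h3.2.1 _ hx).1 (mem_im.2 ⟨ζ, h2, rfl⟩))
  · obtain ⟨β, h1, h2, h3⟩ := hl x h
    exact im_mono (hs β h1) B ((h3.2.1 x hx).2 h2)
  · obtain ⟨x, hx⟩ := hne
    obtain ⟨β, h1, h2, h3⟩ := hl x hx
    exact im_mono (hs β h1) B h3.2.2

theorem clb_unbdd {κ m : Z} {B : Z → Z} (hκ : CardE zmem κ) (hr : RegularE zmem κ) (hom : om ∈ κ)
    (hl : ∀ α ∈ κ, ∃ β ∈ κ, α ∈ β) (hm : m.IsTransitive) (hκm : κ ∈ m) (hB : ∀ ξ ∈ κ, B ξ ∈ m)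
    (hB' : ∀ x ∈ m, ∃ ξ ∈ κ, B ξ = x) (α : Z) (hα : α ∈ κ) : ∃ ξ ∈ κ, α ∈ ξ ∧ Clb κ m B ξ := by
  have hκo := ((cardE_iff κ).1 hκ).1
  have hκm' : ∀ x ∈ κ, x ∈ m := fun x hx => hm _ hκm hx
  have hinf' : ℵ₀ < card κ := by
    have := hκ.lt hom
    simpa [om, card_toZFSet] using this
  have hem : (∅ : Z) ∈ m := by
    have : (∅ : Z) ∈ om := by rw [← nt_zero]; exact ind_om.nt 0
    exact hm _ hκm (hκo.isTransitive _ hom this)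
  have step : ∀ α ∈ κ, ∃ β ∈ κ, α ∈ β ∧ ∃ X, im α B ⊆ X ∧ α ⊆ X ∧ κ ∈ X ∧ X ⊆ im β B ∧ (∀ x ∈ X, x ∈ κ → x ∈ β) ∧
      El (fun x => x ∈ X) (fun x => x ∈ m) := by
    intro α hα
    have hακ : α ⊆ κ := fun x hx => hκo.isTransitive _ hα hx
    obtain ⟨X, h1, h2, h3⟩ := exists_hull (fun x => x ∈ m) hem (im α B ∪ α ∪ {κ}) (by
      intro x hx
      rw [mem_union, mem_union, mem_singleton] at hx
      rcases hx with (hx | hx) | rfl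
      · obtain ⟨ζ, hζ, rfl⟩ := mem_im.1 hx; exact hB _ (hακ hζ)
      · exact hκm' _ (hακ hx)
      · exact hκm) κ (by simp)
    have hc : card X < card κ := by
      refine h3.trans_lt (max_lt ?_ hinf')
      refine (card_union_le).trans_lt (Cardinal.add_lt_of_lt hinf'.le (card_union_le.trans_lt
        (Cardinal.add_lt_of_lt hinf'.le ?_ (hκ.lt hα))) ?_)
      · exact (card_le_of_surj B fun y hy => mem_im.1 hy).trans_lt (hκ.lt hα)
      · simpa using Cardinal.one_lt_aleph0.trans hinf'
    choose! I hI hI' using hB'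
    obtain ⟨β1, hβ1, c1⟩ := reg_bdd hr hκ hc I fun x hx => hI x (h2.1 x hx)
    classical
    obtain ⟨β2, hβ2, c2⟩ := reg_bdd hr hκ hc (fun x => if x ∈ κ then x else α) fun x hx => by
      split
      · assumption
      · exact hα
    obtain ⟨η, hη, h4⟩ := fin_bdd hκo ⟨_, hα⟩ hl ![β1, β2, α] (by
      intro i; fin_cases i
      · exact hβ1
      · exact hβ2
      · exact hα)
    have e1 : β1 ∈ η := h4 0
    have e2 : β2 ∈ η := h4 1
    have e3 : α ∈ η := h4 2
    have hηt := (hκo.mem hη).isTransitive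
    refine ⟨η, hη, e3, X, fun x hx => h1 (by simp [hx]), fun x hx => h1 (by simp [hx]), h1 (by simp), fun x hx => ?_,
      fun x hx hxκ => ?_, h2⟩
    · exact mem_im.2 ⟨I x, hηt _ e1 (c1 x hx), hI' x (h2.1 x hx)⟩
    · have := c2 x hx
      rw [if_pos hxκ] at this
      exact hηt _ e2 this
  choose! H hH1 hH2 XX x1 x2 x3 x4 x5 x6 using step
  let s : ℕ → Z := fun i => H^[i] α
  have hs : ∀ i, s i ∈ κ := by
    intro i
    induction i with
    | zero => exact hα
    | succ i ih =>
      change H^[i+1] α ∈ κ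
      rw [Function.iterate_succ_apply']; exact hH1 _ ih
  have hss : ∀ i, s (i+1) = H (s i) := fun i => Function.iterate_succ_apply' H i α
  have hs1 : ∀ i, s i ∈ s (i+1) := fun i => by rw [hss]; exact hH2 _ (hs i)
  let ξ : Z := ⋃₀ (ZFSet.range s)
  have hmem : ∀ x, x ∈ ξ ↔ ∃ i, x ∈ s i := by
    intro x
    simp only [ξ, mem_sUnion, ZFSet.mem_range]
    constructor
    · rintro ⟨_, ⟨i, rfl⟩, h⟩; exact ⟨i, h⟩
    · rintro ⟨i, h⟩; exact ⟨_, ⟨i, rfl⟩, h⟩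
  have hso : ∀ i, (s i).IsOrdinal := fun i => hκo.mem (hs i)
  have hξo : ξ.IsOrdinal := by
    rw [isOrdinal_iff_forall_mem_isOrdinal]
    refine ⟨fun x hx y hy => ?_, fun x hx => ?_⟩
    · obtain ⟨i, hi⟩ := (hmem x).1 hx
      exact (hmem y).2 ⟨i, (hso i).isTransitive _ hi hy⟩
    · obtain ⟨i, hi⟩ := (hmem x).1 hx
      exact (hso i).mem hi
  have hsx : ∀ i, s i ⊆ ξ := fun i x hx => (hmem x).2 ⟨i, hx⟩
  have hξκ : ξ ∈ κ := by
    classical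
    obtain ⟨β, hβ, h⟩ := reg_bdd hr hκ (X := om) (by simpa [om, card_toZFSet] using hinf')
      (fun x => if h : ∃ i : ℕ, x = nt i then s h.choose else α) (by
        intro x hx
        split
        · exact hs _
        · exact hα)
    have h' : ∀ i, s i ∈ β := by
      intro i
      have := h (nt i) (ind_om.nt i)
      have hex : ∃ j : ℕ, nt i = nt j := ⟨i, rfl⟩
      rw [dif_pos hex] at this
      rwa [← nt_inj hex.choose_spec] at this
    rw [mem_ord_iff hκo]
    refine ⟨hξo, lt_of_le_of_lt (rank_mono ?_) (rank_lt_of_mem hβ)⟩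
    intro x hx
    obtain ⟨i, hi⟩ := (hmem x).1 hx
    exact (hκo.mem hβ).isTransitive _ (h' i) hi
  refine ⟨ξ, hξκ, (hmem α).2 ⟨1, hs1 0⟩, elU hξo ⟨α, (hmem α).2 ⟨1, hs1 0⟩⟩ (fun a ha => ?_) (fun η hη => ?_),
    fun x hx => ⟨fun h => ?_, fun h => ?_⟩, ?_⟩
  · obtain ⟨i, hi⟩ := (hmem a).1 ha
    exact ⟨s i, (hmem _).2 ⟨i+1, hs1 i⟩, hi⟩
  · obtain ⟨i, hi⟩ := (hmem η).1 hη
    refine ⟨XX (s i), fun x hx => x1 _ (hs i) (im_mono (fun x hx => (hso i).isTransitive _ hi hx) B hx), fun x hx =>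
      im_mono (hsx (i+1)) B ?_, x6 _ (hs i)⟩
    rw [hss]; exact x4 _ (hs i) hx
  · obtain ⟨ζ, hζ, rfl⟩ := mem_im.1 h
    obtain ⟨i, hi⟩ := (hmem ζ).1 hζ
    refine hsx (i+1) ?_
    rw [hss]
    exact x5 _ (hs i) _ (x1 _ (hs i) (mem_im.2 ⟨ζ, hi, rfl⟩)) hx
  · obtain ⟨i, hi⟩ := (hmem x).1 h
    refine im_mono (hsx (i+1)) B ?_
    rw [hss]
    exact x4 _ (hs i) (x2 _ (hs i) hi)
  · refine im_mono (hsx 1) B ?_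
    rw [hss]
    exact x4 _ (hs 0) (x3 _ (hs 0))

end Paper

namespace Paper
open ZFSet Ordinal
open scoped Cardinal

/-- the reflected statement -/
def PB (m : ℕ) (d κ lam A M b : Z) : Prop := κ ∈ lam ∧ CnE zmem (m+1) lam ∧ IsV A lam ∧ (∃ e ∈ κ, e = e) ∧
  M.IsTransitive ∧ Bj b κ M ∧
  (∀ ξ ∈ κ, ∀ η ∈ κ, ∀ x ∈ M, ∀ y ∈ M, pair ξ x ∈ b → pair η y ∈ b → ξ ≠ η → (pair ξ η ∈ d ↔ x ∈ y)) ∧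
  (∀ α ∈ κ, ∃ ξ ∈ κ, α ∈ ξ ∧ pair ξ ξ ∈ d) ∧ ¬ Good (m+1) κ M A lam

def PA (m : ℕ) (d κ lam : Z) : Prop := ∃ A M b, PB m d κ lam A M b

theorem Sg.pa {m k : ℕ} (a b c : Fin k) : Sg (m+2) (fun v => PA m (v a) (v b) (v c)) := by
  have hG : ∀ {l : ℕ} (a b c d : Fin l), Sg (m+2) (fun v => ¬ Good (m+1) (v a) (v b) (v c) (v d)) := fun a b c d =>
    (Pn.not' (Sg.good (m := m) (m+1) a b c d)).toSg
  unfold PA PB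
  infer_instance

theorem two_one {m : ℕ} {κ : Z} (hs : CnWeaklyShrewdE zmem (m+1) κ) (h2 : CnE zmem (m+2) κ) :
    CnStronglyUnfoldableE zmem (m+1) κ := by
  have h1 : C1 κ (VV κ) := h2.c1
  have hin := inacc_of hs h1
  have hκo := h1.1
  have hlim := h1.2.2.1
  refine ⟨hin, fun lam hlam (hκl : κ ∈ lam) mm hmt hmz hmc (hκm : κ ∈ mm) hmcl => ?_⟩
  have hmt' : mm.IsTransitive := fun y hy z hz => hmt y hy z hz
  apply Good.wit hlam.ord
  by_contra hbad
  obtain ⟨f, hf⟩ := hmc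
  rw [bijE_iff] at hf
  obtain ⟨B, hB, rfl⟩ := hf.1.1.exists_fun
  have hB' : ∀ x ∈ mm, ∃ ξ ∈ κ, B ξ = x := fun x hx => by
    obtain ⟨ξ, hξ, h⟩ := hf.1.2 x hx
    exact ⟨ξ, hξ, (pair_mem_gr.1 h).2⟩
  have hBi : ∀ ξ ∈ κ, ∀ η ∈ κ, B ξ = B η → ξ = η := fun ξ hξ η hη e =>
    hf.2.2 ξ hξ η hη (B ξ) (hB ξ hξ) (pair_mem_gr.2 ⟨hξ, rfl⟩) (pair_mem_gr.2 ⟨hη, e.symm⟩)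
  obtain ⟨κ', hκ', d', hc', hd1, hd2, lam0, hP⟩ := reflect hs h1.om_mem
    (P := fun d κ => ∃ lam, PA m d κ lam)
    (fun {l} a b => by
      have := fun {l : ℕ} (a b c : Fin l) => Sg.pa (m := m) a b c
      infer_instance)
    (fun ξ η => B ξ ∈ B η ∨ (ξ = η ∧ Clb κ mm B ξ)) (fun d hd => by
      refine ⟨lam, VV lam, mm, gr κ B, hκl, hlam, ⟨hlam.ord, rfl⟩, ⟨om, h1.om_mem, rfl⟩, hmt', hf, ?_, ?_, hbad⟩
      · intro ξ hξ η hη x hx y hy hx' hy' hne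
        rw [hd ξ hξ η hη, (pair_mem_gr.1 hx').2, (pair_mem_gr.1 hy').2]
        simp [hne]
      · intro α hα
        obtain ⟨ξ, hξ, h3, h4⟩ := clb_unbdd hin.1 hin.2.2.1 h1.om_mem hlim hmt' hκm hB hB' α hα
        exact ⟨ξ, hξ, h3, (hd ξ hξ ξ hξ).2 (.inr ⟨rfl, h4⟩)⟩)
  have hκ'o := hκo.mem hκ'
  have hd' : d' ∈ VV κ := by
    obtain ⟨β, hβ, hb1⟩ := hlim κ' hκ'
    obtain ⟨γ, hγ, hb2⟩ := hlim β hβ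
    have : d' ⊆ powerset (powerset κ') := by
      intro p hp
      obtain ⟨ξ, hξ, η, hη, rfl⟩ := hd1 p hp
      rw [mem_powerset]
      intro z hz
      rw [mem_powerset]
      simp only [pair, mem_pair] at hz
      intro w hw
      rcases hz with rfl | rfl
      · rw [mem_singleton] at hw; exact hw ▸ hξ
      · rw [mem_pair] at hw
        rcases hw with rfl | rfl <;> assumption
    refine mem_VV.2 ((rank_mono this).trans_lt ?_)
    rw [rank_powerset, rank_powerset]
    refine lt_of_le_of_lt (Order.succ_le_of_lt ?_) (rank_lt_of_mem hγ)
    exact lt_of_le_of_lt (Order.succ_le_of_lt (rank_lt_of_mem hb1)) (rank_lt_of_mem hb2)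
  obtain ⟨lam', hlam'V, A', M', b', q1, q2, ⟨q3, q3'⟩, ⟨e0, he0, _⟩, q5, q6, q7, q8, q9⟩ :=
    cn_reflect h2 (k := 2) (P := fun v x => PA m (v 0) (v 1) x) (Sg.pa (m := m) _ _ _) ![d', κ'] (by
      intro i; fin_cases i
      · exact hd'
      · exact mem_VV_of_mem hκ') ⟨lam0, hP⟩
  simp only [Matrix.cons_val_zero, Matrix.cons_val_one] at q1 q2 q3 q3' he0 q5 q6 q7 q8 q9
  subst q3'
  apply q9
  have hlam' : lam' ∈ κ := (mem_ord_iff hκo).2 ⟨q3, mem_VV.1 hlam'V⟩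
  have hclb : Clb κ mm B κ' := by
    refine clb_closed hκo hκ' ⟨e0, he0⟩ fun α hα => ?_
    obtain ⟨ξ, hξ, h3, h4⟩ := q8 α hα
    refine ⟨ξ, hξ, h3, ?_⟩
    rcases (hd2 ξ hξ ξ hξ).1 h4 with h5 | ⟨_, h5⟩
    · exact absurd h5 (mem_irrefl _)
    · exact h5
  have hκt : ∀ ξ ∈ κ', ξ ∈ κ := fun ξ hξ => hκo.isTransitive _ hκ' hξ
  obtain ⟨G, hG, rfl⟩ := q6.1.1.exists_fun
  have hG' : ∀ x ∈ M', ∃ ξ ∈ κ', G ξ = x := fun x hx => by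
    obtain ⟨ξ, hξ, h⟩ := q6.1.2 x hx
    exact ⟨ξ, hξ, (pair_mem_gr.1 h).2⟩
  have hGi : ∀ ξ ∈ κ', ∀ η ∈ κ', G ξ = G η → ξ = η := fun ξ hξ η hη e =>
    q6.2.2 ξ hξ η hη (G ξ) (hG ξ hξ) (pair_mem_gr.2 ⟨hξ, rfl⟩) (pair_mem_gr.2 ⟨hη, e.symm⟩)
  have hGB : ∀ ξ ∈ κ', ∀ η ∈ κ', (G ξ ∈ G η ↔ B ξ ∈ B η) := by
    intro ξ hξ η hη
    by_cases e : ξ = η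
    · subst e; exact ⟨fun h => absurd h (mem_irrefl _), fun h => absurd h (mem_irrefl _)⟩
    · rw [← q7 ξ hξ η hη _ (hG ξ hξ) _ (hG η hη) (pair_mem_gr.2 ⟨hξ, rfl⟩) (pair_mem_gr.2 ⟨hη, rfl⟩) e, hd2 ξ hξ η hη]
      simp [e]
  choose! idx hidx hidx' using hG'
  let X := im κ' B
  let I : Z → Z := fun x => B (idx x)
  have hIX : ∀ x ∈ M', I x ∈ X := fun x hx => mem_im.2 ⟨_, hidx x hx, rfl⟩
  have hXI : ∀ y ∈ X, ∃ x ∈ M', I x = y := fun y hy => by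
    obtain ⟨ξ, hξ, rfl⟩ := mem_im.1 hy
    refine ⟨G ξ, hG ξ hξ, ?_⟩
    have := hGi _ (hidx _ (hG ξ hξ)) ξ hξ (hidx' _ (hG ξ hξ))
    simp only [I, this]
  have hIm : ∀ x ∈ M', ∀ y ∈ M', (x ∈ y ↔ I x ∈ I y) := fun x hx y hy => by
    rw [← hGB _ (hidx x hx) _ (hidx y hy), hidx' x hx, hidx' y hy]
  have hIi : ∀ x ∈ M', ∀ y ∈ M', I x = I y → x = y := fun x hx y hy e => by
    rw [← hidx' x hx, ← hidx' y hy, hBi _ (hκt _ (hidx x hx)) _ (hκt _ (hidx y hy)) e]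
  have hXm : X ⊆ mm := fun y hy => by
    obtain ⟨ξ, hξ, rfl⟩ := mem_im.1 hy
    exact hB _ (hκt ξ hξ)
  have hImm : ∀ x ∈ M', I x ∈ mm := fun x hx => hXm (hIX x hx)
  have hmos : ∀ x, x ∈ M' → mos X (I x) = x := by
    intro x
    induction x using ZFSet.inductionOn with
    | _ x ih =>
      intro hx
      ext z
      rw [mem_mos]
      constructor
      · rintro ⟨y, hy, hyX, rfl⟩
        obtain ⟨w, hw, rfl⟩ := hXI y hyX
        have hwx := (hIm w hw x hx).2 hy
        rw [ih w hwx hw]; exact hwx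
      · intro hz
        have hzM := q5 _ hx hz
        exact ⟨I z, (hIm z hzM x hx).1 hz, hIX z hzM, ih z hz hzM⟩
  have hκX : κ' ⊆ X := fun α hα => (hclb.2.1 α (hκt α hα)).2 hα
  have hfix := mos_fix hκ'o.isTransitive hκX
  have hfα : ∀ α ∈ κ', α ∈ M' ∧ I α = α := by
    intro α hα
    obtain ⟨x, hx, e⟩ := hXI α (hκX hα)
    have : x = α := by rw [← hmos x hx, e, hfix α hα]
    subst this
    exact ⟨hx, e⟩
  have hfκ : κ' ∈ M' ∧ I κ' = κ := by
    obtain ⟨x, hx, e⟩ := hXI κ hclb.2.2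
    have : x = κ' := by
      rw [← hmos x hx, e]
      ext z
      rw [mem_mos]
      constructor
      · rintro ⟨y, hy, hyX, rfl⟩
        have := (hclb.2.1 y hy).1 hyX
        rwa [hfix y this]
      · intro hz
        exact ⟨z, hκt z hz, hκX hz, hfix z hz⟩
    subst this
    exact ⟨hx, e⟩
  have hVm := VV_sub_m h1 hmt' hmz hκm hmcl
  refine ⟨mm, gr M' I, κ, X, VV κ, rkR (VV κ) κ, hmt', fun x hx => hVm x (VV_mono hκo hlam' x hx), gr_fn hImm,
    ?_, ⟨hXm, ?_⟩, hclb.1.fe ⟨_, hκX he0⟩, ?_, pair_mem_gr.2 hfκ, hlam', hκo, hVm, ?_, ?_⟩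
  · intro x hx y hy x' _ y' _ hx' hy'
    rw [← (pair_mem_gr.1 hx').2, ← (pair_mem_gr.1 hy').2]
    exact ⟨hIm x hx y hy, hIi x hx y hy⟩
  · intro y _
    constructor
    · intro hy
      obtain ⟨x, hx, e⟩ := hXI y hy
      exact ⟨x, hx, pair_mem_gr.2 ⟨hx, e⟩⟩
    · rintro ⟨x, hx, h⟩
      rw [← (pair_mem_gr.1 h).2]; exact hIX x hx
  · intro α hα
    exact pair_mem_gr.2 (hfα α hα)
  · exact RkB.ex (U := fun x => x ∈ mm) (fun x hx y hy => hmt' x hx hy) hκo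
      (fun x => ⟨fun hx => ⟨hVm x hx, hx⟩, fun hx => hx.2⟩) rfl
  · refine SgE.se ⟨κ', mem_VV_of_mem q1⟩ (SgE.of_both ((cnE_iff _ _).1 q2).2 ((cnE_iff _ _).1 (h2.mono (by omega))).2 ?_)
    exact VV_mono hκo hlam'

end Paper

namespace Paper
open ZFSet Ordinal
open scoped Cardinal

theorem InaccE.om_mem {κ : Z} (h : InaccE zmem κ) : om ∈ κ := by
  obtain ⟨w, hw, hwκ⟩ := h.2.1
  have hwo : w.IsOrdinal := (ordE_iff w).1 hw.1.1
  have h1 := omegaSpec_om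
  rcases lt_trichotomy (rank w) (rank om) with h2 | h2 | h2
  · exact absurd hw.1 (h1.2 w ((ord_mem_rank hwo om_ord).2 h2))
  · rw [← (ord_eq_rank hwo om_ord).2 h2]; exact hwκ
  · exact absurd h1.1 (hw.2 om ((ord_mem_rank om_ord hwo).2 h2))

theorem InaccE.inacc {κ : Z} (h : InaccE zmem κ) : (card κ).IsInaccessible := by
  have hκ := h.1
  obtain ⟨hκo, hκr⟩ := (cardE_iff κ).1 h.1
  have hinf : ℵ₀ < card κ := by
    have := hκ.lt h.om_mem
    simpa [om, card_toZFSet] using this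
  refine ⟨hinf, ?_, ?_⟩
  · rw [le_cof_iff_lsub]
    intro ι f hf
    by_contra hlt
    push Not at hlt
    have hX : card (ZFSet.range fun i => (f i).toZFSet) < card κ := by
      have := lift_card_range_le (f := fun i => (f i).toZFSet)
      simp only [Cardinal.lift_id] at this
      exact this.trans_lt hlt
    obtain ⟨β, hβ, hb⟩ := reg_bdd h.2.2.1 hκ hX id (by
      intro x hx
      obtain ⟨i, rfl⟩ := ZFSet.mem_range.1 hx
      rw [mem_ord_iff hκo]
      refine ⟨isOrdinal_toZFSet _, ?_⟩
      rw [← hκr, ← hf]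
      simpa using lt_lsub f i)
    have : lsub f ≤ rank β := lsub_le fun i => by
      have := rank_lt_of_mem (hb (f i).toZFSet (ZFSet.mem_range.2 ⟨i, rfl⟩))
      simpa using this
    rw [hf, hκr] at this
    exact absurd (rank_lt_of_mem hβ) (not_lt.2 this)
  · intro x hx
    have hα : x.ord.toZFSet ∈ κ := ord_mem_of_card hκ (isOrdinal_toZFSet _) (by simpa [card_toZFSet] using hx)
    obtain ⟨β, f, hβ, hf⟩ := h.2.2.2 _ hα (powerset x.ord.toZFSet) (fun z => by
      simp only [zmem_iff, mem_powerset]; rfl)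
    have h1 := ((injE_iff _ _ _).1 hf).card_le
    rw [card_powerset, card_toZFSet, Cardinal.card_ord] at h1
    exact h1.trans_lt (hκ.lt hβ)

theorem inacc_pow {μ c : Cardinal.{0}} (h : μ.IsInaccessible) (hc : c < μ) : μ ^ c ≤ μ := by
  by_cases h0 : c = 0
  · subst h0
    rw [Cardinal.power_zero]
    exact Cardinal.one_le_iff_ne_zero.2 h.ne_zero
  have hm : #(c.out × μ.out) = μ := by
    simp only [Cardinal.mk_prod, Cardinal.lift_id, Cardinal.mk_out]
    exact Cardinal.mul_eq_right h.isRegular.aleph0_le hc.le h0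
  have := Cardinal.mk_subset_mk_lt_cof (α := c.out × μ.out) (by rw [hm]; exact h.isStrongLimit.2)
  rw [hm] at this
  conv_rhs => rw [← this]
  have e : μ ^ c = #(c.out → μ.out) := by simp
  rw [e]
  refine Cardinal.mk_le_of_injective (f := fun f => ⟨Set.range fun x => (x, f x), ?_⟩) ?_
  · rw [h.isRegular.cof_ord]
    refine Cardinal.mk_range_le.trans_lt ?_
    simpa using hc
  · intro f g e
    have e' : (Set.range fun x => (x, f x)) = Set.range fun x => (x, g x) := congrArg Subtype.val e
    funext x
    have : (x, f x) ∈ Set.range fun x => (x, g x) := e' ▸ ⟨x, rfl⟩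
    obtain ⟨y, hy⟩ := this
    simp only [Prod.mk.injEq] at hy
    rw [← hy.2, hy.1]

theorem inacc_VV {κ : Z} (h : InaccE zmem κ) : card (VV κ) ≤ card κ ∧ ∀ x ∈ VV κ, card x < card κ := by
  obtain ⟨hκo, hκr⟩ := (cardE_iff κ).1 h.1
  have e : Cardinal.preBeth (rank κ) = card κ := by rw [← hκr]; exact h.inacc.preBeth_ord
  constructor
  · rw [VV, card_vonNeumann, e]
  · intro x hx
    have : x ⊆ V_ (rank x) := by
      intro y hy
      rw [mem_vonNeumann]; exact rank_lt_of_mem hy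
    refine (card_mono this).trans_lt ?_
    rw [card_vonNeumann, ← e]
    exact Cardinal.preBeth_strictMono (mem_VV.1 hx)

end Paper

namespace Paper
open ZFSet Ordinal
open scoped Cardinal

/-- `H(κ⁺)` -/
def HK (κ x : Z) : Prop := ∃ t : Z, t.IsTransitive ∧ x ∈ t ∧ card t ≤ card κ

theorem HK.trC (κ : Z) : TrC (HK κ) := fun _ ⟨t, h1, h2, h3⟩ y hy => ⟨t, h1, h1 _ h2 hy, h3⟩

theorem HK.card {κ x : Z} (h : HK κ x) : card x ≤ ZFSet.card κ := by
  obtain ⟨t, h1, h2, h3⟩ := h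
  exact (card_mono (fun y hy => h1 _ h2 hy)).trans h3

theorem HK.of_sub {κ x : Z} (hκ : ℵ₀ ≤ ZFSet.card κ) (h : ∀ y ∈ x, HK κ y) (hx : ZFSet.card x ≤ ZFSet.card κ) : HK κ x := by
  choose! T h1 h2 h3 using h
  by_cases hne : ∃ y, y ∈ x
  swap
  · have : x = ∅ := by ext y; simpa using fun hy => hne ⟨y, hy⟩
    subst this
    refine ⟨{∅}, ?_, by simp, ?_⟩
    · intro y hy
      rw [mem_singleton] at hy; subst hy
      exact empty_subset _
    · rw [card_singleton]; exact Cardinal.one_le_aleph0.trans hκ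
  refine ⟨insert x (⋃₀ im x T), ?_, by simp, ?_⟩
  · intro y hy z hz
    rw [mem_insert_iff] at hy ⊢
    right
    rw [mem_sUnion]
    rcases hy with rfl | hy
    · exact ⟨T z, mem_im.2 ⟨z, hz, rfl⟩, h2 z hz⟩
    · obtain ⟨t, ht, hyt⟩ := mem_sUnion.1 hy
      obtain ⟨w, hw, rfl⟩ := mem_im.1 ht
      exact ⟨_, ht, h1 w hw _ hyt hz⟩
  · refine card_insert_le.trans (Cardinal.add_le_of_le hκ ?_ (Cardinal.one_le_aleph0.trans hκ))
    obtain ⟨G, hG, hG'⟩ := exists_sj hx hne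
    have : ∀ y, ∃ S : Z → Z, y ∈ x → (∀ z ∈ κ, S z ∈ T y) ∧ ∀ z ∈ T y, ∃ w ∈ κ, S w = z := by
      intro y
      by_cases hy : y ∈ x
      · obtain ⟨S, h4, h5⟩ := exists_sj (h3 y hy) ⟨y, h2 y hy⟩
        exact ⟨S, fun _ => ⟨h4, h5⟩⟩
      · exact ⟨id, fun h => absurd h hy⟩
    choose S hS using this
    refine (card_le_prod (s := κ) (fun ξ η => S (G ξ) η) fun y hy => ?_).trans (Cardinal.mul_le_of_le hκ le_rfl le_rfl)
    obtain ⟨t, ht, hyt⟩ := mem_sUnion.1 hy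
    obtain ⟨w, hw, rfl⟩ := mem_im.1 ht
    obtain ⟨ξ, hξ, rfl⟩ := hG' w hw
    obtain ⟨η, hη, e⟩ := (hS _ hw).2 y hyt
    exact ⟨ξ, hξ, η, hη, e⟩

theorem HK.upair {κ x y : Z} (hκ : ℵ₀ ≤ ZFSet.card κ) (hx : HK κ x) (hy : HK κ y) : HK κ {x, y} := by
  refine HK.of_sub hκ (fun z hz => ?_) ?_
  · rw [mem_pair] at hz
    rcases hz with rfl | rfl <;> assumption
  · refine card_insert_le.trans ?_
    rw [card_singleton]
    exact Cardinal.add_le_of_le hκ (Cardinal.one_le_aleph0.trans hκ) (Cardinal.one_le_aleph0.trans hκ)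

theorem HK.pair {κ x y : Z} (hκ : ℵ₀ ≤ ZFSet.card κ) (hx : HK κ x) (hy : HK κ y) : HK κ (ZFSet.pair x y) := by
  have e : ({x} : Z) = {x, x} := by ext; simp
  unfold ZFSet.pair
  rw [e]
  exact HK.upair hκ (HK.upair hκ hx hx) (HK.upair hκ hx hy)

theorem El.wit {S T : Z → Prop} (h : El S T) (hT : TrC T) {k : ℕ} {P : (Fin k → Z) → Z → Prop}
    (hP : D0 (fun w : Fin (k+1) → Z => P (fun i => w i.castSucc) (w (Fin.last k))))
    (a : Fin k → Z) (ha : ∀ i, S (a i)) (hx : ∃ x, T x ∧ P a x) : ∃ x, S x ∧ P a x := by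
  obtain ⟨φ, h1, h2⟩ := hP.out
  have h3 : ∀ x, Tru φ (Fin.snoc a x) ↔ P a x := fun x => by rw [h2]; simp
  have hT' : ∀ x, T x → (RIn T φ (Fin.snoc a x) ↔ P a x) := fun x hx => by
    rw [delta0_abs hT h1 _ (snoc_sub a (fun i => h.1 _ (ha i)) x hx), h3]
  have h4 := h.2 φ.ex a ha
  rw [RIn_ex, RIn_ex] at h4
  obtain ⟨x, hx, h5⟩ := hx
  obtain ⟨y, hy, h6⟩ := h4.2 ⟨x, hx, (hT' x hx).2 h5⟩
  refine ⟨y, hy, (hT' y (h.1 y hy)).1 ?_⟩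
  exact (h.2 φ _ (snoc_sub a ha y hy)).1 h6

def iffF {k : ℕ} (φ ψ : SetFormula k) : SetFormula k := (φ.imp ψ).and (ψ.imp φ)

theorem RIn_iffF {S : Z → Prop} {k : ℕ} {φ ψ : SetFormula k} {v : Fin k → Z} :
    RIn S (iffF φ ψ) v ↔ (RIn S φ v ↔ RIn S ψ v) := by
  simp only [iffF, RIn_and, RIn_imp]; exact iff_iff_implies_and_implies.symm

def sepF {k : ℕ} (φ : SetFormula (k+1)) : SetFormula (k+1) :=
  .ex (.all (iffF (.mem (Fin.last (k+2)) (Fin.last (k+1)).castSucc)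
    ((SetFormula.mem (Fin.last (k+2)) (Fin.last k).castSucc.castSucc).and
      (ren (Fin.cons (Fin.last (k+2)) fun i : Fin k => i.castSucc.castSucc.castSucc) φ))))

theorem RIn_sepF {S : Z → Prop} {k : ℕ} {φ : SetFormula (k+1)} {p : Fin k → Z} {a : Z} :
    RIn S (sepF φ) (Fin.snoc p a : Fin (k+1) → Z) ↔ ∃ s, S s ∧ ∀ z, S z → (z ∈ s ↔ z ∈ a ∧ RIn S φ (Fin.cons z p : Fin (k+1) → Z)) := by
  have e : ∀ s z : Z, (fun i => (Fin.snoc (Fin.snoc (Fin.snoc p a : Fin (k+1) → Z) s : Fin (k+2) → Z) z : Fin (k+3) → Z)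
      ((Fin.cons (Fin.last (k+2)) fun i : Fin k => i.castSucc.castSucc.castSucc : Fin (k+1) → Fin (k+3)) i)) =
      (Fin.cons z p : Fin (k+1) → Z) := by
    intro s z
    funext i
    refine Fin.cases ?_ (fun i => ?_) i
    · simp
    · simp
  simp only [sepF, RIn_ex, RIn_all, RIn_iffF, RIn_and, RIn_ren, RIn_mem, Fin.snoc_last, Fin.snoc_castSucc, e]

def r1 (k : ℕ) : Fin (k+2) → Fin (k+4) :=
  Fin.cons (Fin.last (k+1)).castSucc.castSucc (Fin.cons (Fin.last (k+2)).castSucc fun i : Fin k => i.castSucc.castSucc.castSucc.castSucc)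
def r2 (k : ℕ) : Fin (k+2) → Fin (k+4) :=
  Fin.cons (Fin.last (k+1)).castSucc.castSucc (Fin.cons (Fin.last (k+3)) fun i : Fin k => i.castSucc.castSucc.castSucc.castSucc)
def r3 (k : ℕ) : Fin (k+2) → Fin (k+4) :=
  Fin.cons (Fin.last (k+3)) (Fin.cons (Fin.last (k+2)).castSucc fun i : Fin k => i.castSucc.castSucc.castSucc.castSucc)

def replF {k : ℕ} (φ : SetFormula (k+2)) : SetFormula (k+1) :=
  (SetFormula.all ((SetFormula.mem (Fin.last (k+1)) (Fin.last k).castSucc).imp (.all (.all ((ren (r1 k) φ).imp ((ren (r2 k) φ).imp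
    (.eq (Fin.last (k+2)).castSucc (Fin.last (k+3))))))))).imp
  (.ex (.all (iffF (.mem (Fin.last (k+2)) (Fin.last (k+1)).castSucc)
    (.ex ((SetFormula.mem (Fin.last (k+3)) (Fin.last k).castSucc.castSucc.castSucc).and (ren (r3 k) φ))))))

theorem RIn_replF {S : Z → Prop} {k : ℕ} {φ : SetFormula (k+2)} {p : Fin k → Z} {a : Z} :
    RIn S (replF φ) (Fin.snoc p a : Fin (k+1) → Z) ↔
      ((∀ x, S x → x ∈ a → ∀ y, S y → ∀ y', S y' → RIn S φ (Fin.cons x (Fin.cons y p : Fin (k+1) → Z) : Fin (k+2) → Z) →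
        RIn S φ (Fin.cons x (Fin.cons y' p : Fin (k+1) → Z) : Fin (k+2) → Z) → y = y') →
      ∃ b, S b ∧ ∀ y, S y → (y ∈ b ↔ ∃ x, S x ∧ x ∈ a ∧
        RIn S φ (Fin.cons x (Fin.cons y p : Fin (k+1) → Z) : Fin (k+2) → Z))) := by
  have e : ∀ s y z : Z, (fun i => (Fin.snoc (Fin.snoc (Fin.snoc (Fin.snoc p a : Fin (k+1) → Z) s : Fin (k+2) → Z) y : Fin (k+3) → Z) z : Fin (k+4) → Z)
      (r1 k i)) = (Fin.cons s (Fin.cons y p : Fin (k+1) → Z) : Fin (k+2) → Z) := by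
    intro s y z
    funext i
    refine Fin.cases ?_ (fun i => Fin.cases ?_ (fun i => ?_) i) i <;> simp [r1]
  have e2 : ∀ s y z : Z, (fun i => (Fin.snoc (Fin.snoc (Fin.snoc (Fin.snoc p a : Fin (k+1) → Z) s : Fin (k+2) → Z) y : Fin (k+3) → Z) z : Fin (k+4) → Z)
      (r2 k i)) = (Fin.cons s (Fin.cons z p : Fin (k+1) → Z) : Fin (k+2) → Z) := by
    intro s y z
    funext i
    refine Fin.cases ?_ (fun i => Fin.cases ?_ (fun i => ?_) i) i <;> simp [r2]
  have e3 : ∀ s y z : Z, (fun i => (Fin.snoc (Fin.snoc (Fin.snoc (Fin.snoc p a : Fin (k+1) → Z) s : Fin (k+2) → Z) y : Fin (k+3) → Z) z : Fin (k+4) → Z)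
      (r3 k i)) = (Fin.cons z (Fin.cons y p : Fin (k+1) → Z) : Fin (k+2) → Z) := by
    intro s y z
    funext i
    refine Fin.cases ?_ (fun i => Fin.cases ?_ (fun i => ?_) i) i <;> simp [r3]
  simp only [replF, RIn_ex, RIn_all, RIn_iffF, RIn_and, RIn_ren, RIn_mem, RIn_eq, RIn_imp, Fin.snoc_last, Fin.snoc_castSucc, e, e2, e3]

theorem HK.sep {κ : Z} (hκ : ℵ₀ ≤ ZFSet.card κ) {k : ℕ} (φ : SetFormula (k+1)) (p : Fin k → Z) (a : Z)
    (ha : HK κ a) : RIn (HK κ) (sepF φ) (Fin.snoc p a : Fin (k+1) → Z) := by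
  rw [RIn_sepF]
  refine ⟨ZFSet.sep (fun z => RIn (HK κ) φ (Fin.cons z p : Fin (k+1) → Z)) a, ?_, fun z _ => by rw [mem_sep]⟩
  have hs : ZFSet.sep (fun z => RIn (HK κ) φ (Fin.cons z p : Fin (k+1) → Z)) a ⊆ a := fun z hz => (mem_sep.1 hz).1
  exact HK.of_sub hκ (fun z hz => HK.trC κ _ ha _ (hs hz)) ((card_mono hs).trans ha.card)

theorem HK.repl {κ : Z} (hκ : ℵ₀ ≤ ZFSet.card κ) {k : ℕ} (φ : SetFormula (k+2)) (p : Fin k → Z) (a : Z)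
    (ha : HK κ a) : RIn (HK κ) (replF φ) (Fin.snoc p a : Fin (k+1) → Z) := by
  rw [RIn_replF]
  intro hf
  let Q : Z → Z → Prop := fun x y => HK κ y ∧ RIn (HK κ) φ (Fin.cons x (Fin.cons y p : Fin (k+1) → Z) : Fin (k+2) → Z)
  classical
  let a' := ZFSet.sep (fun x => ∃ y, Q x y) a
  have hG : ∀ x, ∃ y, x ∈ a' → Q x y := fun x => by
    by_cases h : x ∈ a'
    · obtain ⟨y, hy⟩ := (mem_sep.1 h).2
      exact ⟨y, fun _ => hy⟩
    · exact ⟨∅, fun h' => absurd h' h⟩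
  choose G hG using hG
  have hs : a' ⊆ a := fun z hz => (mem_sep.1 hz).1
  refine ⟨im a' G, HK.of_sub hκ (fun z hz => ?_) ?_, fun y hy => ?_⟩
  · obtain ⟨x, hx, rfl⟩ := mem_im.1 hz
    exact (hG x hx).1
  · exact (card_le_of_surj G fun y hy => mem_im.1 hy).trans ((card_mono hs).trans ha.card)
  · rw [mem_im]
    constructor
    · rintro ⟨x, hx, rfl⟩
      exact ⟨x, HK.trC κ _ ha _ (hs hx), hs hx, (hG x hx).2⟩
    · rintro ⟨x, hx, hxa, h⟩
      have hx' : x ∈ a' := mem_sep.2 ⟨hxa, y, hy, h⟩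
      exact ⟨x, hx', hf x hx hxa _ (hG x hx').1 _ hy (hG x hx').2 h⟩

theorem zf_of {κ M : Z} (hκ : ℵ₀ ≤ ZFSet.card κ) (hM : M.IsTransitive) (hom : om ∈ M) (h : El (fun x => x ∈ M) (HK κ)) :
    ZFMinusModelE zmem M := by
  have hH := HK.trC κ
  refine ⟨?_, ?_, ?_, ?_, ?_, ?_, ?_⟩
  · intro x y hxy
    apply Subtype.ext
    ext z
    exact ⟨fun hz => (hxy ⟨z, hM _ x.2 hz⟩).1 hz, fun hz => (hxy ⟨z, hM _ y.2 hz⟩).2 hz⟩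
  · rintro ⟨a, ha⟩ ⟨b, hb⟩
    obtain ⟨p, hp, e⟩ := h.wit hH (k := 2) (P := fun v x => x = {v 0, v 1}) inferInstance ![a, b] (by
      intro i; fin_cases i
      · exact ha
      · exact hb) ⟨{a, b}, HK.upair hκ (h.1 a ha) (h.1 b hb), rfl⟩
    refine ⟨⟨p, hp⟩, fun z => ?_⟩
    subst e
    simp [zmem]
    exact or_congr ⟨fun h => Subtype.ext h, fun h => congrArg Subtype.val h⟩ ⟨fun h => Subtype.ext h, fun h => congrArg Subtype.val h⟩
  · rintro ⟨a, ha⟩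
    obtain ⟨t, t1, t2, t3⟩ := h.1 a ha
    have hsub : ⋃₀ a ⊆ t := fun z hz => by
      obtain ⟨y, hy, hzy⟩ := mem_sUnion.1 hz
      exact t1 _ (t1 _ t2 hy) hzy
    obtain ⟨u, hu, e1, e2⟩ := h.wit hH (k := 1) (P := fun v x => (∀ z ∈ x, ∃ y ∈ v 0, z ∈ y) ∧ ∀ y ∈ v 0, ∀ z ∈ y, z ∈ x)
      inferInstance ![a] (by intro i; fin_cases i; exact ha) ⟨⋃₀ a, HK.of_sub hκ
        (fun z hz => ⟨t, t1, hsub hz, t3⟩) ((card_mono hsub).trans t3), fun z hz => mem_sUnion.1 hz,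
        fun y hy z hz => mem_sUnion.2 ⟨y, hy, hz⟩⟩
    refine ⟨⟨u, hu⟩, fun z => ⟨fun hz => ?_, fun ⟨y, hy, hz⟩ => e2 _ hy _ hz⟩⟩
    obtain ⟨y, hy, hzy⟩ := e1 z.1 hz
    exact ⟨⟨y, hM _ ha hy⟩, hy, hzy⟩
  · refine ⟨⟨om, hom⟩, ?_, fun y hy => ?_⟩
    · obtain ⟨e, he, e0⟩ := ind_om.1
      subst e0
      exact ⟨⟨∅, hM _ hom he⟩, he, fun z hz => notMem_empty _ hz⟩
    · obtain ⟨s, hs, e⟩ := ind_om.2 _ hy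
      refine ⟨⟨s, hM _ hom hs⟩, hs, fun z => ?_⟩
      subst e
      simp [zmem, or_comm]
      exact or_congr ⟨fun h => Subtype.ext h, fun h => congrArg Subtype.val h⟩ Iff.rfl
  · rintro ⟨a, ha⟩ ⟨z, hz⟩
    have hne : a ≠ ∅ := fun e => by
      subst e; exact notMem_empty _ hz
    obtain ⟨y, hy, e⟩ := regularity a hne
    refine ⟨⟨y, hM _ ha hy⟩, hy, fun w hw hwy => ?_⟩
    have : w.1 ∈ a ∩ y := mem_inter.2 ⟨hw, hwy⟩
    rw [e] at this
    exact notMem_empty _ this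
  · intro k φ p a
    have := HK.sep hκ φ (fun i => (p i).1) a.1 (h.1 _ a.2)
    rw [← h.2 _ _ (snoc_sub (S := fun x => x ∈ M) _ (fun i => (p i).2) _ a.2), RIn_sepF] at this
    obtain ⟨s, hs, h1⟩ := this
    refine ⟨⟨s, hs⟩, fun z => ?_⟩
    have e : (fun i => ((Fin.cons z p : Fin (k+1) → {x // zmem x M}) i).1) = (Fin.cons z.1 fun i => (p i).1) := by
      funext i
      refine Fin.cases ?_ (fun i => ?_) i <;> simp
    rw [realize_sub_iff, e]
    exact h1 z.1 z.2
  · intro k φ p a hf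
    have := HK.repl hκ φ (fun i => (p i).1) a.1 (h.1 _ a.2)
    rw [← h.2 _ _ (snoc_sub (S := fun x => x ∈ M) _ (fun i => (p i).2) _ a.2), RIn_replF] at this
    have e : ∀ x y : {x // zmem x M}, (fun i => ((Fin.cons x (Fin.cons y p : Fin (k+1) → {x // zmem x M}) : Fin (k+2) → {x // zmem x M}) i).1) =
        (Fin.cons x.1 (Fin.cons y.1 fun i => (p i).1 : Fin (k+1) → Z) : Fin (k+2) → Z) := by
      intro x y
      funext i
      refine Fin.cases ?_ (fun i => Fin.cases ?_ (fun i => ?_) i) i <;> simp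
    simp only [realize_sub_iff, e] at hf ⊢
    obtain ⟨b, hb, h1⟩ := this (fun x hx hxa y hy y' hy' h2 h3 =>
      congrArg Subtype.val (hf ⟨x, hx⟩ hxa ⟨y, hy⟩ ⟨y', hy'⟩ h2 h3))
    refine ⟨⟨b, hb⟩, fun y => ?_⟩
    refine (h1 y.1 y.2).trans ?_
    constructor
    · rintro ⟨x, hx, h2, h3⟩
      exact ⟨⟨x, hx⟩, h2, h3⟩
    · rintro ⟨x, h2, h3⟩
      exact ⟨x.1, x.2, h2, h3⟩

end Paper

namespace Paper
open ZFSet Ordinal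
open scoped Cardinal

theorem exists_model {κ : Z} (h : InaccE zmem κ) : ∃ M : Z, M.IsTransitive ∧ VV κ ⊆ M ∧ κ ∈ M ∧ VV κ ∈ M ∧
    rkR (VV κ) κ ∈ M ∧ card M = card κ ∧ ZFMinusModelE zmem M ∧ SmallSeqClosedE zmem M κ := by
  classical
  have hi := h.inacc
  have hκ : ℵ₀ ≤ card κ := hi.isRegular.aleph0_le
  obtain ⟨hκo, hκr⟩ := (cardE_iff κ).1 h.1
  obtain ⟨hV, hV'⟩ := inacc_VV h
  have hκV : κ ⊆ VV κ := fun x hx => mem_VV_of_mem hx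
  have hne : ∅ ∈ VV κ := mem_VV.2 (by
    rw [rank_empty]
    exact (zero_le).trans_lt (rank_lt_of_mem h.om_mem))
  have kV : ∀ x ∈ VV κ, HK κ x := fun x hx => ⟨VV κ, VV_trans κ, hx, hV⟩
  have kVV : HK κ (VV κ) := HK.of_sub hκ kV hV
  have kκ : HK κ κ := HK.of_sub hκ (fun x hx => kV x (hκV hx)) le_rfl
  have kr : HK κ (rkR (VV κ) κ) := by
    have hsub : ∀ p ∈ rkR (VV κ) κ, ∃ x ∈ VV κ, ∃ ρ ∈ VV κ, pair x ρ = p := by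
      intro p hp
      obtain ⟨x, hx, ρ, hρ, rfl⟩ := mem_prod.1 (mem_sep.1 hp).1
      exact ⟨x, hx, ρ, hκV hρ, rfl⟩
    refine HK.of_sub hκ (fun p hp => ?_) ?_
    · obtain ⟨x, hx, ρ, hρ, rfl⟩ := hsub p hp
      exact HK.pair hκ (kV x hx) (kV ρ hρ)
    · exact (card_le_prod (s := VV κ) pair hsub).trans (Cardinal.mul_le_of_le hκ hV hV)
  let P := Fm ⊕ Shrink.{0} κ
  let go : Shrink.{0} κ → Z := fun g => ((equivShrink κ).symm g).1
  have hgo : ∀ g, go g ∈ κ := fun g => ((equivShrink κ).symm g).2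
  let ar : P → Type := Sum.elim (fun p => Fin p.1) (fun g => Shrink.{0} (go g))
  let op : ∀ p : P, (ar p → Z) → Z := fun p => match p with
    | .inl p => fun v => sk (HK κ) p.2 v
    | .inr g => fun v => gr (go g) (fun ξ => if hξ : ξ ∈ go g then v (equivShrink (go g) ⟨ξ, hξ⟩) else ∅)
  have har : ∀ p, #(ar p) < card κ := by
    rintro (p | g)
    · exact (show #(Fin p.1) < ℵ₀ by simp).trans_le hκ
    · exact h.1.lt (hgo g)
  let base := VV κ ∪ {κ, VV κ, rkR (VV κ) κ}
  have hbase : card base ≤ card κ := by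
    have h1 := Cardinal.one_le_aleph0.trans hκ
    have h2 : card ({κ, VV κ, rkR (VV κ) κ} : Z) ≤ card κ := by
      refine card_insert_le.trans (Cardinal.add_le_of_le hκ ?_ h1)
      refine card_insert_le.trans (Cardinal.add_le_of_le hκ ?_ h1)
      rw [card_singleton]; exact h1
    exact card_union_le.trans (Cardinal.add_le_of_le hκ hV h2)
  obtain ⟨M, b1, b2, b3, b4⟩ := exists_closure ar op (card κ) (card κ) hi.isRegular le_rfl (by
      simp only [P, Cardinal.mk_sum, Cardinal.lift_id]
      exact Cardinal.add_le_of_le hκ (mk_Fm.trans hκ) le_rfl) har (fun p => inacc_pow hi (har p)) base hbase ∅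
      (mem_union.2 (Or.inl hne))
  have hMV : VV κ ⊆ M := fun x hx => b1 (mem_union.2 (Or.inl hx))
  have hMκ : κ ∈ M := b1 (by simp [base])
  have hMVV : VV κ ∈ M := b1 (by simp [base])
  have hMr : rkR (VV κ) κ ∈ M := b1 (by simp [base])
  have hEl : El (fun x => x ∈ M) (HK κ) := by
    refine El.of_sk ?_ fun k φ v hv _ => b2 (.inl ⟨k, φ⟩) v hv
    refine b4 _ ?_ ?_
    · intro x hx
      rcases mem_union.1 hx with hx | hx
      · exact kV x hx
      · simp only [mem_insert_iff, mem_singleton] at hx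
        rcases hx with rfl | rfl | rfl <;> assumption
    · rintro (p | g) v hv
      · show HK κ (sk (HK κ) p.2 v)
        by_cases hx : ∃ x, HK κ x ∧ RIn (HK κ) p.2 (Fin.snoc v x)
        · exact (sk_spec hx).1
        · simp only [sk, dif_neg hx]; exact kV _ hne
      · refine HK.of_sub hκ (fun p hp => ?_) ?_
        · obtain ⟨x, hx, rfl⟩ := mem_gr.1 hp
          refine HK.pair hκ (kV x (hκV (hκo.isTransitive _ (hgo g) hx))) ?_
          rw [dif_pos hx]; exact hv _
        · exact (card_le_of_surj (fun x => pair x _) fun y hy => mem_gr.1 hy).trans (h.1.lt (hgo g)).le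
  have hM : M.IsTransitive := by
    intro x hx y hy
    obtain ⟨F, f1, f2⟩ := exists_sj (HK.card (hEl.1 x hx)) ⟨y, hy⟩
    obtain ⟨f, hf, e⟩ := hEl.wit (HK.trC κ) (k := 2) (P := fun v f => Sj f (v 0) (v 1)) inferInstance ![κ, x] (by
      intro i; fin_cases i
      · exact hMκ
      · exact hx) ⟨gr κ F, HK.of_sub hκ (fun p hp => by
          obtain ⟨ξ, hξ, rfl⟩ := mem_gr.1 hp
          exact HK.pair hκ (kV _ (hκV hξ)) (HK.trC κ _ (hEl.1 x hx) _ (f1 ξ hξ)))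
          (card_le_of_surj (fun x => pair x _) fun y hy => mem_gr.1 hy), gr_sj f1 f2⟩
    have e : Sj f κ x := e
    obtain ⟨ξ, hξ, hp⟩ := e.2 y hy
    obtain ⟨y', hy', hp'⟩ := hEl.wit (HK.trC κ) (k := 2) (P := fun v y => pair (v 0) y ∈ v 1) inferInstance ![ξ, f] (by
      intro i; fin_cases i
      · exact hMV (hκV hξ)
      · exact hf) ⟨y, HK.trC κ _ (hEl.1 x hx) _ hy, hp⟩
    rwa [e.1.uniq hp hp']
  refine ⟨M, hM, hMV, hMκ, hMVV, hMr, le_antisymm b3 (card_mono (fun x hx => hMV (hκV hx))),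
    zf_of hκ hM (hMV (hκV h.om_mem)) hEl, fun γ f hγ hf => ?_⟩
  obtain ⟨F, F1, rfl⟩ := ((isFuncE_iff _ _ _).1 hf).exists_fun
  obtain ⟨g, rfl⟩ : ∃ g, go g = γ := ⟨equivShrink κ ⟨γ, (zmem_iff _ _).1 hγ⟩, by simp [go]⟩
  have := b2 (.inr g) (fun x => F ((equivShrink (go g)).symm x).1) (fun x => F1 _ ((equivShrink (go g)).symm x).2)
  have e : op (.inr g) (fun x => F ((equivShrink (go g)).symm x).1) = gr (go g) F := by
    show gr (go g) _ = _
    ext p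
    rw [mem_gr, mem_gr]
    refine exists_congr fun x => and_congr_right fun hx => ?_
    rw [dif_pos hx]
    simp
  rwa [e] at this

end Paper

namespace Paper
open ZFSet Ordinal
open scoped Cardinal

theorem one_two {κ : Z} {m : ℕ} (h : CnStronglyUnfoldableE zmem (m+1) κ) : CnE zmem (m+2) κ := by
  obtain ⟨hin, h⟩ := h
  obtain ⟨hκo, hκr⟩ := (cardE_iff κ).1 hin.1
  obtain ⟨hV, hV'⟩ := inacc_VV hin
  rw [cnE_iff]
  refine ⟨hκo, SgE.of_down (VV_trC κ) (fun _ _ _ _ => trivial) (fun _ _ => trivial) fun k φ hφ v hv hT => ?_⟩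
  obtain ⟨M, hM, hMV, hMκ, hMVV, hMr, hMc, hMz, hMs⟩ := exists_model hin
  obtain ⟨l, hl, hκl, hEl, hc⟩ := exists_cn κ
  have hκl' : κ ∈ l := (mem_ord_iff hl).2 ⟨hκo, mem_VV.1 hκl⟩
  have hvl : ∀ i, v i ∈ VV l := fun i => mem_VV.2 ((mem_VV.1 (hv i)).trans (mem_VV.1 hκl))
  have hT1 : RIn (fun x => x ∈ VV l) φ v := (hEl.2 φ v hvl).2 hT
  obtain ⟨F, F1, F2, F3⟩ := exists_bj hMc.symm
  obtain ⟨N, j, κ', hN, hVN, hj, hel, hid, hjκ, hlκ', hsg⟩ := h l (hc _) hκl' M (fun y hy z hz => hM y hy hz) hMz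
    ⟨_, (bijE_iff _ _ _).2 (gr_bj F1 F2 F3)⟩ hMκ hMs
  obtain ⟨J, J1, rfl⟩ := ((isFuncE_iff _ _ _).1 hj).exists_fun
  have hMt : TrC (fun x => x ∈ M) := fun x hx y hy => hM x hx hy
  have hNt : TrC (fun x => x ∈ N) := fun x hx y hy => hN x hx y hy
  have hJ : ∀ {k : ℕ} (φ : SetFormula k) (v : Fin k → Z), (∀ i, v i ∈ M) →
      (RIn (fun x => x ∈ M) φ v ↔ RIn (fun x => x ∈ N) φ (fun i => J (v i))) := by
    intro k φ v hv
    have := hel φ v (fun i => J (v i)) hv (fun i => by rw [pairMemE_iff, pair_mem_gr]; exact ⟨hv i, rfl⟩)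
    simp only [realizeIn_iff, zmem_iff] at this
    constructor
    · intro h1; exact (this.1 ⟨hv, h1⟩).2
    · intro h1; exact (this.2 ⟨fun i => J1 _ (hv i), h1⟩).2
  have tr : ∀ {k : ℕ} {P : (Fin k → Z) → Prop}, D0 P → ∀ v : Fin k → Z, (∀ i, v i ∈ M) → (P v ↔ P fun i => J (v i)) := by
    intro k P hP v hv
    obtain ⟨φ, p1, p2⟩ := hP.out
    rw [← p2, ← p2, ← delta0_abs hMt p1 v hv, ← delta0_abs hNt p1 _ (fun i => J1 _ (hv i))]
    exact hJ φ v hv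
  have Jκ : J κ = κ' := (pair_mem_gr.1 ((pairMemE_iff _ _ _).1 hjκ)).2
  have Jid : ∀ α ∈ κ, J α = α := fun α hα => (pair_mem_gr.1 ((pairMemE_iff _ _ _).1 (hid α hα))).2
  have hκ'o : κ'.IsOrdinal := by
    have := (tr (k := 1) (P := fun v => (v 0).IsOrdinal) inferInstance ![κ] (by intro i; fin_cases i; exact hMκ)).1 hκo
    rw [← Jκ]; exact this
  have JV : ∀ x, x ∈ VV κ → J x = x := by
    intro x
    induction x using ZFSet.inductionOn with
    | _ x ih =>
    intro hx
    have hγ : cardOrd x ∈ κ := ord_mem_of_card hin.1 (cardOrd_ord x) (by rw [card_cardOrd]; exact hV' x hx)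
    obtain ⟨G, g1, g2, g3⟩ := exists_bj (card_cardOrd x)
    have hf : gr (cardOrd x) G ∈ M := hMs _ _ hγ ((isFuncE_iff _ _ _).2 (gr_fn fun ξ hξ => hM x (hMV hx) (g1 ξ hξ)))
    have hS := (tr (k := 3) (P := fun v => Sj (v 0) (v 1) (v 2)) inferInstance ![gr (cardOrd x) G, cardOrd x, x] (by
      intro i; fin_cases i
      · exact hf
      · exact hMV (mem_VV_of_mem hγ)
      · exact hMV hx)).1 (gr_sj g1 g3)
    replace hS : Sj (J (gr (cardOrd x) G)) (J (cardOrd x)) (J x) := hS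
    rw [Jid _ hγ] at hS
    have key : ∀ ξ ∈ cardOrd x, pair ξ (G ξ) ∈ J (gr (cardOrd x) G) := by
      intro ξ hξ
      have hξκ : ξ ∈ κ := hκo.isTransitive _ hγ hξ
      have := (tr (k := 3) (P := fun v => pair (v 0) (v 1) ∈ v 2) inferInstance ![ξ, G ξ, gr (cardOrd x) G] (by
        intro i; fin_cases i
        · exact hMV (mem_VV_of_mem hξκ)
        · exact hM x (hMV hx) (g1 ξ hξ)
        · exact hf)).1 (pair_mem_gr.2 ⟨hξ, rfl⟩)
      replace this : pair (J ξ) (J (G ξ)) ∈ J (gr (cardOrd x) G) := this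
      rwa [Jid ξ hξκ, ih _ (g1 ξ hξ) (VV_trans κ x hx (g1 ξ hξ))] at this
    ext y
    constructor
    · intro hy
      obtain ⟨ξ, hξ, hp⟩ := hS.2 y hy
      rw [hS.1.uniq hp (key ξ hξ)]
      exact g1 ξ hξ
    · intro hy
      obtain ⟨ξ, hξ, rfl⟩ := g3 y hy
      exact (hS.1.dom (key ξ hξ)).2
  -- the image of `V_κ`
  have hC : ∀ x ∈ N, (x ∈ J (VV κ) ↔ x ∈ VV κ') := by
    have h1 : ∀ x ∈ M, RkB (VV κ) κ (rkR (VV κ) κ) x :=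
      RkB.ex hMt hκo (fun x => ⟨fun hx => ⟨hMV hx, hx⟩, fun hx => hx.2⟩) rfl
    obtain ⟨ψ, p1, p2⟩ := (inferInstance : D0 (fun v : Fin 4 → Z => RkB (v 0) (v 1) (v 2) (v 3))).out
    have hw : ∀ i, (![VV κ, κ, rkR (VV κ) κ] : Fin 3 → Z) i ∈ M := by
      intro i; fin_cases i
      · exact hMVV
      · exact hMκ
      · exact hMr
    have h2 := (hJ (SetFormula.all ψ) ![VV κ, κ, rkR (VV κ) κ] hw).1 (by
      rw [RIn_all]
      intro x hx
      rw [delta0_abs hMt p1 _ (snoc_sub (S := fun x => x ∈ M) _ hw x hx), p2]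
      exact h1 x hx)
    rw [RIn_all] at h2
    have h3 : ∀ x ∈ N, RkB (J (VV κ)) κ' (J (rkR (VV κ) κ)) x := by
      intro x hx
      have h4 := h2 x hx
      rw [delta0_abs hNt p1 _ (snoc_sub (S := fun x => x ∈ N) _ (fun i => J1 _ (hw i)) x hx), p2] at h4
      rw [← Jκ]
      exact h4
    exact RkB.spec hNt hκ'o h3
  have hsg' := ((sgE_iff _ _ _).1 hsg).up hφ v (fun i => (vmemE_iff _ _).2 ⟨hl, hvl i⟩) (by
    convert hT1 using 2
    rw [vmemE_iff]; simp [hl])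
  have e : (fun x => zmem x N ∧ VMemE zmem x κ') = fun x => x ∈ J (VV κ) := by
    funext x
    apply propext
    rw [vmemE_iff, zmem_iff]
    constructor
    · rintro ⟨h1, -, h2⟩; exact (hC x h1).2 h2
    · intro h1
      have h2 := hNt _ (J1 _ hMVV) x h1
      exact ⟨h2, hκ'o, (hC x h2).1 h1⟩
  rw [e] at hsg'
  have fin := tr (D0.rel (l := k+1) φ (Fin.last k) Fin.castSucc) (Fin.snoc v (VV κ) : Fin (k+1) → Z)
    (snoc_sub (S := fun x => x ∈ M) v (fun i => hMV (hv i)) _ hMVV)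
  simp only [Fin.snoc_last, Fin.snoc_castSucc] at fin
  refine fin.2 ?_
  convert hsg' using 2 with i
  exact JV _ (hv i)

end Paper

namespace Paper

/-- **Lemma 4.1.** Given a natural number `n > 0`, the following are equivalent for
every `C⁽ⁿ⁾`-weakly shrewd cardinal `κ`:
(1) `κ` is `C⁽ⁿ⁾`-strongly unfoldable;
(2) `κ` is an element of `C⁽ⁿ⁺¹⁾`;
(3) there is no ordinal `ε ≥ κ` such that the set `{ε}` is definable by a
    `Σₙ₊₁`-formula with parameters in `H(κ)`. -/
theorem cnWeaklyShrewd_unfoldable_tfae (n : ℕ) (hn : 0 < n) (κ : ZFSet.{0})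
    (hκ : CnWeaklyShrewdE zmem n κ) :
    (CnStronglyUnfoldableE zmem n κ ↔ CnE zmem (n + 1) κ) ∧
    (CnE zmem (n + 1) κ ↔
      ¬ ∃ ε : ZFSet.{0}, OrdE zmem ε ∧ (κ ∈ ε ∨ κ = ε) ∧
        SigmaDefinableSingleton (n + 1) ε fun x => HMemE zmem x κ) := by
  obtain ⟨m, rfl⟩ : ∃ m, n = m + 1 := ⟨n - 1, by omega⟩
  exact ⟨⟨one_two, two_one hκ⟩, ⟨two_three hκ.1, three_two hκ.1⟩⟩

end Paper
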